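/- arXiv:1510.02331 — 2 statements merged into one kernel-verified Lean document; each statement's English description precedes it below -/
import Mathlib

section
/- Let C ⊆ ℝ³ be the cuboctahedron given as the convex hull of the 12 points obtained as all coordinate permutations of (±1, ±1, 0). Then every translative packing of C has upper density at most 0.9365. -/
open MeasureTheory Filter Metric

/-- A translative packing of `K`: a set of translation vectors such that the translates
of the interior of `K` are pairwise disjoint. -/
def IsTranslativePacking (K X : Set (EuclideanSpace ℝ (Fin 3))) : Prop :=
  ∀ x ∈ X, ∀ y ∈ X, x ≠ y →
    Disjoint ((fun z => x + z) '' interior K) ((fun z => y + z) '' interior K)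

/-- The upper density of a translative packing `X` of the body `K`. -/
noncomputable def packingUpperDensity (K X : Set (EuclideanSpace ℝ (Fin 3))) : ℝ :=
  Filter.limsup (fun r : ℝ => ⨆ c : EuclideanSpace ℝ (Fin 3),
    (volume (closedBall c r ∩ ⋃ x ∈ X, (fun z => x + z) '' K) /
      volume (closedBall c r)).toReal) Filter.atTop


namespace Cubo

/-- linear interpolation -/
noncomputable def I (φ : ℤ → ℝ) (d : ℝ) : ℝ :=
  (1 - Int.fract d) * φ ⌊d⌋ + Int.fract d * φ (⌊d⌋ + 1)

lemma floor_add_fract (d u : ℝ) (h0 : 0 ≤ u) (h1 : u < 1) :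
    ⌊d + u⌋ = if u < 1 - Int.fract d then ⌊d⌋ else ⌊d⌋ + 1 := by
  have e := Int.floor_add_fract d
  have f0 := Int.fract_nonneg d
  have f1 := Int.fract_lt_one d
  split_ifs with h
  · rw [Int.floor_eq_iff]; constructor <;> linarith
  · rw [Int.floor_eq_iff]; push_cast; constructor <;> linarith

lemma floor_diff (x y τ : ℝ) :
    ⌊x + τ⌋ - ⌊y + τ⌋ = ⌊(x - y) + Int.fract (y + τ)⌋ := by
  have : (x - y) + Int.fract (y + τ) = (x + τ) - (⌊y + τ⌋ : ℤ) := by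
    rw [Int.fract]; ring
  rw [this, Int.floor_sub_intCast]

lemma meas_g (φ : ℤ → ℝ) (d : ℝ) : Measurable (fun t : ℝ => φ ⌊d + Int.fract t⌋) := by
  have : Measurable (fun t : ℝ => ⌊d + Int.fract t⌋) :=
    Int.measurable_floor.comp (measurable_const.add measurable_fract)
  exact (measurable_from_top (f := φ)).comp this

lemma bdd_g (φ : ℤ → ℝ) (d t : ℝ) :
    ‖φ ⌊d + Int.fract t⌋‖ ≤ |φ ⌊d⌋| + |φ (⌊d⌋ + 1)| := by
  rw [floor_add_fract d _ (Int.fract_nonneg t) (Int.fract_lt_one t), Real.norm_eq_abs]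
  split_ifs
  · linarith [abs_nonneg (φ (⌊d⌋ + 1))]
  · linarith [abs_nonneg (φ (⌊d⌋))]

lemma ii_g (φ : ℤ → ℝ) (d a b : ℝ) :
    IntervalIntegrable (fun t : ℝ => φ ⌊d + Int.fract t⌋) volume a b := by
  rw [intervalIntegrable_iff]
  refine Measure.integrableOn_of_bounded (M := |φ ⌊d⌋| + |φ (⌊d⌋ + 1)|) ?_
    (meas_g φ d).aestronglyMeasurable ?_
  · simp [Set.uIoc]
  · exact Filter.Eventually.of_forall (fun t => bdd_g φ d t)

lemma int_g (φ : ℤ → ℝ) (d : ℝ) : ∫ t in (0:ℝ)..1, φ ⌊d + Int.fract t⌋ = I φ d := by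
  have f0 := Int.fract_nonneg d
  have f1 := Int.fract_lt_one d
  rw [← intervalIntegral.integral_add_adjacent_intervals (ii_g φ d 0 (1 - Int.fract d))
    (ii_g φ d (1 - Int.fract d) 1)]
  have e1 : ∫ t in (0:ℝ)..(1 - Int.fract d), φ ⌊d + Int.fract t⌋
      = ∫ t in (0:ℝ)..(1 - Int.fract d), φ ⌊d⌋ := by
    rw [intervalIntegral.integral_of_le (by linarith), intervalIntegral.integral_of_le (by linarith),
      ← integral_Ico_eq_integral_Ioc, ← integral_Ico_eq_integral_Ioc]
    refine setIntegral_congr_fun measurableSet_Ico ?_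
    intro t ht
    have : Int.fract t = t := Int.fract_eq_self.2 ⟨ht.1, by linarith [ht.2]⟩
    simp only [this]
    rw [floor_add_fract d t ht.1 (by linarith [ht.2]), if_pos ht.2]
  have e2 : ∫ t in (1 - Int.fract d)..(1:ℝ), φ ⌊d + Int.fract t⌋
      = ∫ t in (1 - Int.fract d)..(1:ℝ), φ (⌊d⌋ + 1) := by
    rw [intervalIntegral.integral_of_le (by linarith), intervalIntegral.integral_of_le (by linarith),
      ← integral_Ico_eq_integral_Ioc, ← integral_Ico_eq_integral_Ioc]
    refine setIntegral_congr_fun measurableSet_Ico ?_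
    intro t ht
    have : Int.fract t = t := Int.fract_eq_self.2 ⟨by linarith [ht.1], ht.2⟩
    simp only [this]
    rw [floor_add_fract d t (by linarith [ht.1]) ht.2, if_neg (by linarith [ht.1])]
  rw [e1, e2]
  simp [I]

lemma int_g' (φ : ℤ → ℝ) (x y : ℝ) :
    ∫ τ in (0:ℝ)..1, φ (⌊x + τ⌋ - ⌊y + τ⌋) = I φ (x - y) := by
  simp_rw [floor_diff]
  rw [intervalIntegral.integral_comp_add_left (fun t => φ ⌊(x - y) + Int.fract t⌋) y]
  have hp : Function.Periodic (fun t : ℝ => φ ⌊(x - y) + Int.fract t⌋) 1 := by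
    intro t; simp
  have := hp.intervalIntegral_add_eq y 0
  simp only [add_zero, zero_add] at this ⊢
  rw [this, int_g]

lemma ii_g' (φ : ℤ → ℝ) (x y : ℝ) :
    IntervalIntegrable (fun τ : ℝ => φ (⌊x + τ⌋ - ⌊y + τ⌋)) volume 0 1 := by
  simp_rw [floor_diff]
  have := (ii_g φ (x - y) (y + 0) (y + 1)).comp_add_left y
  simpa using this

lemma avg {P : Type*} (S : Finset P) (x y : P → ℝ) (φ : P → ℤ → ℝ) :
    ∃ τ : ℝ, 0 ≤ τ ∧ τ ≤ 1 ∧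
      ∑ p ∈ S, φ p (⌊x p + τ⌋ - ⌊y p + τ⌋) ≤ ∑ p ∈ S, I (φ p) (x p - y p) := by
  by_contra hcon
  push Not at hcon
  set c := ∑ p ∈ S, I (φ p) (x p - y p) with hc
  set F : ℝ → ℝ := fun τ => ∑ p ∈ S, φ p (⌊x p + τ⌋ - ⌊y p + τ⌋) with hF
  have hi : IntervalIntegrable F volume 0 1 :=
    intervalIntegrable_iff.2 (integrable_finsetSum S
      (fun p _ => intervalIntegrable_iff.1 (ii_g' (φ p) (x p) (y p))))
  have hint : ∫ τ in (0:ℝ)..1, F τ = c := by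
    rw [hF, hc, intervalIntegral.integral_finsetSum (fun p _ => ii_g' (φ p) (x p) (y p))]
    exact Finset.sum_congr rfl (fun p _ => int_g' _ _ _)
  have hpos : 0 < ∫ τ in (0:ℝ)..1, (F τ - c) := by
    refine intervalIntegral.intervalIntegral_pos_of_pos_on (hi.sub intervalIntegrable_const) ?_ zero_lt_one
    intro t ht
    have := hcon t ht.1.le ht.2.le
    simp only [hF]; linarith
  rw [intervalIntegral.integral_sub hi intervalIntegrable_const, hint] at hpos
  simp at hpos

/-- trilinear interpolation -/
noncomputable def T (A : ℤ → ℤ → ℤ → ℝ) (a b c : ℝ) : ℝ :=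
  I (fun i => I (fun j => I (fun k => A i j k) c) b) a

lemma avg3 {P : Type*} (S : Finset P) (x1 x2 x3 : P → ℝ) (A : ℤ → ℤ → ℤ → ℝ) :
    ∃ t1 t2 t3 : ℝ, (0 ≤ t1 ∧ t1 ≤ 1) ∧ (0 ≤ t2 ∧ t2 ≤ 1) ∧ (0 ≤ t3 ∧ t3 ≤ 1) ∧
      ∑ p ∈ S, ∑ q ∈ S, A (⌊x1 p + t1⌋ - ⌊x1 q + t1⌋) (⌊x2 p + t2⌋ - ⌊x2 q + t2⌋)
        (⌊x3 p + t3⌋ - ⌊x3 q + t3⌋)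
      ≤ ∑ p ∈ S, ∑ q ∈ S, T A (x1 p - x1 q) (x2 p - x2 q) (x3 p - x3 q) := by
  obtain ⟨t1, h10, h11, h1⟩ := avg (S ×ˢ S) (fun p => x1 p.1) (fun p => x1 p.2)
    (fun p i => I (fun j => I (fun k => A i j k) (x3 p.1 - x3 p.2)) (x2 p.1 - x2 p.2))
  obtain ⟨t2, h20, h21, h2⟩ := avg (S ×ˢ S) (fun p => x2 p.1) (fun p => x2 p.2)
    (fun p j => I (fun k => A (⌊x1 p.1 + t1⌋ - ⌊x1 p.2 + t1⌋) j k) (x3 p.1 - x3 p.2))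
  obtain ⟨t3, h30, h31, h3⟩ := avg (S ×ˢ S) (fun p => x3 p.1) (fun p => x3 p.2)
    (fun p k => A (⌊x1 p.1 + t1⌋ - ⌊x1 p.2 + t1⌋) (⌊x2 p.1 + t2⌋ - ⌊x2 p.2 + t2⌋) k)
  refine ⟨t1, t2, t3, ⟨h10, h11⟩, ⟨h20, h21⟩, ⟨h30, h31⟩, ?_⟩
  rw [← Finset.sum_product', ← Finset.sum_product']
  exact h3.trans (h2.trans h1)

end Cubo

namespace Cubo

abbrev Z3 := ℤ × ℤ × ℤ

def corr (bx : Finset Z3) (h : Z3 → ℤ) (v : Z3) : ℤ := ∑ k ∈ bx, h k * h (k + v)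

lemma corr_sum {ι : Type*} (bx : Finset Z3) (h : Z3 → ℤ) (hs : ∀ k, k ∉ bx → h k = 0)
    (F : Finset ι) (Y : ι → Z3) (W : Finset Z3) (hW : ∀ i ∈ F, ∀ k ∈ bx, Y i + k ∈ W) :
    ∑ i ∈ F, ∑ j ∈ F, corr bx h (Y i - Y j) = ∑ w ∈ W, (∑ i ∈ F, h (w - Y i)) ^ 2 := by
  have key : ∀ i ∈ F, ∀ j ∈ F, corr bx h (Y i - Y j) = ∑ w ∈ W, h (w - Y i) * h (w - Y j) := by
    intro i hi j _
    unfold corr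
    have e : ∑ k ∈ bx, h k * h (k + (Y i - Y j))
        = ∑ w ∈ bx.map (addLeftEmbedding (Y i)), h (w - Y i) * h (w - Y j) := by
      rw [Finset.sum_map]
      refine Finset.sum_congr rfl (fun k _ => ?_)
      simp only [addLeftEmbedding_apply]
      congr 2 <;> abel
    rw [e]
    refine Finset.sum_subset ?_ ?_
    · intro w hw
      rw [Finset.mem_map] at hw
      obtain ⟨k, hk, rfl⟩ := hw
      exact hW i hi k hk
    · intro w _ hw
      rw [hs (w - Y i), zero_mul]
      intro hk
      apply hw
      rw [Finset.mem_map]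
      exact ⟨w - Y i, hk, by simp⟩
  rw [Finset.sum_congr rfl (fun i hi => Finset.sum_congr rfl (fun j hj => key i hi j hj))]
  simp_rw [sq, Finset.sum_mul_sum]
  rw [Finset.sum_comm' (s := W) (t := fun _ => F) (t' := F) (s' := fun _ => W) (by simp)]
  refine Finset.sum_congr rfl (fun i _ => ?_)
  rw [Finset.sum_comm]

lemma corr_nonneg {ι : Type*} (bx : Finset Z3) (h : Z3 → ℤ) (hs : ∀ k, k ∉ bx → h k = 0)
    (F : Finset ι) (Y : ι → Z3) : 0 ≤ ∑ i ∈ F, ∑ j ∈ F, corr bx h (Y i - Y j) := by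
  classical
  rw [corr_sum bx h hs F Y (F.biUnion (fun i => bx.image (fun k => Y i + k)))]
  · exact Finset.sum_nonneg (fun w _ => sq_nonneg _)
  · intro i hi k hk
    exact Finset.mem_biUnion.2 ⟨i, hi, Finset.mem_image_of_mem _ hk⟩

lemma corr_lower {ι : Type*} (bx : Finset Z3) (h : Z3 → ℤ) (hs : ∀ k, k ∉ bx → h k = 0)
    (F : Finset ι) (Y : ι → Z3) (W : Finset Z3) (hW : ∀ i ∈ F, ∀ k ∈ bx, Y i + k ∈ W) :
    ((F.card : ℤ) * ∑ k ∈ bx, h k) ^ 2 ≤ W.card * ∑ i ∈ F, ∑ j ∈ F, corr bx h (Y i - Y j) := by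
  rw [corr_sum bx h hs F Y W hW]
  have e : (F.card : ℤ) * ∑ k ∈ bx, h k = ∑ w ∈ W, ∑ i ∈ F, h (w - Y i) := by
    rw [Finset.sum_comm, ← nsmul_eq_mul, ← Finset.sum_const]
    refine Finset.sum_congr rfl (fun i hi => ?_)
    have e : ∑ k ∈ bx, h k = ∑ w ∈ bx.map (addLeftEmbedding (Y i)), h (w - Y i) := by
      rw [Finset.sum_map]
      refine Finset.sum_congr rfl (fun k _ => ?_)
      simp only [addLeftEmbedding_apply]
      congr 1; abel
    rw [e]
    refine Finset.sum_subset ?_ ?_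
    · intro w hw
      rw [Finset.mem_map] at hw
      obtain ⟨k, hk, rfl⟩ := hw
      exact hW i hi k hk
    · intro w _ hw
      rw [hs (w - Y i)]
      intro hk
      apply hw
      rw [Finset.mem_map]
      exact ⟨w - Y i, hk, by simp⟩
  rw [e]
  exact sq_sum_le_card_mul_sum_sq

end Cubo

namespace Cubo

lemma I_neg (φ : ℤ → ℝ) (d : ℝ) : I φ (-d) = I (fun m => φ (-m)) d := by
  unfold I
  by_cases h : Int.fract d = 0
  · have hd : d = (⌊d⌋ : ℤ) := by
      have := Int.floor_add_fract d; rw [h] at this; linarith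
    rw [hd]
    simp only [Int.floor_intCast, Int.fract_intCast]
    rw [← Int.cast_neg]
    simp only [Int.floor_intCast, Int.fract_intCast]
    simp
  · rw [Int.fract_neg h]
    have : ⌊-d⌋ = -⌊d⌋ - 1 := by
      have e1 := Int.floor_add_fract d
      have f1 := Int.fract_lt_one d
      have f0 := (Int.fract_nonneg d).lt_of_ne' h
      rw [Int.floor_eq_iff]; push_cast; constructor <;> linarith
    rw [this]
    have e2 : -⌊d⌋ - 1 + 1 = -⌊d⌋ := by ring
    have e3 : -(⌊d⌋ + 1) = -⌊d⌋ - 1 := by ring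
    simp only [e2, e3]; ring

lemma I_abs (φ : ℤ → ℝ) (hφ : ∀ m, φ (-m) = φ m) (d : ℝ) : I φ d = I φ |d| := by
  rcases abs_choice d with h | h
  · rw [h]
  · rw [h, I_neg]; simp_rw [hφ]

lemma T_abs (A : ℤ → ℤ → ℤ → ℝ) (h1 : ∀ i j k, A (-i) j k = A i j k)
    (h2 : ∀ i j k, A i (-j) k = A i j k) (h3 : ∀ i j k, A i j (-k) = A i j k) (a b c : ℝ) :
    T A a b c = T A |a| |b| |c| := by
  unfold T
  rw [I_abs _ (fun m => by simp_rw [h1])]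
  simp_rw [I_abs (fun k => A _ _ k) (fun m => h3 _ _ m) c]
  congr 1
  ext i
  rw [I_abs _ (fun m => by simp_rw [h2])]

lemma core1 (x y z : ℝ) (hx0 : 0 ≤ x) (hx1 : x ≤ 1) (hy0 : 0 ≤ y) (hy1 : y ≤ 1)
    (hz0 : 0 ≤ z) (hz1 : z ≤ 1) (hs : 1 ≤ x + y + z)
    (f000 f001 f010 f011 f100 f101 f110 f111 : ℝ)
    (h001 : f001 ≤ 0) (h010 : f010 ≤ 0) (h100 : f100 ≤ 0) (h011 : f011 ≤ 0) (h101 : f101 ≤ 0)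
    (h110 : f110 ≤ 0) (h111 : f111 ≤ 0)
    (g011 : f000 + f011 ≤ 0) (g101 : f000 + f101 ≤ 0) (g110 : f000 + f110 ≤ 0)
    (g111 : 2 * f000 + f111 ≤ 0) :
    (1 - x) * ((1 - y) * ((1 - z) * f000 + z * f001) + y * ((1 - z) * f010 + z * f011))
    + x * ((1 - y) * ((1 - z) * f100 + z * f101) + y * ((1 - z) * f110 + z * f111)) ≤ 0 := by
  have X : 0 ≤ 1 - x := by linarith
  have Y : 0 ≤ 1 - y := by linarith
  have Z : 0 ≤ 1 - z := by linarith
  have t000 : 0 ≤ (1 - x) * (1 - y) * (1 - z) := by positivity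
  have t001 := mul_nonpos_of_nonneg_of_nonpos (show 0 ≤ (1 - x) * (1 - y) * z by positivity) h001
  have t010 := mul_nonpos_of_nonneg_of_nonpos (show 0 ≤ (1 - x) * y * (1 - z) by positivity) h010
  have t100 := mul_nonpos_of_nonneg_of_nonpos (show 0 ≤ x * (1 - y) * (1 - z) by positivity) h100
  rcases le_or_gt f000 0 with h | h
  · have q := mul_nonpos_of_nonneg_of_nonpos t000 h
    have t011 := mul_nonpos_of_nonneg_of_nonpos (show 0 ≤ (1 - x) * y * z by positivity) h011
    have t101 := mul_nonpos_of_nonneg_of_nonpos (show 0 ≤ x * (1 - y) * z by positivity) h101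
    have t110 := mul_nonpos_of_nonneg_of_nonpos (show 0 ≤ x * y * (1 - z) by positivity) h110
    have t111 := mul_nonpos_of_nonneg_of_nonpos (show 0 ≤ x * y * z by positivity) h111
    linarith
  · have t011 := mul_nonpos_of_nonneg_of_nonpos (show 0 ≤ (1 - x) * y * z by positivity) g011
    have t101 := mul_nonpos_of_nonneg_of_nonpos (show 0 ≤ x * (1 - y) * z by positivity) g101
    have t110 := mul_nonpos_of_nonneg_of_nonpos (show 0 ≤ x * y * (1 - z) by positivity) g110
    have t111 := mul_nonpos_of_nonneg_of_nonpos (show 0 ≤ x * y * z by positivity) g111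
    have q := mul_nonpos_of_nonneg_of_nonpos h.le (show 1 - (x + y + z) ≤ 0 by linarith)
    linarith

lemma core2 (u v w : ℝ) (hu : 0 ≤ u) (hv : 0 ≤ v) (hw : 0 ≤ w) (hs : u + v + w ≤ 1)
    (c cu cv cw cuv cuw cvw cuvw : ℝ)
    (h0 : c ≤ 0) (h1 : c + cu ≤ 0) (h2 : c + cv ≤ 0) (h3 : c + cw ≤ 0)
    (s1 : 6 * c + 2 * (cu + cv) + cuv ≤ 0) (s2 : 6 * c + 2 * (cu + cw) + cuw ≤ 0)
    (s3 : 6 * c + 2 * (cv + cw) + cvw ≤ 0)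
    (a1 : 3 * c + (2 * cu + cv) + cuv ≤ 0) (b1 : 3 * c + (cu + 2 * cv) + cuv ≤ 0)
    (a2 : 3 * c + (2 * cu + cw) + cuw ≤ 0) (b2 : 3 * c + (cu + 2 * cw) + cuw ≤ 0)
    (a3 : 3 * c + (2 * cv + cw) + cvw ≤ 0) (b3 : 3 * c + (cv + 2 * cw) + cvw ≤ 0)
    (t : 6 * c + 2 * (cu + cv + cw) + cuv + cuw + cvw + cuvw ≤ 0) :
    c + cu * u + cv * v + cw * w + cuv * (u * v) + cuw * (u * w) + cvw * (v * w)
      + cuvw * (u * v * w) ≤ 0 := by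
  obtain ⟨s, hs'⟩ : ∃ s, s = 1 - u - v - w := ⟨_, rfl⟩
  have s0 : 0 ≤ s := by linarith
  have k0 := mul_nonpos_of_nonneg_of_nonpos (show 0 ≤ s * s * s by positivity) h0
  have k1 := mul_nonpos_of_nonneg_of_nonpos (show 0 ≤ s * s * u by positivity) (show 3 * c + cu ≤ 0 by linarith)
  have k2 := mul_nonpos_of_nonneg_of_nonpos (show 0 ≤ s * s * v by positivity) (show 3 * c + cv ≤ 0 by linarith)
  have k3 := mul_nonpos_of_nonneg_of_nonpos (show 0 ≤ s * s * w by positivity) (show 3 * c + cw ≤ 0 by linarith)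
  have l1 := mul_nonpos_of_nonneg_of_nonpos (show 0 ≤ s * u * u by positivity) (show 3 * c + 2 * cu ≤ 0 by linarith)
  have l2 := mul_nonpos_of_nonneg_of_nonpos (show 0 ≤ s * v * v by positivity) (show 3 * c + 2 * cv ≤ 0 by linarith)
  have l3 := mul_nonpos_of_nonneg_of_nonpos (show 0 ≤ s * w * w by positivity) (show 3 * c + 2 * cw ≤ 0 by linarith)
  have m1 := mul_nonpos_of_nonneg_of_nonpos (show 0 ≤ u * u * u by positivity) h1
  have m2 := mul_nonpos_of_nonneg_of_nonpos (show 0 ≤ v * v * v by positivity) h2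
  have m3 := mul_nonpos_of_nonneg_of_nonpos (show 0 ≤ w * w * w by positivity) h3
  have n1 := mul_nonpos_of_nonneg_of_nonpos (show 0 ≤ s * u * v by positivity) s1
  have n2 := mul_nonpos_of_nonneg_of_nonpos (show 0 ≤ s * u * w by positivity) s2
  have n3 := mul_nonpos_of_nonneg_of_nonpos (show 0 ≤ s * v * w by positivity) s3
  have o1 := mul_nonpos_of_nonneg_of_nonpos (show 0 ≤ u * u * v by positivity) a1
  have o2 := mul_nonpos_of_nonneg_of_nonpos (show 0 ≤ u * v * v by positivity) b1
  have o3 := mul_nonpos_of_nonneg_of_nonpos (show 0 ≤ u * u * w by positivity) a2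
  have o4 := mul_nonpos_of_nonneg_of_nonpos (show 0 ≤ u * w * w by positivity) b2
  have o5 := mul_nonpos_of_nonneg_of_nonpos (show 0 ≤ v * v * w by positivity) a3
  have o6 := mul_nonpos_of_nonneg_of_nonpos (show 0 ≤ v * w * w by positivity) b3
  have r := mul_nonpos_of_nonneg_of_nonpos (show 0 ≤ u * v * w by positivity) t
  have e : c + cu * u + cv * v + cw * w + cuv * (u * v) + cuw * (u * w) + cvw * (v * w)
      + cuvw * (u * v * w)
      = s * s * s * c + s * s * u * (3 * c + cu) + s * s * v * (3 * c + cv)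
        + s * s * w * (3 * c + cw) + s * u * u * (3 * c + 2 * cu) + s * v * v * (3 * c + 2 * cv)
        + s * w * w * (3 * c + 2 * cw) + u * u * u * (c + cu) + v * v * v * (c + cv)
        + w * w * w * (c + cw) + s * u * v * (6 * c + 2 * (cu + cv) + cuv)
        + s * u * w * (6 * c + 2 * (cu + cw) + cuw) + s * v * w * (6 * c + 2 * (cv + cw) + cvw)
        + u * u * v * (3 * c + (2 * cu + cv) + cuv) + u * v * v * (3 * c + (cu + 2 * cv) + cuv)
        + u * u * w * (3 * c + (2 * cu + cw) + cuw) + u * w * w * (3 * c + (cu + 2 * cw) + cuw)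
        + v * v * w * (3 * c + (2 * cv + cw) + cvw) + v * w * w * (3 * c + (cv + 2 * cw) + cvw)
        + u * v * w * (6 * c + 2 * (cu + cv + cw) + cuv + cuw + cvw + cuvw) := by
    rw [hs']; ring
  rw [e]; linarith

/-- conditions of the certificate -/
structure Good (A : ℤ → ℤ → ℤ → ℤ) : Prop where
  pt : ∀ p q r : ℤ, 0 ≤ p → 0 ≤ q → 0 ≤ r → (12 ≤ p ∨ 12 ≤ q ∨ 12 ≤ r ∨ 24 ≤ p + q + r) →
    A p q r ≤ 0
  c1 : ∀ p q r : ℤ, 0 ≤ p → 0 ≤ q → 0 ≤ r → p < 12 → q < 12 → r < 12 → p + q + r = 23 →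
    A p q r + A p (q + 1) (r + 1) ≤ 0 ∧ A p q r + A (p + 1) q (r + 1) ≤ 0 ∧
    A p q r + A (p + 1) (q + 1) r ≤ 0 ∧ 2 * A p q r + A (p + 1) (q + 1) (r + 1) ≤ 0
  c2 : ∀ p q r : ℤ, 0 ≤ p → 0 ≤ q → 0 ≤ r → p < 12 → q < 12 → r < 12 → p + q + r = 22 →
    ∃ c cu cv cw cuv cuw cvw cuvw : ℤ,
      A (p + 1) (q + 1) (r + 1) = c ∧
      A p (q + 1) (r + 1) = c + cu ∧ A (p + 1) q (r + 1) = c + cv ∧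
      A (p + 1) (q + 1) r = c + cw ∧ A p q (r + 1) = c + cu + cv + cuv ∧
      A p (q + 1) r = c + cu + cw + cuw ∧ A (p + 1) q r = c + cv + cw + cvw ∧
      A p q r = c + cu + cv + cw + cuv + cuw + cvw + cuvw ∧
      6 * c + 2 * (cu + cv) + cuv ≤ 0 ∧ 6 * c + 2 * (cu + cw) + cuw ≤ 0 ∧
      6 * c + 2 * (cv + cw) + cvw ≤ 0 ∧
      3 * c + (2 * cu + cv) + cuv ≤ 0 ∧ 3 * c + (cu + 2 * cv) + cuv ≤ 0 ∧
      3 * c + (2 * cu + cw) + cuw ≤ 0 ∧ 3 * c + (cu + 2 * cw) + cuw ≤ 0 ∧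
      3 * c + (2 * cv + cw) + cvw ≤ 0 ∧ 3 * c + (cv + 2 * cw) + cvw ≤ 0 ∧
      6 * c + 2 * (cu + cv + cw) + cuv + cuw + cvw + cuvw ≤ 0

lemma T_nonpos (A : ℤ → ℤ → ℤ → ℤ) (hA : Good A) (a b c : ℝ) (ha : 0 ≤ a) (hb : 0 ≤ b)
    (hc : 0 ≤ c) (h : 12 ≤ a ∨ 12 ≤ b ∨ 12 ≤ c ∨ 24 ≤ a + b + c) :
    T (fun i j k => (A i j k : ℝ)) a b c ≤ 0 := by
  unfold T I
  obtain ⟨p, hp⟩ : ∃ p, p = ⌊a⌋ := ⟨_, rfl⟩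
  obtain ⟨q, hq⟩ : ∃ p, p = ⌊b⌋ := ⟨_, rfl⟩
  obtain ⟨r, hr⟩ : ∃ p, p = ⌊c⌋ := ⟨_, rfl⟩
  obtain ⟨x, hx⟩ : ∃ x, x = Int.fract a := ⟨_, rfl⟩
  obtain ⟨y, hy⟩ : ∃ x, x = Int.fract b := ⟨_, rfl⟩
  obtain ⟨z, hz⟩ : ∃ x, x = Int.fract c := ⟨_, rfl⟩
  have ea : (p : ℝ) + x = a := by rw [hp, hx]; exact Int.floor_add_fract a
  have eb : (q : ℝ) + y = b := by rw [hq, hy]; exact Int.floor_add_fract b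
  have ec : (r : ℝ) + z = c := by rw [hr, hz]; exact Int.floor_add_fract c
  have x0 : 0 ≤ x := hx ▸ Int.fract_nonneg a
  have y0 : 0 ≤ y := hy ▸ Int.fract_nonneg b
  have z0 : 0 ≤ z := hz ▸ Int.fract_nonneg c
  have x1 : x < 1 := hx ▸ Int.fract_lt_one a
  have y1 : y < 1 := hy ▸ Int.fract_lt_one b
  have z1 : z < 1 := hz ▸ Int.fract_lt_one c
  have p0 : 0 ≤ p := hp ▸ Int.floor_nonneg.2 ha
  have q0 : 0 ≤ q := hq ▸ Int.floor_nonneg.2 hb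
  have r0 : 0 ≤ r := hr ▸ Int.floor_nonneg.2 hc
  rw [← hp, ← hq, ← hr, ← hx, ← hy, ← hz]
  beta_reduce
  have X : 0 ≤ 1 - x := by linarith
  have Y : 0 ≤ 1 - y := by linarith
  have Z : 0 ≤ 1 - z := by linarith
  have cast : ∀ i j k : ℤ, A i j k ≤ 0 → (A i j k : ℝ) ≤ 0 := fun i j k h => by exact_mod_cast h
  by_cases big : 12 ≤ p ∨ 12 ≤ q ∨ 12 ≤ r ∨ 24 ≤ p + q + r
  · have f000 := cast _ _ _ (hA.pt p q r p0 q0 r0 big)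
    have f001 := cast _ _ _ (hA.pt p q (r + 1) p0 q0 (by lia) (by lia))
    have f010 := cast _ _ _ (hA.pt p (q + 1) r p0 (by lia) r0 (by lia))
    have f011 := cast _ _ _ (hA.pt p (q + 1) (r + 1) p0 (by lia) (by lia) (by lia))
    have f100 := cast _ _ _ (hA.pt (p + 1) q r (by lia) q0 r0 (by lia))
    have f101 := cast _ _ _ (hA.pt (p + 1) q (r + 1) (by lia) q0 (by lia) (by lia))
    have f110 := cast _ _ _ (hA.pt (p + 1) (q + 1) r (by lia) (by lia) r0 (by lia))
    have f111 := cast _ _ _ (hA.pt (p + 1) (q + 1) (r + 1) (by lia) (by lia) (by lia) (by lia))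
    have t000 := mul_nonpos_of_nonneg_of_nonpos (show 0 ≤ (1 - x) * (1 - y) * (1 - z) by positivity) f000
    have t001 := mul_nonpos_of_nonneg_of_nonpos (show 0 ≤ (1 - x) * (1 - y) * z by positivity) f001
    have t010 := mul_nonpos_of_nonneg_of_nonpos (show 0 ≤ (1 - x) * y * (1 - z) by positivity) f010
    have t100 := mul_nonpos_of_nonneg_of_nonpos (show 0 ≤ x * (1 - y) * (1 - z) by positivity) f100
    have t011 := mul_nonpos_of_nonneg_of_nonpos (show 0 ≤ (1 - x) * y * z by positivity) f011
    have t101 := mul_nonpos_of_nonneg_of_nonpos (show 0 ≤ x * (1 - y) * z by positivity) f101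
    have t110 := mul_nonpos_of_nonneg_of_nonpos (show 0 ≤ x * y * (1 - z) by positivity) f110
    have t111 := mul_nonpos_of_nonneg_of_nonpos (show 0 ≤ x * y * z by positivity) f111
    linarith
  · push Not at big
    obtain ⟨bp, bq, br, bs⟩ := big
    have hsum : 24 ≤ a + b + c := by
      have hp' : (p : ℝ) ≤ 11 := by exact_mod_cast (by lia : p ≤ 11)
      have hq' : (q : ℝ) ≤ 11 := by exact_mod_cast (by lia : q ≤ 11)
      have hr' : (r : ℝ) ≤ 11 := by exact_mod_cast (by lia : r ≤ 11)
      rcases h with h | h | h | h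
      · linarith
      · linarith
      · linarith
      · exact h
    have h22 : 22 ≤ p + q + r := by
      have : (21 : ℝ) < ((p + q + r : ℤ) : ℝ) := by push_cast; linarith
      have : (21 : ℤ) < p + q + r := by exact_mod_cast this
      lia
    have f011 := cast _ _ _ (hA.pt p (q + 1) (r + 1) p0 (by lia) (by lia) (by lia))
    have f101 := cast _ _ _ (hA.pt (p + 1) q (r + 1) (by lia) q0 (by lia) (by lia))
    have f110 := cast _ _ _ (hA.pt (p + 1) (q + 1) r (by lia) (by lia) r0 (by lia))
    have f111 := cast _ _ _ (hA.pt (p + 1) (q + 1) (r + 1) (by lia) (by lia) (by lia) (by lia))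
    rcases (by lia : p + q + r = 22 ∨ p + q + r = 23) with e | e
    · have e' : (p : ℝ) + q + r = 22 := by exact_mod_cast e
      obtain ⟨k, ku, kv, kw, kuv, kuw, kvw, kuvw, e111, e011, e101, e110, e001, e010, e100, e000,
        s1, s2, s3, a1, b1, a2, b2, a3, b3, t⟩ := hA.c2 p q r p0 q0 r0 bp bq br e
      rw [e011] at f011
      rw [e101] at f101
      rw [e110] at f110
      rw [e111] at f111
      have := core2 (1 - x) (1 - y) (1 - z) X Y Z (by linarith) k ku kv kw kuv kuw kvw kuvw
        f111 (by exact_mod_cast f011) (by exact_mod_cast f101) (by exact_mod_cast f110)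
        (by exact_mod_cast s1) (by exact_mod_cast s2) (by exact_mod_cast s3)
        (by exact_mod_cast a1) (by exact_mod_cast b1) (by exact_mod_cast a2)
        (by exact_mod_cast b2) (by exact_mod_cast a3) (by exact_mod_cast b3) (by exact_mod_cast t)
      rw [e011, e101, e110, e111, e001, e010, e100, e000]
      push_cast
      linarith
    · have e' : (p : ℝ) + q + r = 23 := by exact_mod_cast e
      have f001 := cast _ _ _ (hA.pt p q (r + 1) p0 q0 (by lia) (by lia))
      have f010 := cast _ _ _ (hA.pt p (q + 1) r p0 (by lia) r0 (by lia))
      have f100 := cast _ _ _ (hA.pt (p + 1) q r (by lia) q0 r0 (by lia))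
      obtain ⟨g1, g2, g3, g4⟩ := hA.c1 p q r p0 q0 r0 bp bq br e
      exact core1 x y z x0 x1.le y0 y1.le z0 z1.le (by linarith) _ _ _ _ _ _ _ _
        f001 f010 f100 f011 f101 f110 f111 (by exact_mod_cast g1) (by exact_mod_cast g2)
        (by exact_mod_cast g3) (by exact_mod_cast g4)

end Cubo

namespace Cubo

def Acert {m : ℕ} (bx : Finset Z3) (G : Z3 → ℤ) (X : Fin m → Z3 → ℤ) (i j k : ℤ) : ℤ :=
  corr bx G (i, j, k) + ∑ l, (corr bx (X l) (i, j, k) + corr bx (X l) (j, i, k)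
    + corr bx (X l) (k, i, j))

lemma Acert_lower {m : ℕ} {ι : Type*} (bx : Finset Z3) (G : Z3 → ℤ) (X : Fin m → Z3 → ℤ)
    (hG : ∀ k, k ∉ bx → G k = 0) (hX : ∀ l, ∀ k, k ∉ bx → X l k = 0)
    (F : Finset ι) (y1 y2 y3 : ι → ℤ) (W : Finset Z3)
    (hW : ∀ i ∈ F, ∀ k ∈ bx, (y1 i, y2 i, y3 i) + k ∈ W) :
    ((F.card : ℤ) * ∑ k ∈ bx, G k) ^ 2 ≤ W.card *
      ∑ p ∈ F, ∑ q ∈ F, Acert bx G X (y1 p - y1 q) (y2 p - y2 q) (y3 p - y3 q) := by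
  have h0 := corr_lower bx G hG F (fun i => (y1 i, y2 i, y3 i)) W hW
  refine h0.trans (mul_le_mul_of_nonneg_left ?_ (by positivity))
  have h1 : ∀ l, 0 ≤ ∑ p ∈ F, ∑ q ∈ F, corr bx (X l) (y1 p - y1 q, y2 p - y2 q, y3 p - y3 q) :=
    fun l => corr_nonneg bx (X l) (hX l) F (fun i => (y1 i, y2 i, y3 i))
  have h2 : ∀ l, 0 ≤ ∑ p ∈ F, ∑ q ∈ F, corr bx (X l) (y2 p - y2 q, y1 p - y1 q, y3 p - y3 q) :=
    fun l => corr_nonneg bx (X l) (hX l) F (fun i => (y2 i, y1 i, y3 i))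
  have h3 : ∀ l, 0 ≤ ∑ p ∈ F, ∑ q ∈ F, corr bx (X l) (y3 p - y3 q, y1 p - y1 q, y2 p - y2 q) :=
    fun l => corr_nonneg bx (X l) (hX l) F (fun i => (y3 i, y1 i, y2 i))
  have e : ∑ p ∈ F, ∑ q ∈ F, Acert bx G X (y1 p - y1 q) (y2 p - y2 q) (y3 p - y3 q)
      = ∑ p ∈ F, ∑ q ∈ F, corr bx G (y1 p - y1 q, y2 p - y2 q, y3 p - y3 q)
        + ∑ l, (∑ p ∈ F, ∑ q ∈ F, corr bx (X l) (y1 p - y1 q, y2 p - y2 q, y3 p - y3 q)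
        + ∑ p ∈ F, ∑ q ∈ F, corr bx (X l) (y2 p - y2 q, y1 p - y1 q, y3 p - y3 q)
        + ∑ p ∈ F, ∑ q ∈ F, corr bx (X l) (y3 p - y3 q, y1 p - y1 q, y2 p - y2 q)) := by
    simp_rw [← Finset.sum_add_distrib]
    rw [Finset.sum_comm (s := Finset.univ)]
    simp_rw [Finset.sum_comm (s := Finset.univ) (t := F), ← Finset.sum_add_distrib]
    rfl
  rw [e]
  have := Finset.sum_nonneg (s := Finset.univ) (fun l _ => add_nonneg (add_nonneg (h1 l) (h2 l)) (h3 l))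
  exact le_add_of_nonneg_right this

lemma T_zero (A : ℤ → ℤ → ℤ → ℝ) : T A 0 0 0 = A 0 0 0 := by
  simp [T, I]

theorem count {m : ℕ} {ι : Type*} (bx : Finset Z3) (G : Z3 → ℤ) (X : Fin m → Z3 → ℤ)
    (hG : ∀ k, k ∉ bx → G k = 0) (hX : ∀ l, ∀ k, k ∉ bx → X l k = 0)
    (hA : Good (Acert bx G X))
    (e1 : ∀ i j k, Acert bx G X (-i) j k = Acert bx G X i j k)
    (e2 : ∀ i j k, Acert bx G X i (-j) k = Acert bx G X i j k)
    (e3 : ∀ i j k, Acert bx G X i j (-k) = Acert bx G X i j k)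
    (F : Finset ι) (x1 x2 x3 : ι → ℝ)
    (hx : ∀ p ∈ F, ∀ q ∈ F, p ≠ q → 12 ≤ |x1 p - x1 q| ∨ 12 ≤ |x2 p - x2 q| ∨
      12 ≤ |x3 p - x3 q| ∨ 24 ≤ |x1 p - x1 q| + |x2 p - x2 q| + |x3 p - x3 q|) :
    ∃ t1 t2 t3 : ℝ, (0 ≤ t1 ∧ t1 ≤ 1) ∧ (0 ≤ t2 ∧ t2 ≤ 1) ∧ (0 ≤ t3 ∧ t3 ≤ 1) ∧
      ∀ W : Finset Z3, (∀ i ∈ F, ∀ k ∈ bx, (⌊x1 i + t1⌋, ⌊x2 i + t2⌋, ⌊x3 i + t3⌋) + k ∈ W) →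
        F.card * (∑ k ∈ bx, G k) ^ 2 ≤ W.card * Acert bx G X 0 0 0 := by
  classical
  obtain ⟨t1, t2, t3, h1, h2, h3, h⟩ := avg3 F x1 x2 x3 (fun i j k => (Acert bx G X i j k : ℝ))
  refine ⟨t1, t2, t3, h1, h2, h3, fun W hW => ?_⟩
  have hl := Acert_lower bx G X hG hX F _ _ _ W hW
  have hu : ∑ p ∈ F, ∑ q ∈ F, T (fun i j k => (Acert bx G X i j k : ℝ)) (x1 p - x1 q)
      (x2 p - x2 q) (x3 p - x3 q) ≤ ∑ p ∈ F, (Acert bx G X 0 0 0 : ℝ) := by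
    refine Finset.sum_le_sum (fun p hp => ?_)
    rw [← Finset.add_sum_erase F _ hp]
    have hz : ∑ q ∈ F.erase p, T (fun i j k => (Acert bx G X i j k : ℝ)) (x1 p - x1 q)
        (x2 p - x2 q) (x3 p - x3 q) ≤ 0 := by
      refine Finset.sum_nonpos (fun q hq => ?_)
      rw [Finset.mem_erase] at hq
      rw [T_abs _ (fun i j k => by rw [e1]) (fun i j k => by rw [e2]) (fun i j k => by rw [e3])]
      exact T_nonpos _ hA _ _ _ (abs_nonneg _) (abs_nonneg _) (abs_nonneg _)
        (hx p hp q hq.2 (Ne.symm hq.1))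
    simp only [sub_self, T_zero]
    linarith
  have hu2 := h.trans hu
  rw [Finset.sum_const, nsmul_eq_mul] at hu2
  have hu3 : ∑ p ∈ F, ∑ q ∈ F, Acert bx G X (⌊x1 p + t1⌋ - ⌊x1 q + t1⌋)
      (⌊x2 p + t2⌋ - ⌊x2 q + t2⌋) (⌊x3 p + t3⌋ - ⌊x3 q + t3⌋) ≤ F.card * Acert bx G X 0 0 0 := by
    exact_mod_cast hu2
  rcases Nat.eq_zero_or_pos F.card with h0 | h0
  · rw [h0]
    simp only [Nat.cast_zero, zero_mul]
    have : 0 ≤ Acert bx G X 0 0 0 := by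
      have := Acert_lower bx G X hG hX {()} (fun _ => 0) (fun _ => 0) (fun _ => 0) bx
        (by intro i _ k hk; rw [show ((0, 0, 0) : Z3) + k = k from zero_add k]; exact hk)
      simp at this
      by_contra hneg
      push Not at hneg
      rcases Nat.eq_zero_or_pos bx.card with hb | hb
      · have : bx = ∅ := Finset.card_eq_zero.1 hb
        subst this
        simp [Acert, corr] at hneg
      · have hb' : (0 : ℤ) < bx.card := by exact_mod_cast hb
        nlinarith [sq_nonneg (∑ k ∈ bx, G k)]
    positivity
  · have h0' : (0 : ℤ) < F.card := by exact_mod_cast h0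
    have h4 := hl.trans (mul_le_mul_of_nonneg_left hu3 (by positivity))
    refine le_of_mul_le_mul_left (a := (F.card : ℤ)) ?_ h0'
    linarith

end Cubo

namespace Cubo

abbrev E3 := EuclideanSpace ℝ (Fin 3)

def verts : Set E3 := {v : EuclideanSpace ℝ (Fin 3) | ∃ (σ : Equiv.Perm (Fin 3)) (e₁ e₂ : ℝ),
        (e₁ = 1 ∨ e₁ = -1) ∧ (e₂ = 1 ∨ e₂ = -1) ∧
        v = fun i => ![e₁, e₂, 0] (σ i)}

def KK : Set E3 := {x | |x 0| ≤ 1 ∧ |x 1| ≤ 1 ∧ |x 2| ≤ 1 ∧ |x 0| + |x 1| + |x 2| ≤ 2}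

lemma abs_comb (a b x y : ℝ) (ha : 0 ≤ a) (hb : 0 ≤ b) : |a * x + b * y| ≤ a * |x| + b * |y| := by
  refine (abs_add_le _ _).trans ?_
  rw [abs_mul, abs_mul, abs_of_nonneg ha, abs_of_nonneg hb]

lemma comb_le (a b x y M : ℝ) (ha : 0 ≤ a) (hb : 0 ≤ b) (hab : a + b = 1) (hx : x ≤ M) (hy : y ≤ M) :
    a * x + b * y ≤ M := by
  have h1 := mul_le_mul_of_nonneg_left hx ha
  have h2 := mul_le_mul_of_nonneg_left hy hb
  have : M = a * M + b * M := by rw [← add_mul, hab, one_mul]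
  linarith

lemma KK_convex : Convex ℝ KK := by
  intro x hx y hy a b ha hb hab
  obtain ⟨x0, x1, x2, xs⟩ := hx
  obtain ⟨y0, y1, y2, ys⟩ := hy
  have k0 := abs_comb a b (x 0) (y 0) ha hb
  have k1 := abs_comb a b (x 1) (y 1) ha hb
  have k2 := abs_comb a b (x 2) (y 2) ha hb
  refine ⟨?_, ?_, ?_, ?_⟩ <;> simp only [PiLp.add_apply, PiLp.smul_apply, smul_eq_mul]
  · exact k0.trans (comb_le a b _ _ _ ha hb hab x0 y0)
  · exact k1.trans (comb_le a b _ _ _ ha hb hab x1 y1)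
  · exact k2.trans (comb_le a b _ _ _ ha hb hab x2 y2)
  · have := comb_le a b _ _ _ ha hb hab xs ys
    linarith

lemma perm_sum (σ : Equiv.Perm (Fin 3)) (f : Fin 3 → ℝ) :
    f (σ 0) + f (σ 1) + f (σ 2) = f 0 + f 1 + f 2 := by
  have := Equiv.sum_comp σ f
  simpa [Fin.sum_univ_three] using this

lemma verts_sub : verts ⊆ KK := by
  rintro v ⟨σ, e1, e2, h1, h2, hv⟩
  have hv' : ∀ i, v i = ![e1, e2, 0] (σ i) := fun i => congrFun hv i
  have a1 : |e1| = 1 := by rcases h1 with rfl | rfl <;> simp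
  have a2 : |e2| = 1 := by rcases h2 with rfl | rfl <;> simp
  have hb : ∀ j, |![e1, e2, 0] j| ≤ 1 := by
    intro j; fin_cases j <;> simp [a1, a2]
  have hs := perm_sum σ (fun j => |![e1, e2, 0] j|)
  refine ⟨?_, ?_, ?_, ?_⟩ <;> simp only [hv']
  · exact hb _
  · exact hb _
  · exact hb _
  · rw [hs]; simp [a1, a2]; norm_num

lemma hull_sub : convexHull ℝ verts ⊆ KK := convexHull_min verts_sub KK_convex

lemma comb3 (C : Set E3) (hC : Convex ℝ C) (h0 : (0 : E3) ∈ C) (u v w : E3) (hu : u ∈ C) (hv : v ∈ C)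
    (hw : w ∈ C) (a b c : ℝ) (ha : 0 ≤ a) (hb : 0 ≤ b) (hc : 0 ≤ c) (hs : a + b + c ≤ 1) :
    a • u + b • v + c • w ∈ C := by
  have := hC.sum_mem (t := Finset.univ) (w := ![a, b, c, 1 - a - b - c]) (z := ![u, v, w, 0])
    (by intro i _; fin_cases i <;> simp <;> linarith)
    (by simp [Fin.sum_univ_four])
    (by intro i _; fin_cases i <;> simp [hu, hv, hw, h0])
  simpa [Fin.sum_univ_four] using this

lemma KK_sub : KK ⊆ convexHull ℝ verts := by
  intro p hp
  obtain ⟨p0, p1, p2, ps⟩ := hp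
  have cv : Convex ℝ (convexHull ℝ verts) := convex_convexHull ℝ verts
  have m01 : ∀ a b : ℝ, (a = 1 ∨ a = -1) → (b = 1 ∨ b = -1) → !₂[a, b, 0] ∈ convexHull ℝ verts := by
    intro a b ha hb
    refine subset_convexHull ℝ _ ⟨1, a, b, ha, hb, ?_⟩
    ext i; fin_cases i <;> simp
  have m02 : ∀ a b : ℝ, (a = 1 ∨ a = -1) → (b = 1 ∨ b = -1) → !₂[a, 0, b] ∈ convexHull ℝ verts := by
    intro a b ha hb
    refine subset_convexHull ℝ _ ⟨Equiv.swap 1 2, a, b, ha, hb, ?_⟩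
    ext i; fin_cases i <;> simp [Equiv.swap_apply_def]
  have m12 : ∀ a b : ℝ, (a = 1 ∨ a = -1) → (b = 1 ∨ b = -1) → !₂[0, a, b] ∈ convexHull ℝ verts := by
    intro a b ha hb
    refine subset_convexHull ℝ _ ⟨Equiv.swap 1 2 * Equiv.swap 0 1, a, b, ha, hb, ?_⟩
    ext i; fin_cases i <;> simp [Equiv.swap_apply_def]
  have mid : ∀ u v w : E3, u ∈ convexHull ℝ verts → v ∈ convexHull ℝ verts →
      w = (1/2 : ℝ) • u + (1/2 : ℝ) • v → w ∈ convexHull ℝ verts := by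
    intro u v w hu hv h
    rw [h]; exact cv hu hv (by norm_num) (by norm_num) (by norm_num)
  have z : (0 : E3) ∈ convexHull ℝ verts := by
    refine mid _ _ _ (m01 1 1 (by simp) (by simp)) (m01 (-1) (-1) (by simp) (by simp)) ?_
    ext i; fin_cases i <;> simp
  have sg : ∀ x : ℝ, ∃ s : ℝ, (s = 1 ∨ s = -1) ∧ x = s * |x| := by
    intro x
    rcases abs_choice x with h | h
    · exact ⟨1, by simp, by rw [h]; ring⟩
    · exact ⟨-1, by simp, by rw [h]; ring⟩
  obtain ⟨s0, hs0, e0⟩ := sg (p 0)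
  obtain ⟨s1, hs1, e1⟩ := sg (p 1)
  obtain ⟨s2, hs2, e2⟩ := sg (p 2)
  have x0 := abs_nonneg (p 0)
  have x1 := abs_nonneg (p 1)
  have x2 := abs_nonneg (p 2)
  generalize |p 0| = x at *
  generalize |p 1| = y at *
  generalize |p 2| = w at *
  have i0 : !₂[s0, 0, 0] ∈ convexHull ℝ verts := by
    refine mid _ _ _ (m01 s0 1 hs0 (by simp)) (m01 s0 (-1) hs0 (by simp)) ?_
    ext i; fin_cases i <;> simp <;> ring
  have i1 : !₂[0, s1, 0] ∈ convexHull ℝ verts := by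
    refine mid _ _ _ (m01 1 s1 (by simp) hs1) (m01 (-1) s1 (by simp) hs1) ?_
    ext i; fin_cases i <;> simp <;> ring
  have i2 : !₂[0, 0, s2] ∈ convexHull ℝ verts := by
    refine mid _ _ _ (m02 1 s2 (by simp) hs2) (m02 (-1) s2 (by simp) hs2) ?_
    ext i; fin_cases i <;> simp <;> ring
  by_cases c0 : y + w < x
  · have := comb3 _ cv z _ _ _ (m01 s0 s1 hs0 hs1) (m02 s0 s2 hs0 hs2) i0 y w (x - y - w) x1 x2
      (by linarith) (by linarith)
    convert this using 1
    ext i; fin_cases i <;> simp [e0, e1, e2] <;> ring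
  by_cases c1 : x + w < y
  · have := comb3 _ cv z _ _ _ (m01 s0 s1 hs0 hs1) (m12 s1 s2 hs1 hs2) i1 x w (y - x - w) x0 x2
      (by linarith) (by linarith)
    convert this using 1
    ext i; fin_cases i <;> simp [e0, e1, e2] <;> ring
  by_cases c2 : x + y < w
  · have := comb3 _ cv z _ _ _ (m02 s0 s2 hs0 hs2) (m12 s1 s2 hs1 hs2) i2 x y (w - x - y) x0 x1
      (by linarith) (by linarith)
    convert this using 1
    ext i; fin_cases i <;> simp [e0, e1, e2] <;> ring
  · have := comb3 _ cv z _ _ _ (m01 s0 s1 hs0 hs1) (m02 s0 s2 hs0 hs2) (m12 s1 s2 hs1 hs2)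
      ((x + y - w) / 2) ((x + w - y) / 2) ((y + w - x) / 2)
      (by linarith) (by linarith) (by linarith) (by linarith)
    convert this using 1
    ext i; fin_cases i <;> simp [e0, e1, e2] <;> ring

lemma open_sub (x : E3) (h0 : |x 0| < 1) (h1 : |x 1| < 1) (h2 : |x 2| < 1)
    (hs : |x 0| + |x 1| + |x 2| < 2) : x ∈ interior (convexHull ℝ verts) := by
  rw [mem_interior]
  refine ⟨{x : E3 | |x 0| < 1 ∧ |x 1| < 1 ∧ |x 2| < 1 ∧ |x 0| + |x 1| + |x 2| < 2}, ?_, ?_,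
    h0, h1, h2, hs⟩
  · intro y hy
    exact KK_sub ⟨hy.1.le, hy.2.1.le, hy.2.2.1.le, hy.2.2.2.le⟩
  · have c0 : Continuous (fun x : E3 => |x 0|) := by fun_prop
    have c1 : Continuous (fun x : E3 => |x 1|) := by fun_prop
    have c2 : Continuous (fun x : E3 => |x 2|) := by fun_prop
    exact (isOpen_lt c0 continuous_const).inter ((isOpen_lt c1 continuous_const).inter
      ((isOpen_lt c2 continuous_const).inter (isOpen_lt ((c0.add c1).add c2) continuous_const)))

lemma far (X : Set E3) (hX : IsTranslativePacking (convexHull ℝ verts) X) (x y : E3)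
    (hx : x ∈ X) (hy : y ∈ X) (hxy : x ≠ y) :
    2 ≤ |x 0 - y 0| ∨ 2 ≤ |x 1 - y 1| ∨ 2 ≤ |x 2 - y 2| ∨
      4 ≤ |x 0 - y 0| + |x 1 - y 1| + |x 2 - y 2| := by
  by_contra hcon
  push Not at hcon
  obtain ⟨h0, h1, h2, h3⟩ := hcon
  have hd := hX x hx y hy hxy
  rw [Set.disjoint_left] at hd
  have key : ∀ i, |((1/2 : ℝ) • (x - y)) i| = |x i - y i| / 2 := by
    intro i
    simp only [PiLp.smul_apply, PiLp.sub_apply, smul_eq_mul, abs_mul]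
    rw [abs_of_pos (by norm_num : (0:ℝ) < 1/2)]; ring
  have key' : ∀ i, |((1/2 : ℝ) • (y - x)) i| = |x i - y i| / 2 := by
    intro i
    simp only [PiLp.smul_apply, PiLp.sub_apply, smul_eq_mul, abs_mul]
    rw [abs_of_pos (by norm_num : (0:ℝ) < 1/2), abs_sub_comm]; ring
  apply hd (a := x + (1/2 : ℝ) • (y - x))
  · exact ⟨_, open_sub _ (by rw [key']; linarith) (by rw [key']; linarith) (by rw [key']; linarith)
      (by rw [key', key', key']; linarith), rfl⟩
  · refine ⟨(1/2 : ℝ) • (x - y), open_sub _ (by rw [key]; linarith) (by rw [key]; linarith)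
      (by rw [key]; linarith) (by rw [key, key, key]; linarith), ?_⟩
    ext i
    simp
    ring

end Cubo

namespace Cubo

def toP (x : E3) : ℝ × ℝ × ℝ := (x 0, x 1, x 2)

lemma toP_mp : MeasurePreserving toP volume volume := by
  have h1 := EuclideanSpace.volume_preserving_symm_measurableEquiv_toLp (Fin 3)
  have h2 := volume_preserving_piFinSuccAbove (fun _ : Fin 3 => ℝ) 0
  have h3 := volume_preserving_finTwoArrow ℝ
  have h4 := (MeasurePreserving.id (volume : Measure ℝ)).prod h3
  have h5 := h4.comp (h2.comp h1)
  exact h5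

def KP : Set (ℝ × ℝ × ℝ) := {q | |q.1| ≤ 1 ∧ |q.2.1| ≤ 1 ∧ |q.2.2| ≤ 1 ∧ |q.1| + |q.2.1| + |q.2.2| ≤ 2}

lemma KP_meas : MeasurableSet KP := by
  apply IsClosed.measurableSet
  have c0 : Continuous (fun q : ℝ × ℝ × ℝ => |q.1|) := by fun_prop
  have c1 : Continuous (fun q : ℝ × ℝ × ℝ => |q.2.1|) := by fun_prop
  have c2 : Continuous (fun q : ℝ × ℝ × ℝ => |q.2.2|) := by fun_prop
  exact (isClosed_le c0 continuous_const).inter ((isClosed_le c1 continuous_const).inter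
      ((isClosed_le c2 continuous_const).inter (isClosed_le ((c0.add c1).add c2) continuous_const)))

lemma int_lin (a b p q : ℝ) : ∫ x in p..q, (a + b * x) = a * (q - p) + b * ((q ^ 2 - p ^ 2) / 2) := by
  rw [intervalIntegral.integral_add (f := fun _ => a) (g := fun x => b * x) (by simp)
    (by apply Continuous.intervalIntegrable; fun_prop), intervalIntegral.integral_const,
    intervalIntegral.integral_const_mul, integral_id, smul_eq_mul]
  ring

lemma int_lin' (a b p q : ℝ) : ∫ x in p..q, (a - b * x) = a * (q - p) - b * ((q ^ 2 - p ^ 2) / 2) := by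
  have := int_lin a (-b) p q
  simp only [neg_mul, ← sub_eq_add_neg] at this
  exact this

lemma int_slice (h : ℝ) (h0 : 0 ≤ h) (h1 : h ≤ 1) :
    ∫ x in (-1:ℝ)..1, 2 * min 1 (2 - h - |x|) = 4 - 2 * h ^ 2 := by
  have hc : Continuous (fun x : ℝ => 2 * min 1 (2 - h - |x|)) := by fun_prop
  rw [← intervalIntegral.integral_add_adjacent_intervals (b := -(1 - h))
    (hc.intervalIntegrable _ _) (hc.intervalIntegrable _ _),
    ← intervalIntegral.integral_add_adjacent_intervals (a := -(1 - h)) (b := 1 - h)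
    (hc.intervalIntegrable _ _) (hc.intervalIntegrable _ _)]
  have e1 : ∫ x in (-1:ℝ)..(-(1-h)), 2 * min 1 (2 - h - |x|)
      = ∫ x in (-1:ℝ)..(-(1-h)), ((4 - 2 * h) + 2 * x) := by
    refine intervalIntegral.integral_congr (fun x hx => ?_)
    rw [Set.uIcc_of_le (by linarith)] at hx
    obtain ⟨ha, hb⟩ := hx
    rw [abs_of_nonpos (by linarith), min_eq_right (by linarith)]; ring
  have e2 : ∫ x in (-(1-h))..(1-h), 2 * min 1 (2 - h - |x|)
      = ∫ x in (-(1-h))..(1-h), (2:ℝ) := by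
    refine intervalIntegral.integral_congr (fun x hx => ?_)
    rw [Set.uIcc_of_le (by linarith)] at hx
    have := abs_le.2 hx
    rw [min_eq_left (by linarith)]; ring
  have e3 : ∫ x in (1-h)..1, 2 * min 1 (2 - h - |x|)
      = ∫ x in (1-h)..1, ((4 - 2 * h) - 2 * x) := by
    refine intervalIntegral.integral_congr (fun x hx => ?_)
    rw [Set.uIcc_of_le (by linarith)] at hx
    obtain ⟨ha, hb⟩ := hx
    rw [abs_of_nonneg (by linarith), min_eq_right (by linarith)]; ring
  rw [e1, e2, e3, int_lin, int_lin', intervalIntegral.integral_const, smul_eq_mul]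
  ring

lemma lint (f : ℝ → ℝ) (hf : Continuous f) (h0 : ∀ x, |x| ≤ 1 → 0 ≤ f x) :
    ∫⁻ x in Set.Icc (-1:ℝ) 1, ENNReal.ofReal (f x) = ENNReal.ofReal (∫ x in (-1:ℝ)..1, f x) := by
  rw [intervalIntegral.integral_of_le (by norm_num), ← integral_Icc_eq_integral_Ioc,
    ofReal_integral_eq_lintegral_ofReal]
  · exact hf.integrableOn_Icc
  · rw [Filter.EventuallyLE, ae_restrict_iff' measurableSet_Icc]
    exact Filter.Eventually.of_forall (fun x hx => h0 x (abs_le.2 hx))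

lemma slice_le (z : ℝ) (hz : |z| ≤ 1) : volume (Prod.mk z ⁻¹' KP) ≤ ENNReal.ofReal (4 - 2 * z ^ 2) := by
  rw [Measure.volume_eq_prod, Measure.prod_apply (measurable_prodMk_left KP_meas)]
  have hb : ∀ x : ℝ, volume (Prod.mk x ⁻¹' (Prod.mk z ⁻¹' KP)) ≤
      (Set.Icc (-1:ℝ) 1).indicator (fun x => ENNReal.ofReal (2 * min 1 (2 - |z| - |x|))) x := by
    intro x
    by_cases hx : x ∈ Set.Icc (-1:ℝ) 1
    · rw [Set.indicator_of_mem hx]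
      have : (Prod.mk x ⁻¹' (Prod.mk z ⁻¹' KP)) ⊆
          Set.Icc (-(min 1 (2 - |z| - |x|))) (min 1 (2 - |z| - |x|)) := by
        rintro y ⟨_, _, hy, hs⟩
        simp only at hy hs
        exact abs_le.1 (le_min hy (by linarith))
      refine (measure_mono this).trans ?_
      rw [Real.volume_Icc]
      exact ENNReal.ofReal_le_ofReal (by linarith)
    · rw [Set.indicator_of_notMem hx]
      have : (Prod.mk x ⁻¹' (Prod.mk z ⁻¹' KP)) = ∅ := by
        rw [Set.eq_empty_iff_forall_notMem]
        rintro y ⟨_, hy, _, _⟩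
        exact hx (abs_le.1 hy)
      rw [this]; simp
  refine (lintegral_mono hb).trans ?_
  rw [lintegral_indicator measurableSet_Icc, lint _ (by fun_prop) ?_, int_slice |z| (abs_nonneg z) hz,
    sq_abs]
  intro x hx
  have : 0 ≤ min 1 (2 - |z| - |x|) := le_min (by norm_num) (by linarith)
  linarith

lemma vol_KP : volume KP ≤ ENNReal.ofReal (20/3) := by
  rw [Measure.volume_eq_prod, Measure.prod_apply KP_meas]
  have hb : ∀ x : ℝ, volume (Prod.mk x ⁻¹' KP) ≤
      (Set.Icc (-1:ℝ) 1).indicator (fun x => ENNReal.ofReal (4 - 2 * x ^ 2)) x := by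
    intro x
    by_cases hx : x ∈ Set.Icc (-1:ℝ) 1
    · rw [Set.indicator_of_mem hx]
      exact slice_le x (abs_le.2 hx)
    · rw [Set.indicator_of_notMem hx]
      have : (Prod.mk x ⁻¹' KP) = ∅ := by
        rw [Set.eq_empty_iff_forall_notMem]
        rintro y ⟨hy, _, _, _⟩
        exact hx (abs_le.1 hy)
      rw [this]; simp
  refine (lintegral_mono hb).trans ?_
  rw [lintegral_indicator measurableSet_Icc, lint _ (by fun_prop) ?_]
  · apply ENNReal.ofReal_le_ofReal
    rw [intervalIntegral.integral_sub (by simp) (by apply Continuous.intervalIntegrable; fun_prop)]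
    simp
    norm_num
  · intro x hx
    have := sq_le_one_iff_abs_le_one x |>.2 hx
    linarith

lemma vol_hull : volume (convexHull ℝ verts) ≤ ENNReal.ofReal (20/3) := by
  refine (measure_mono hull_sub).trans ?_
  have : KK = toP ⁻¹' KP := rfl
  rw [this, toP_mp.measure_preimage KP_meas.nullMeasurableSet]
  exact vol_KP

def cube (w : Z3) : Set E3 := {x | ⌊x 0⌋ = w.1 ∧ ⌊x 1⌋ = w.2.1 ∧ ⌊x 2⌋ = w.2.2}

lemma cube_eq (w : Z3) : cube w = toP ⁻¹' (Set.Ico (w.1 : ℝ) (w.1 + 1) ×ˢ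
    (Set.Ico (w.2.1 : ℝ) (w.2.1 + 1) ×ˢ Set.Ico (w.2.2 : ℝ) (w.2.2 + 1))) := by
  ext x
  simp [cube, toP, Int.floor_eq_iff]

lemma cube_meas (w : Z3) : MeasurableSet (cube w) := by
  rw [cube_eq]
  exact toP_mp.measurable (measurableSet_Ico.prod (measurableSet_Ico.prod measurableSet_Ico))

lemma cube_vol (w : Z3) : volume (cube w) = 1 := by
  rw [cube_eq, toP_mp.measure_preimage
    (measurableSet_Ico.prod (measurableSet_Ico.prod measurableSet_Ico)).nullMeasurableSet,
    Measure.volume_eq_prod, Measure.prod_prod, Measure.volume_eq_prod, Measure.prod_prod]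
  simp

lemma card_le (W : Finset Z3) (B : Set E3) (h : ∀ w ∈ W, cube w ⊆ B) : (W.card : ENNReal) ≤ volume B := by
  have hd : ((W : Set Z3)).PairwiseDisjoint cube := by
    intro u _ v _ huv
    rw [Function.onFun, Set.disjoint_left]
    rintro x ⟨a1, a2, a3⟩ ⟨b1, b2, b3⟩
    exact huv (Prod.ext (a1.symm.trans b1) (Prod.ext (a2.symm.trans b2) (a3.symm.trans b3)))
  have := measure_biUnion_finset (μ := volume) hd (fun w _ => cube_meas w)
  simp only [cube_vol, Finset.sum_const, nsmul_eq_mul, mul_one] at this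
  rw [← this]
  exact measure_mono (Set.iUnion₂_subset h)

end Cubo

namespace Cubo

noncomputable def bx : Finset Z3 := Finset.Icc (-9) 9 ×ˢ (Finset.Icc (-9) 9 ×ˢ Finset.Icc (-9) 9)

lemma mem_bx (k : Z3) : k ∈ bx ↔ (-9 ≤ k.1 ∧ k.1 ≤ 9) ∧ (-9 ≤ k.2.1 ∧ k.2.1 ≤ 9) ∧
    (-9 ≤ k.2.2 ∧ k.2.2 ≤ 9) := by
  simp only [bx, Finset.mem_product, Finset.mem_Icc]

/-- the property of the certificate -/
structure IsCert {m : ℕ} (G : Z3 → ℤ) (X : Fin m → Z3 → ℤ) (a0 s : ℤ) : Prop where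
  G0 : ∀ k, k ∉ bx → G k = 0
  X0 : ∀ l, ∀ k, k ∉ bx → X l k = 0
  good : Good (Acert bx G X)
  e1 : ∀ i j k, Acert bx G X (-i) j k = Acert bx G X i j k
  e2 : ∀ i j k, Acert bx G X i (-j) k = Acert bx G X i j k
  e3 : ∀ i j k, Acert bx G X i j (-k) = Acert bx G X i j k
  val : Acert bx G X 0 0 0 = a0
  sum : ∑ k ∈ bx, G k = s
  bound : 14400000 * a0 ≤ 9364 * s ^ 2
  spos : 0 < s

lemma coord_le {a b c : ℝ} (x y : E3) (h0 : |x 0 - y 0| ≤ a) (h1 : |x 1 - y 1| ≤ b)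
    (h2 : |x 2 - y 2| ≤ c) : dist x y ≤ a + b + c := by
  have a0 := (abs_nonneg _).trans h0
  have b0 := (abs_nonneg _).trans h1
  have c0 := (abs_nonneg _).trans h2
  rw [EuclideanSpace.dist_eq, Fin.sum_univ_three, Real.dist_eq, Real.dist_eq, Real.dist_eq]
  refine Real.sqrt_le_iff.2 ⟨by positivity, ?_⟩
  have := pow_le_pow_left₀ (abs_nonneg _) h0 2
  have := pow_le_pow_left₀ (abs_nonneg _) h1 2
  have := pow_le_pow_left₀ (abs_nonneg _) h2 2
  nlinarith [mul_nonneg a0 b0, mul_nonneg a0 c0, mul_nonneg b0 c0]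

lemma near (x t y : ℝ) (k w : ℤ) (h0 : 0 ≤ t) (h1 : t ≤ 1) (hk : -9 ≤ k) (hk' : k ≤ 9)
    (hw : ⌊x + t⌋ + k = w) (hy : ⌊y⌋ = w) : |y - x| ≤ 11 := by
  rw [← hw] at hy
  have a1 := Int.floor_le (x + t)
  have a2 := Int.lt_floor_add_one (x + t)
  have b1 := Int.floor_le y
  have b2 := Int.lt_floor_add_one y
  rw [hy] at b1 b2
  push_cast at b1 b2
  have c1 : (-9 : ℝ) ≤ k := by exact_mod_cast hk
  have c2 : (k : ℝ) ≤ 9 := by exact_mod_cast hk'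
  rw [abs_le]; constructor <;> linarith

noncomputable def V1 : ℝ := (volume (ball (0 : E3) 1)).toReal

lemma V1_pos : 0 < V1 :=
  ENNReal.toReal_pos (measure_ball_pos volume _ one_pos).ne' measure_ball_lt_top.ne

lemma vol_ball (c : E3) (r : ℝ) (hr : 0 ≤ r) : volume (closedBall c r) = ENNReal.ofReal (r ^ 3 * V1) := by
  rw [Measure.addHaar_closedBall _ _ hr, ENNReal.ofReal_mul (by positivity), V1,
    ENNReal.ofReal_toReal measure_ball_lt_top.ne]
  simp

lemma card_bound {m : ℕ} {G : Z3 → ℤ} {X : Fin m → Z3 → ℤ} {a0 s : ℤ} (hc : IsCert G X a0 s)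
    (P : Set E3) (hP : IsTranslativePacking (convexHull ℝ verts) P) (c : E3) (ρ : ℝ) (hρ : 0 ≤ ρ)
    (F : Finset E3) (hF : ∀ x ∈ F, x ∈ P ∧ x ∈ closedBall c ρ) :
    (F.card : ℝ) * s ^ 2 ≤ a0 * ((6 * ρ + 33) ^ 3 * V1) := by
  classical
  obtain ⟨t1, t2, t3, h1, h2, h3, h⟩ := count bx G X hc.G0 hc.X0 hc.good hc.e1 hc.e2 hc.e3 F
    (fun x => 6 * x 0) (fun x => 6 * x 1) (fun x => 6 * x 2) (by
      intro p hp q hq hpq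
      have := far P hP p q (hF p hp).1 (hF q hq).1 hpq
      simp only [← mul_sub, abs_mul, abs_of_pos (by norm_num : (0:ℝ) < 6)]
      rcases this with h | h | h | h
      · left; linarith
      · right; left; linarith
      · right; right; left; linarith
      · right; right; right; linarith)
  obtain ⟨W, hW⟩ : ∃ W : Finset Z3, W = F.biUnion (fun x => bx.image
    (fun k => (⌊6 * x 0 + t1⌋, ⌊6 * x 1 + t2⌋, ⌊6 * x 2 + t3⌋) + k)) := ⟨_, rfl⟩
  have hcnt := h W (by
    intro i hi k hk
    rw [hW]
    exact Finset.mem_biUnion.2 ⟨i, hi, Finset.mem_image_of_mem _ hk⟩)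
  rw [hc.val, hc.sum] at hcnt
  have hcard := card_le W (closedBall ((6:ℝ) • c) (6 * ρ + 33)) (by
    intro w hw y hy
    rw [hW, Finset.mem_biUnion] at hw
    obtain ⟨x, hx, hw⟩ := hw
    rw [Finset.mem_image] at hw
    obtain ⟨k, hk, hw⟩ := hw
    rw [mem_bx] at hk
    obtain ⟨y0, y1, y2⟩ := hy
    have hx1 := (hF x hx).2
    rw [mem_closedBall] at hx1 ⊢
    have d1 : dist y ((6:ℝ) • x) ≤ 11 + 11 + 11 := by
      refine coord_le _ _ ?_ ?_ ?_ <;> simp only [PiLp.smul_apply, smul_eq_mul]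
      · exact near _ t1 _ k.1 w.1 h1.1 h1.2 hk.1.1 hk.1.2 (by rw [← hw]; rfl) y0
      · exact near _ t2 _ k.2.1 w.2.1 h2.1 h2.2 hk.2.1.1 hk.2.1.2 (by rw [← hw]; rfl) y1
      · exact near _ t3 _ k.2.2 w.2.2 h3.1 h3.2 hk.2.2.1 hk.2.2.2 (by rw [← hw]; rfl) y2
    have d2 : dist ((6:ℝ) • x) ((6:ℝ) • c) ≤ 6 * ρ := by
      rw [dist_smul₀, Real.norm_eq_abs, abs_of_pos (by norm_num)]; linarith
    linarith [dist_triangle y ((6:ℝ) • x) ((6:ℝ) • c)])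
  rw [vol_ball _ _ (by linarith)] at hcard
  have hcard' : (W.card : ℝ) ≤ (6 * ρ + 33) ^ 3 * V1 := by
    have hnn : 0 ≤ (6 * ρ + 33) ^ 3 * V1 := by have := V1_pos; positivity
    have := ENNReal.toReal_mono ENNReal.ofReal_ne_top hcard
    rwa [ENNReal.toReal_natCast, ENNReal.toReal_ofReal hnn] at this
  have a0nn : 0 ≤ a0 := by
    have := count bx G X hc.G0 hc.X0 hc.good hc.e1 hc.e2 hc.e3 ({()} : Finset Unit)
      (fun _ => 0) (fun _ => 0) (fun _ => 0) (by simp)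
    obtain ⟨u1, u2, u3, _, _, _, hh⟩ := this
    have h9 := hh (bx.image (fun k => (⌊0 + u1⌋, ⌊0 + u2⌋, ⌊0 + u3⌋) + k))
      (by intro i _ k hk; exact Finset.mem_image_of_mem _ hk)
    rw [hc.val, hc.sum, Finset.card_singleton, Nat.cast_one, one_mul] at h9
    by_contra hneg
    have hneg' : a0 ≤ 0 := by omega
    have sp := hc.spos
    have sp2 : (0:ℤ) < s ^ 2 := by positivity
    have := mul_nonpos_of_nonneg_of_nonpos (Nat.cast_nonneg (α := ℤ)
      (bx.image (fun k => (⌊0 + u1⌋, ⌊0 + u2⌋, ⌊0 + u3⌋) + k)).card) hneg'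
    exact absurd (h9.trans this) (not_le.2 sp2)
  have hcnt' : (F.card : ℝ) * (s : ℝ) ^ 2 ≤ W.card * a0 := by exact_mod_cast hcnt
  have a0r : (0 : ℝ) ≤ a0 := by exact_mod_cast a0nn
  calc _ ≤ _ := hcnt'
    _ ≤ ((6 * ρ + 33) ^ 3 * V1) * a0 := mul_le_mul_of_nonneg_right hcard' a0r
    _ = _ := by ring

lemma hull_norm (z : E3) (hz : z ∈ convexHull ℝ verts) : ‖z‖ ≤ 2 := by
  obtain ⟨_, _, _, h⟩ := hull_sub hz
  have := coord_le z 0 (a := |z 0|) (b := |z 1|) (c := |z 2|) (by simp) (by simp) (by simp)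
  rw [dist_zero_right] at this
  linarith

theorem density {m : ℕ} {G : Z3 → ℤ} {X : Fin m → Z3 → ℤ} {a0 s : ℤ} (hc : IsCert G X a0 s)
    (P : Set E3) (hP : IsTranslativePacking (convexHull ℝ verts) P) :
    packingUpperDensity (convexHull ℝ verts) P ≤ 0.9365 := by
  classical
  have hs : (0:ℝ) < s := by exact_mod_cast hc.spos
  have hV := V1_pos
  have hb : (14400000 : ℝ) * a0 ≤ 9364 * (s:ℝ) ^ 2 := by exact_mod_cast hc.bound
  have main : ∀ r : ℝ, 1000000 ≤ r → ∀ c : E3,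
      (volume (closedBall c r ∩ ⋃ x ∈ P, (fun z => x + z) '' (convexHull ℝ verts)) /
        volume (closedBall c r)).toReal ≤ 0.9365 := by
    intro r hr c
    have hfin : (P ∩ closedBall c (r + 2)).Finite := by
      by_contra hinf
      obtain ⟨n, hn⟩ := exists_nat_gt (a0 * ((6 * (r + 2) + 33) ^ 3 * V1) / (s:ℝ) ^ 2)
      obtain ⟨F, hF, hFn⟩ := Set.Infinite.exists_subset_card_eq hinf n
      have := card_bound hc P hP c (r + 2) (by linarith) F (fun x hx => hF hx)
      rw [div_lt_iff₀ (by positivity), ← hFn] at hn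
      linarith
    obtain ⟨F, hF⟩ := hfin.exists_finset_coe
    have hFm : ∀ x, x ∈ F ↔ x ∈ P ∧ x ∈ closedBall c (r + 2) := by
      intro x
      rw [← Finset.mem_coe, hF]; rfl
    have hcard := card_bound hc P hP c (r + 2) (by linarith) F (fun x hx => (hFm x).1 hx)
    have hsub : closedBall c r ∩ ⋃ x ∈ P, (fun z => x + z) '' (convexHull ℝ verts)
        ⊆ ⋃ x ∈ F, (fun z => x + z) '' (convexHull ℝ verts) := by
      rintro y ⟨hy, hyu⟩
      rw [Set.mem_iUnion₂] at hyu ⊢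
      obtain ⟨x, hx, z, hz, rfl⟩ := hyu
      refine ⟨x, (hFm x).2 ⟨hx, ?_⟩, z, hz, rfl⟩
      rw [mem_closedBall] at hy ⊢
      have h2 := hull_norm z hz
      have h3 : dist x (x + z) = ‖z‖ := by simp [dist_eq_norm]
      linarith [dist_triangle x (x + z) c]
    have hvol : volume (closedBall c r ∩ ⋃ x ∈ P, (fun z => x + z) '' (convexHull ℝ verts))
        ≤ ENNReal.ofReal (F.card * (20/3)) := by
      refine (measure_mono hsub).trans ((measure_biUnion_finset_le F _).trans ?_)
      have : ∀ x ∈ F, volume ((fun z => x + z) '' (convexHull ℝ verts)) ≤ ENNReal.ofReal (20/3) := by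
        intro x _
        rw [Set.image_add_left, measure_preimage_add]
        exact vol_hull
      refine (Finset.sum_le_sum this).trans ?_
      rw [Finset.sum_const, nsmul_eq_mul, ENNReal.ofReal_mul (by positivity), ENNReal.ofReal_natCast]
    rw [vol_ball c r (by linarith)]
    have hr3 : 0 < r ^ 3 * V1 := by positivity
    have hle : (volume (closedBall c r ∩ ⋃ x ∈ P, (fun z => x + z) '' (convexHull ℝ verts)) /
        ENNReal.ofReal (r ^ 3 * V1)) ≤ ENNReal.ofReal (F.card * (20/3) / (r ^ 3 * V1)) := by
      rw [ENNReal.ofReal_div_of_pos hr3]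
      exact ENNReal.div_le_div_right hvol _
    refine (ENNReal.toReal_mono ENNReal.ofReal_ne_top hle).trans ?_
    rw [ENNReal.toReal_ofReal (by positivity), div_le_iff₀ hr3]
    have h45 : (6 * (r + 2) + 33) ≤ 6.00006 * r := by linarith
    have h45' : (6 * (r + 2) + 33) ^ 3 ≤ (6.00006 * r) ^ 3 := pow_le_pow_left₀ (by linarith) h45 3
    have hs2 : 0 < (s:ℝ) ^ 2 := by positivity
    refine le_of_mul_le_mul_right (a := (s:ℝ) ^ 2) ?_ hs2
    have k1 : (6 * (r + 2) + 33) ^ 3 * V1 ≤ (6.00006 * r) ^ 3 * V1 :=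
      mul_le_mul_of_nonneg_right h45' hV.le
    have knn : 0 ≤ (6 * (r + 2) + 33) ^ 3 * V1 := by positivity
    have k2 : (14400000 : ℝ) * a0 * ((6 * (r + 2) + 33) ^ 3 * V1)
        ≤ 9364 * (s:ℝ) ^ 2 * ((6.00006 * r) ^ 3 * V1) :=
      (mul_le_mul_of_nonneg_right hb knn).trans (mul_le_mul_of_nonneg_left k1 (by positivity))
    have k3 : 0 ≤ (s:ℝ) ^ 2 * (r ^ 3 * V1) := by positivity
    have e : (6.00006 * r) ^ 3 = 6.00006 ^ 3 * r ^ 3 := by ring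
    rw [e] at k2
    norm_num at k2 ⊢
    nlinarith
  unfold packingUpperDensity
  refine Filter.limsup_le_of_le ?_ ?_
  · refine Filter.isCoboundedUnder_le_of_le _ (x := 0) ?_
    intro r
    exact Real.iSup_nonneg (fun c => ENNReal.toReal_nonneg)
  · filter_upwards [eventually_ge_atTop (1000000:ℝ)] with r hr
    exact ciSup_le (main r hr)

end Cubo

namespace Cubo

noncomputable def bx2 : Finset Z3 :=
  Finset.Icc (-18) 18 ×ˢ (Finset.Icc (-18) 18 ×ˢ Finset.Icc (-18) 18)

lemma mem_bx2 (k : Z3) : k ∈ bx2 ↔ (-18 ≤ k.1 ∧ k.1 ≤ 18) ∧ (-18 ≤ k.2.1 ∧ k.2.1 ≤ 18) ∧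
    (-18 ≤ k.2.2 ∧ k.2.2 ≤ 18) := by
  simp only [bx2, Finset.mem_product, Finset.mem_Icc]

def enc (k : Z3) : ℕ := (((k.1 + 9) * 37 + (k.2.1 + 9)) * 37 + (k.2.2 + 9)).toNat
def enc2 (k : Z3) : ℕ := (((k.1 + 18) * 37 + (k.2.1 + 18)) * 37 + (k.2.2 + 18)).toNat

/-- Kronecker packing -/
noncomputable def PP (B : ℤ) (h : Z3 → ℤ) : ℤ := ∑ k ∈ bx, h k * B ^ enc k

lemma sum_neg_bx (f : Z3 → ℤ) : ∑ k ∈ bx, f (-k) = ∑ k ∈ bx, f k := by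
  refine Finset.sum_nbij' (fun k => -k) (fun k => -k) ?_ ?_ ?_ ?_ ?_
  · intro k hk; rw [mem_bx] at hk ⊢; simp only [Prod.fst_neg, Prod.snd_neg]; omega
  · intro k hk; rw [mem_bx] at hk ⊢; simp only [Prod.fst_neg, Prod.snd_neg]; omega
  · intro k _; simp
  · intro k _; simp
  · intro k _; rfl

lemma PP_sq (B : ℤ) (h : Z3 → ℤ) (hs : ∀ k, k ∉ bx → h k = 0) (ε : ℤ)
    (hε : ∀ k, h (-k) = ε * h k) :
    PP B h * PP B h = ∑ v ∈ bx2, ε * corr bx h v * B ^ enc2 v := by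
  have e1 : PP B h = ∑ k ∈ bx, ε * h k * B ^ enc (-k) := by
    unfold PP
    rw [← sum_neg_bx]
    exact Finset.sum_congr rfl (fun k _ => by rw [hε])
  have e2 : ∀ k ∈ bx, B ^ enc (-k) * PP B h = ∑ v ∈ bx2, h (k + v) * B ^ enc2 v := by
    intro k hk
    have : ∑ v ∈ bx2, h (k + v) * B ^ enc2 v
        = ∑ v ∈ bx.map (addLeftEmbedding (-k)), h (k + v) * B ^ enc2 v := by
      symm
      refine Finset.sum_subset ?_ ?_
      · intro v hv
        rw [Finset.mem_map] at hv
        obtain ⟨w, hw, rfl⟩ := hv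
        rw [mem_bx] at hk hw
        rw [mem_bx2]
        simp only [addLeftEmbedding_apply, Prod.fst_add, Prod.snd_add, Prod.fst_neg, Prod.snd_neg]
        omega
      · intro v _ hv
        rw [hs, zero_mul]
        intro hb
        exact hv (Finset.mem_map.2 ⟨k + v, hb, by simp⟩)
    rw [this, Finset.sum_map, PP, Finset.mul_sum]
    refine Finset.sum_congr rfl (fun w hw => ?_)
    simp only [addLeftEmbedding_apply, add_neg_cancel_left]
    rw [mul_left_comm, ← pow_add]
    congr 2
    rw [mem_bx] at hk hw
    simp only [enc, enc2, Prod.fst_add, Prod.snd_add, Prod.fst_neg, Prod.snd_neg]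
    omega
  calc PP B h * PP B h = ∑ k ∈ bx, ε * h k * (B ^ enc (-k) * PP B h) := by
        nth_rewrite 1 [e1]
        rw [Finset.sum_mul]
        exact Finset.sum_congr rfl (fun k _ => by ring)
    _ = ∑ k ∈ bx, ∑ v ∈ bx2, ε * (h k * h (k + v)) * B ^ enc2 v := by
        refine Finset.sum_congr rfl (fun k hk => ?_)
        rw [e2 k hk, Finset.mul_sum]
        exact Finset.sum_congr rfl (fun k _ => by ring)
    _ = _ := by
        rw [Finset.sum_comm]
        refine Finset.sum_congr rfl (fun v _ => ?_)
        rw [corr, Finset.mul_sum, Finset.sum_mul]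

lemma icc_range (n : ℕ) (f : ℤ → ℤ) :
    ∑ a ∈ Finset.Icc (-(n:ℤ)) n, f a = ∑ i ∈ Finset.range (2 * n + 1), f ((i:ℤ) - n) := by
  refine Finset.sum_nbij' (fun a => (a + n).toNat) (fun i => (i:ℤ) - n) ?_ ?_ ?_ ?_ ?_
  · intro a ha; rw [Finset.mem_Icc] at ha; rw [Finset.mem_range]; omega
  · intro a ha; rw [Finset.mem_range] at ha; rw [Finset.mem_Icc]; omega
  · intro a ha; rw [Finset.mem_Icc] at ha; omega
  · intro a ha; omega
  · intro a ha; rw [Finset.mem_Icc] at ha; congr 1; omega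

/-- nested sums -/
def N3 (n : ℕ) (B : ℕ) (f : ℕ → ℕ → ℕ → ℕ) : ℕ :=
  ∑ i ∈ Finset.range n, (∑ j ∈ Finset.range n, (∑ k ∈ Finset.range n, f i j k * B ^ k) *
    (B ^ 37) ^ j) * (B ^ 1369) ^ i

lemma N3_cast (n : ℕ) (B : ℕ) (f : ℕ → ℕ → ℕ → ℕ) :
    (N3 n B f : ℤ) = ∑ i ∈ Finset.range n, ∑ j ∈ Finset.range n, ∑ k ∈ Finset.range n,
      (f i j k : ℤ) * (B:ℤ) ^ ((i * 37 + j) * 37 + k) := by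
  unfold N3
  push_cast
  refine Finset.sum_congr rfl (fun i _ => ?_)
  rw [Finset.sum_mul]
  refine Finset.sum_congr rfl (fun j _ => ?_)
  rw [Finset.sum_mul, Finset.sum_mul]
  refine Finset.sum_congr rfl (fun k _ => ?_)
  rw [← pow_mul, ← pow_mul, mul_assoc, mul_assoc, ← pow_add, ← pow_add]
  congr 2
  ring

lemma sum_bx (f : Z3 → ℤ) : ∑ k ∈ bx, f k = ∑ i ∈ Finset.range 19, ∑ j ∈ Finset.range 19,
    ∑ k ∈ Finset.range 19, f ((i:ℤ) - 9, (j:ℤ) - 9, (k:ℤ) - 9) := by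
  have h := icc_range 9
  norm_num at h
  unfold bx
  rw [Finset.sum_product, h]
  refine Finset.sum_congr rfl (fun i _ => ?_)
  rw [Finset.sum_product, h]
  refine Finset.sum_congr rfl (fun j _ => ?_)
  rw [h]

lemma sum_bx2 (f : Z3 → ℤ) : ∑ k ∈ bx2, f k = ∑ i ∈ Finset.range 37, ∑ j ∈ Finset.range 37,
    ∑ k ∈ Finset.range 37, f ((i:ℤ) - 18, (j:ℤ) - 18, (k:ℤ) - 18) := by
  have h := icc_range 18
  norm_num at h
  unfold bx2
  rw [Finset.sum_product, h]
  refine Finset.sum_congr rfl (fun i _ => ?_)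
  rw [Finset.sum_product, h]
  refine Finset.sum_congr rfl (fun j _ => ?_)
  rw [h]

/-- functions from tables of digits with offset -/
noncomputable def hD (D : ℕ → ℕ → ℕ → ℕ) (k : Z3) : ℤ := by
  classical exact
  if k ∈ bx then (D (k.1 + 9).toNat (k.2.1 + 9).toNat (k.2.2 + 9).toNat : ℤ) - 131072 else 0

lemma hD_out (D : ℕ → ℕ → ℕ → ℕ) (k : Z3) (hk : k ∉ bx) : hD D k = 0 := by
  unfold hD; rw [if_neg hk]

lemma hD_in (D : ℕ → ℕ → ℕ → ℕ) (i j k : ℕ) (hi : i < 19) (hj : j < 19) (hk : k < 19) :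
    hD D ((i:ℤ) - 9, (j:ℤ) - 9, (k:ℤ) - 9) = (D i j k : ℤ) - 131072 := by
  unfold hD
  rw [if_pos (by rw [mem_bx]; simp only; omega)]
  simp

lemma hD_bound (D : ℕ → ℕ → ℕ → ℕ) (hb : ∀ i j k, D i j k ≤ 262144) (k : Z3) :
    |hD D k| ≤ 131072 := by
  unfold hD
  split_ifs
  · have := hb (k.1 + 9).toNat (k.2.1 + 9).toNat (k.2.2 + 9).toNat
    rw [abs_le]; constructor <;> omega
  · simp

lemma card_bx : (bx.card : ℤ) = 6859 := by
  simp [bx]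

lemma corr_bound (D : ℕ → ℕ → ℕ → ℕ) (hb : ∀ i j k, D i j k ≤ 262144) (v : Z3) :
    |corr bx (hD D) v| ≤ 2 ^ 50 := by
  unfold corr
  refine (Finset.abs_sum_le_sum_abs _ _).trans ?_
  have : ∀ k ∈ bx, |hD D k * hD D (k + v)| ≤ 131072 * 131072 := by
    intro k _
    rw [abs_mul]
    exact mul_le_mul (hD_bound D hb _) (hD_bound D hb _) (abs_nonneg _) (by norm_num)
  refine (Finset.sum_le_card_nsmul _ _ _ this).trans ?_
  rw [nsmul_eq_mul, card_bx]
  norm_num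

lemma PP_hD (B : ℕ) (D : ℕ → ℕ → ℕ → ℕ) :
    PP B (hD D) = (N3 19 B D : ℤ) - 131072 * (N3 19 B (fun _ _ _ => 1) : ℤ) := by
  unfold PP
  rw [sum_bx, N3_cast, N3_cast, Finset.mul_sum, ← Finset.sum_sub_distrib]
  refine Finset.sum_congr rfl (fun i hi => ?_)
  rw [Finset.mul_sum, ← Finset.sum_sub_distrib]
  refine Finset.sum_congr rfl (fun j hj => ?_)
  rw [Finset.mul_sum, ← Finset.sum_sub_distrib]
  refine Finset.sum_congr rfl (fun k hk => ?_)
  rw [Finset.mem_range] at hi hj hk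
  rw [hD_in D i j k hi hj hk]
  have : enc ((i:ℤ) - 9, (j:ℤ) - 9, (k:ℤ) - 9) = (i * 37 + j) * 37 + k := by
    simp only [enc]; omega
  rw [this]
  push_cast
  ring

/-- a natural number equal to a packed integer function gives its digits -/
lemma packed (B H : ℕ) (g : Z3 → ℤ) (hg : ∀ v, |g v| < H) :
    ∑ v ∈ bx2, g v * (B:ℤ) ^ enc2 v + H * (N3 37 B (fun _ _ _ => 1) : ℤ) =
    N3 37 B (fun i j k => (g ((i:ℤ) - 18, (j:ℤ) - 18, (k:ℤ) - 18) + H).toNat) := by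
  rw [N3_cast, N3_cast, sum_bx2, Finset.mul_sum, ← Finset.sum_add_distrib]
  refine Finset.sum_congr rfl (fun i hi => ?_)
  rw [Finset.mul_sum, ← Finset.sum_add_distrib]
  refine Finset.sum_congr rfl (fun j hj => ?_)
  rw [Finset.mul_sum, ← Finset.sum_add_distrib]
  refine Finset.sum_congr rfl (fun k hk => ?_)
  have : enc2 ((i:ℤ) - 18, (j:ℤ) - 18, (k:ℤ) - 18) = (i * 37 + j) * 37 + k := by
    simp only [enc2]; omega
  have h0 := abs_lt.1 (hg ((i:ℤ) - 18, (j:ℤ) - 18, (k:ℤ) - 18))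
  rw [this, Int.toNat_of_nonneg (by linarith)]
  push_cast
  ring

lemma dig_lt (b : ℕ) (f : ℕ → ℕ) (n : ℕ) (hf : ∀ i, f i < b) :
    ∑ i ∈ Finset.range n, f i * b ^ i < b ^ n := by
  induction n with
  | zero => simp
  | succ n ih =>
    rw [Finset.sum_range_succ, pow_succ]
    have := Nat.mul_le_mul_right (b ^ n) (Nat.succ_le_of_lt (hf n))
    rw [Nat.succ_mul] at this
    rw [mul_comm (b ^ n) b]
    omega

lemma dig (b : ℕ) (f : ℕ → ℕ) (n : ℕ) (hf : ∀ i, f i < b) (e : ℕ) (he : e < n) :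
    (∑ i ∈ Finset.range n, f i * b ^ i) / b ^ e % b = f e := by
  have hb : 0 < b := (Nat.zero_le _).trans_lt (hf 0)
  obtain ⟨m, rfl⟩ : ∃ m, n = e + 1 + m := ⟨n - (e + 1), by omega⟩
  rw [Finset.sum_range_add, Finset.sum_range_succ]
  have : ∑ x ∈ Finset.range m, f (e + 1 + x) * b ^ (e + 1 + x)
      = b ^ e * (b * ∑ x ∈ Finset.range m, f (e + 1 + x) * b ^ x) := by
    rw [Finset.mul_sum, Finset.mul_sum]
    refine Finset.sum_congr rfl (fun x _ => ?_)
    rw [pow_add, pow_succ]; ring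
  rw [this, mul_comm (f e), add_assoc, ← mul_add, Nat.add_mul_div_left _ _ (pow_pos hb e),
    Nat.div_eq_of_lt (dig_lt b f e hf), zero_add, Nat.add_mul_mod_self_left,
    Nat.mod_eq_of_lt (hf e)]

lemma dig3 (B : ℕ) (f : ℕ → ℕ → ℕ → ℕ) (hf : ∀ i j k, f i j k < B) (i j k : ℕ)
    (hi : i < 37) (hj : j < 37) (hk : k < 37) :
    (N3 37 B f / (B ^ 1369) ^ i % B ^ 1369) / (B ^ 37) ^ j % B ^ 37 / B ^ k % B = f i j k := by
  have h1 : ∀ i j, ∑ k ∈ Finset.range 37, f i j k * B ^ k < B ^ 37 :=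
    fun i j => dig_lt B (f i j) 37 (hf i j)
  have h2 : ∀ i, ∑ j ∈ Finset.range 37, (∑ k ∈ Finset.range 37, f i j k * B ^ k) * (B ^ 37) ^ j
      < B ^ 1369 := by
    intro i
    have := dig_lt (B ^ 37) (fun j => ∑ k ∈ Finset.range 37, f i j k * B ^ k) 37 (h1 i)
    rwa [← pow_mul (B) 37 37] at this
  unfold N3
  rw [dig (B ^ 1369) (fun i => ∑ j ∈ Finset.range 37, (∑ k ∈ Finset.range 37, f i j k * B ^ k) *
    (B ^ 37) ^ j) 37 h2 i hi, dig (B ^ 37) (fun j => ∑ k ∈ Finset.range 37, f i j k * B ^ k) 37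
    (h1 i) j hj, dig B (f i j) 37 (hf i j) k hk]

/-- fast sums -/
def sm (s : ℕ) (f : ℕ → ℕ) (n : ℕ) : ℕ :=
  Nat.rec (motive := fun _ => ℕ) 0 (fun m ih => Nat.add ih (Nat.shiftLeft (f m) (Nat.mul s m))) n

lemma sm_eq (s : ℕ) (f : ℕ → ℕ) (n : ℕ) :
    sm s f n = ∑ i ∈ Finset.range n, f i * (2 ^ s) ^ i := by
  induction n with
  | zero => rfl
  | succ n ih =>
    rw [Finset.sum_range_succ, ← ih, ← pow_mul, ← Nat.shiftLeft_eq]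
    rfl

def F3 (n : ℕ) (f : ℕ → ℕ → ℕ → ℕ) : ℕ :=
  sm 87616 (fun i => sm 2368 (fun j => sm 64 (fun k => f i j k) n) n) n

lemma F3_eq (n : ℕ) (f : ℕ → ℕ → ℕ → ℕ) : F3 n f = N3 n (2 ^ 64) f := by
  unfold F3 N3
  simp only [sm_eq]
  refine Finset.sum_congr rfl (fun i _ => ?_)
  rw [← pow_mul 2 64 37, ← pow_mul 2 64 1369]

/-- low digits extraction -/
def lowd (x s e w : ℕ) : ℕ := Nat.mod (Nat.shiftRight x (Nat.mul s e)) w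

lemma lowd_eq (x s e w : ℕ) : lowd x s e w = x / (2 ^ s) ^ e % w := by
  rw [← pow_mul, ← Nat.shiftRight_eq_div_pow]; rfl

def dd (Q i j k : ℕ) : ℕ :=
  lowd (lowd (lowd Q 87616 i (Nat.pow 2 87616)) 2368 j (Nat.pow 2 2368)) 64 k (Nat.pow 2 64)

lemma dd_eq (Q i j k : ℕ) (f : ℕ → ℕ → ℕ → ℕ) (hf : ∀ i j k, f i j k < 2 ^ 64)
    (hi : i < 37) (hj : j < 37) (hk : k < 37) (hQ : Q = N3 37 (2 ^ 64) f) :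
    dd Q i j k = f i j k := by
  have := dig3 (2 ^ 64) f hf i j k hi hj hk
  rw [← this, ← hQ, ← pow_mul 2 64 37, ← pow_mul 2 64 1369]
  unfold dd
  simp only [lowd_eq]
  rfl

end Cubo

namespace Cubo

def ab (i : ℕ) : ℕ := Nat.add (Nat.sub i 9) (Nat.sub 9 i)
def mx (a b : ℕ) : ℕ := Nat.add a (Nat.sub b a)
def mn (a b : ℕ) : ℕ := Nat.sub a (Nat.sub a b)
def tri (a : ℕ) : ℕ := Nat.div (Nat.mul a (Nat.succ a)) 2
def tet (a : ℕ) : ℕ := Nat.div (Nat.mul (Nat.mul a (Nat.succ a)) (Nat.add a 2)) 6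
def look (T i : ℕ) : ℕ := lowd T 18 i 262144
/-- sorted index -/
def gi (a b c : ℕ) : ℕ :=
  Nat.add (Nat.add (tet (mx a (mx b c)))
    (tri (Nat.sub (Nat.sub (Nat.add (Nat.add a b) c) (mx a (mx b c))) (mn a (mn b c)))))
    (mn a (mn b c))
def xi (a b c : ℕ) : ℕ := Nat.add (Nat.mul 55 (Nat.pred a)) (Nat.add (tri (mx b c)) (mn b c))
def DG (T i j k : ℕ) : ℕ := look T (gi (ab i) (ab j) (ab k))
def DX (T i j k : ℕ) : ℕ :=
  cond (Nat.ble i 8) (Nat.sub 262144 (look T (xi (ab i) (ab j) (ab k))))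
    (cond (Nat.ble i 9) 131072 (look T (xi (ab i) (ab j) (ab k))))

lemma look_lt (T i : ℕ) : look T i < 262144 := Nat.mod_lt _ (by norm_num)
lemma DG_le (T i j k : ℕ) : DG T i j k ≤ 262144 := (look_lt _ _).le
lemma DX_le (T i j k : ℕ) : DX T i j k ≤ 262144 := by
  have := look_lt T (xi (ab i) (ab j) (ab k))
  unfold DX
  cases Nat.ble i 8 <;> cases Nat.ble i 9 <;> simp only [cond_true, cond_false]
  · omega
  · norm_num
  · exact Nat.sub_le _ _
  · exact Nat.sub_le _ _

lemma ab_sym (i : ℕ) (h : i ≤ 18) : ab (18 - i) = ab i := by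
  have e : ∀ i, ab i = (i - 9) + (9 - i) := fun _ => rfl
  rw [e, e]; omega

lemma DX_sym (T i j k : ℕ) (h : i ≤ 18) :
    (DX T (18 - i) j k : ℤ) - 131072 = -((DX T i j k : ℤ) - 131072) := by
  have hl := look_lt T (xi (ab i) (ab j) (ab k))
  unfold DX
  rw [ab_sym i h]
  generalize look T (xi (ab i) (ab j) (ab k)) = t at *
  have e : Nat.sub 262144 t = 262144 - t := rfl
  rw [e]
  rcases lt_trichotomy i 9 with h1 | h1 | h1
  · have a1 : Nat.ble i 8 = true := Nat.ble_eq ▸ (by omega : i ≤ 8)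
    have a2 : Nat.ble (18 - i) 8 = false := by
      rw [Bool.eq_false_iff, ne_eq, Nat.ble_eq]; omega
    have a3 : Nat.ble (18 - i) 9 = false := by
      rw [Bool.eq_false_iff, ne_eq, Nat.ble_eq]; omega
    rw [a1, a2, a3]; simp only [cond_true, cond_false]; omega
  · subst h1; norm_num [Nat.ble]
  · have a1 : Nat.ble (18 - i) 8 = true := Nat.ble_eq ▸ (by omega : 18 - i ≤ 8)
    have a2 : Nat.ble i 8 = false := by
      rw [Bool.eq_false_iff, ne_eq, Nat.ble_eq]; omega
    have a3 : Nat.ble i 9 = false := by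
      rw [Bool.eq_false_iff, ne_eq, Nat.ble_eq]; omega
    rw [a1, a2, a3]; simp only [cond_true, cond_false]; omega

lemma hD_flip1 (D : ℕ → ℕ → ℕ → ℕ) (ε : ℤ)
    (h : ∀ i j k, i ≤ 18 → (D (18 - i) j k : ℤ) - 131072 = ε * ((D i j k : ℤ) - 131072)) (a b c : ℤ) :
    hD D (-a, b, c) = ε * hD D (a, b, c) := by
  by_cases hk : (a, b, c) ∈ bx
  · have hk' : (-a, b, c) ∈ bx := by rw [mem_bx] at hk ⊢; simp only at *; omega
    unfold hD
    rw [if_pos hk, if_pos hk', ← h]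
    · rw [mem_bx] at hk; simp only at *
      congr 3; omega
    · rw [mem_bx] at hk; simp only at *; omega
  · have hk' : (-a, b, c) ∉ bx := by rw [mem_bx] at hk ⊢; simp only at *; omega
    rw [hD_out _ _ hk, hD_out _ _ hk', mul_zero]

lemma hD_flip2 (D : ℕ → ℕ → ℕ → ℕ)
    (h : ∀ i j k, j ≤ 18 → D i (18 - j) k = D i j k) (a b c : ℤ) :
    hD D (a, -b, c) = hD D (a, b, c) := by
  by_cases hk : (a, b, c) ∈ bx
  · have hk' : (a, -b, c) ∈ bx := by rw [mem_bx] at hk ⊢; simp only at *; omega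
    unfold hD
    rw [if_pos hk, if_pos hk']
    rw [mem_bx] at hk; simp only at *
    rw [← h _ (b + 9).toNat _ (by omega)]
    congr 3; omega
  · have hk' : (a, -b, c) ∉ bx := by rw [mem_bx] at hk ⊢; simp only at *; omega
    rw [hD_out _ _ hk, hD_out _ _ hk']

lemma hD_flip3 (D : ℕ → ℕ → ℕ → ℕ)
    (h : ∀ i j k, k ≤ 18 → D i j (18 - k) = D i j k) (a b c : ℤ) :
    hD D (a, b, -c) = hD D (a, b, c) := by
  by_cases hk : (a, b, c) ∈ bx
  · have hk' : (a, b, -c) ∈ bx := by rw [mem_bx] at hk ⊢; simp only at *; omega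
    unfold hD
    rw [if_pos hk, if_pos hk']
    rw [mem_bx] at hk; simp only at *
    rw [← h _ _ (c + 9).toNat (by omega)]
    congr 3; omega
  · have hk' : (a, b, -c) ∉ bx := by rw [mem_bx] at hk ⊢; simp only at *; omega
    rw [hD_out _ _ hk, hD_out _ _ hk']

lemma corr_flip (h : Z3 → ℤ) (σ : Z3 → Z3) (hσ : ∀ k, σ (σ k) = k)
    (hadd : ∀ k v, σ (k + v) = σ k + σ v) (hb : ∀ k ∈ bx, σ k ∈ bx) (ε : ℤ) (hε : ε * ε = 1)
    (hh : ∀ k, h (σ k) = ε * h k) (v : Z3) : corr bx h (σ v) = corr bx h v := by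
  unfold corr
  refine Finset.sum_nbij' σ σ hb hb (fun k _ => hσ k) (fun k _ => hσ k) ?_
  intro k _
  have e : σ k + v = σ (k + σ v) := by rw [hadd, hσ]
  rw [e, hh, hh]
  linear_combination (-(h k * h (k + σ v))) * hε

structure Ev (h : Z3 → ℤ) : Prop where
  f1 : ∀ a b c, corr bx h (-a, b, c) = corr bx h (a, b, c)
  f2 : ∀ a b c, corr bx h (a, -b, c) = corr bx h (a, b, c)
  f3 : ∀ a b c, corr bx h (a, b, -c) = corr bx h (a, b, c)

lemma ev_hD (D : ℕ → ℕ → ℕ → ℕ) (ε : ℤ) (hε : ε * ε = 1)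
    (h1 : ∀ i j k, i ≤ 18 → (D (18 - i) j k : ℤ) - 131072 = ε * ((D i j k : ℤ) - 131072))
    (h2 : ∀ i j k, j ≤ 18 → D i (18 - j) k = D i j k)
    (h3 : ∀ i j k, k ≤ 18 → D i j (18 - k) = D i j k) : Ev (hD D) := by
  refine ⟨fun a b c => ?_, fun a b c => ?_, fun a b c => ?_⟩
  · refine corr_flip (hD D) (fun k => (-k.1, k.2.1, k.2.2)) (by simp) ?_ ?_ ε hε
      (fun k => hD_flip1 D ε h1 k.1 k.2.1 k.2.2) (a, b, c)
    · intro k v; ext <;> simp [add_comm]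
    · intro k hk; rw [mem_bx] at *; simp only; omega
  · refine corr_flip (hD D) (fun k => (k.1, -k.2.1, k.2.2)) (by simp) ?_ ?_ 1 (by norm_num)
      (fun k => by rw [one_mul]; exact hD_flip2 D h2 k.1 k.2.1 k.2.2) (a, b, c)
    · intro k v; ext <;> simp [add_comm]
    · intro k hk; rw [mem_bx] at *; simp only; omega
  · refine corr_flip (hD D) (fun k => (k.1, k.2.1, -k.2.2)) (by simp) ?_ ?_ 1 (by norm_num)
      (fun k => by rw [one_mul]; exact hD_flip3 D h3 k.1 k.2.1 k.2.2) (a, b, c)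
    · intro k v; ext <;> simp [add_comm]
    · intro k hk; rw [mem_bx] at *; simp only; omega

lemma neg_hD (D : ℕ → ℕ → ℕ → ℕ) (ε : ℤ)
    (h1 : ∀ i j k, i ≤ 18 → (D (18 - i) j k : ℤ) - 131072 = ε * ((D i j k : ℤ) - 131072))
    (h2 : ∀ i j k, j ≤ 18 → D i (18 - j) k = D i j k)
    (h3 : ∀ i j k, k ≤ 18 → D i j (18 - k) = D i j k) (k : Z3) : hD D (-k) = ε * hD D k := by
  obtain ⟨a, b, c⟩ := k
  have : -((a, b, c) : Z3) = (-a, -b, -c) := rfl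
  rw [this, hD_flip1 D ε h1, hD_flip2 D h2, hD_flip3 D h3]

lemma DG1 (T : ℕ) : ∀ i j k, i ≤ 18 →
    (DG T (18 - i) j k : ℤ) - 131072 = 1 * ((DG T i j k : ℤ) - 131072) := by
  intro i j k h; unfold DG; rw [ab_sym i h, one_mul]
lemma DG2 (T : ℕ) : ∀ i j k, j ≤ 18 → DG T i (18 - j) k = DG T i j k := by
  intro i j k h; unfold DG; rw [ab_sym j h]
lemma DG3 (T : ℕ) : ∀ i j k, k ≤ 18 → DG T i j (18 - k) = DG T i j k := by
  intro i j k h; unfold DG; rw [ab_sym k h]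
lemma DX1 (T : ℕ) : ∀ i j k, i ≤ 18 →
    (DX T (18 - i) j k : ℤ) - 131072 = -1 * ((DX T i j k : ℤ) - 131072) := by
  intro i j k h; rw [DX_sym T i j k h]; ring
lemma DX2 (T : ℕ) : ∀ i j k, j ≤ 18 → DX T i (18 - j) k = DX T i j k := by
  intro i j k h; unfold DX; rw [ab_sym j h]
lemma DX3 (T : ℕ) : ∀ i j k, k ≤ 18 → DX T i j (18 - k) = DX T i j k := by
  intro i j k h; unfold DX; rw [ab_sym k h]

lemma corr_far (D : ℕ → ℕ → ℕ → ℕ) (v : Z3) (h : v ∉ bx2) : corr bx (hD D) v = 0 := by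
  unfold corr
  refine Finset.sum_eq_zero (fun k hk => ?_)
  rw [hD_out D (k + v), mul_zero]
  rw [mem_bx2] at h
  rw [mem_bx] at *
  simp only [Prod.fst_add, Prod.snd_add]
  omega

/-- computed quantities -/
def hh : ℕ := 9223372036854775808
def YY : ℕ := Nat.mul 131072 (F3 19 (fun _ _ _ => 1))
def JJ : ℕ := Nat.mul hh (F3 37 (fun _ _ _ => 1))
def xG (T : ℕ) : ℕ := F3 19 (DG T)
def xX (T : ℕ) : ℕ := F3 19 (DX T)
def QG (T : ℕ) : ℕ :=
  Nat.sub (Nat.add JJ (Nat.add (Nat.mul (xG T) (xG T)) (Nat.mul YY YY)))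
    (Nat.mul 2 (Nat.mul (xG T) YY))
def QX (T0 T1 T2 : ℕ) : ℕ :=
  Nat.sub (Nat.add JJ (Nat.mul 2 (Nat.mul (Nat.add (Nat.add (xX T0) (xX T1)) (xX T2)) YY)))
    (Nat.add (Nat.add (Nat.add (Nat.mul (xX T0) (xX T0)) (Nat.mul (xX T1) (xX T1)))
      (Nat.mul (xX T2) (xX T2))) (Nat.mul 3 (Nat.mul YY YY)))

noncomputable def XX (T0 T1 T2 : ℕ) : Fin 3 → Z3 → ℤ := ![hD (DX T0), hD (DX T1), hD (DX T2)]

lemma hh_eq : (hh : ℤ) = 2 ^ 63 := by norm_num [hh]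

lemma PP_G (T : ℕ) : PP ((2 ^ 64 : ℕ) : ℤ) (hD (DG T)) = (xG T : ℤ) - YY := by
  rw [PP_hD, xG, YY, F3_eq]
  change _ = _ - (((131072 : ℕ) * F3 19 (fun _ _ _ => 1) : ℕ) : ℤ)
  rw [F3_eq, Nat.cast_mul]; rfl

lemma PP_X (T : ℕ) : PP ((2 ^ 64 : ℕ) : ℤ) (hD (DX T)) = (xX T : ℤ) - YY := by
  rw [PP_hD, xX, YY, F3_eq]
  change _ = _ - (((131072 : ℕ) * F3 19 (fun _ _ _ => 1) : ℕ) : ℤ)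
  rw [F3_eq, Nat.cast_mul]; rfl

lemma JJ_eq : (JJ : ℤ) = (hh : ℤ) * (N3 37 (2 ^ 64) (fun _ _ _ => 1) : ℤ) := by
  change (((hh : ℕ) * F3 37 (fun _ _ _ => 1) : ℕ) : ℤ) = _
  rw [F3_eq, Nat.cast_mul]

lemma QG_eq (T : ℕ) : QG T = N3 37 (2 ^ 64) (fun i j k =>
    (corr bx (hD (DG T)) ((i:ℤ) - 18, (j:ℤ) - 18, (k:ℤ) - 18) + (hh:ℤ)).toNat) := by
  have hp := packed (2 ^ 64) hh (corr bx (hD (DG T))) (by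
    intro v
    refine (corr_bound _ (DG_le T) v).trans_lt ?_
    rw [hh_eq]; norm_num)
  have h := PP_sq ((2 ^ 64 : ℕ) : ℤ) (hD (DG T)) (hD_out _) 1
      (neg_hD _ 1 (DG1 T) (DG2 T) (DG3 T))
  rw [PP_G] at h
  simp only [one_mul] at h
  rw [← h, ← JJ_eq] at hp
  refine Nat.sub_eq_of_eq_add ?_
  change JJ + (xG T * xG T + YY * YY) = _ + 2 * (xG T * YY)
  zify
  rw [← hp]
  ring

lemma QX_eq (T0 T1 T2 : ℕ) : QX T0 T1 T2 = N3 37 (2 ^ 64) (fun i j k =>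
    (corr bx (hD (DX T0)) ((i:ℤ) - 18, (j:ℤ) - 18, (k:ℤ) - 18)
      + corr bx (hD (DX T1)) ((i:ℤ) - 18, (j:ℤ) - 18, (k:ℤ) - 18)
      + corr bx (hD (DX T2)) ((i:ℤ) - 18, (j:ℤ) - 18, (k:ℤ) - 18) + (hh:ℤ)).toNat) := by
  have hp := packed (2 ^ 64) hh (fun v => corr bx (hD (DX T0)) v + corr bx (hD (DX T1)) v
      + corr bx (hD (DX T2)) v) (by
    intro v
    have h0 := abs_le.1 (corr_bound _ (DX_le T0) v)
    have h1 := abs_le.1 (corr_bound _ (DX_le T1) v)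
    have h2 := abs_le.1 (corr_bound _ (DX_le T2) v)
    rw [hh_eq, abs_lt]
    norm_num at *
    constructor <;> linarith)
  have h : ∀ T, ((xX T : ℤ) - YY) * ((xX T : ℤ) - YY) =
      -∑ v ∈ bx2, corr bx (hD (DX T)) v * ((2 ^ 64 : ℕ) : ℤ) ^ enc2 v := by
    intro T
    have h := PP_sq ((2 ^ 64 : ℕ) : ℤ) (hD (DX T)) (hD_out _) (-1)
      (neg_hD _ (-1) (DX1 T) (DX2 T) (DX3 T))
    rw [PP_X] at h
    rw [h, ← Finset.sum_neg_distrib]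
    exact Finset.sum_congr rfl (fun v _ => by ring)
  simp only [add_mul, Finset.sum_add_distrib] at hp
  rw [← JJ_eq] at hp
  refine Nat.sub_eq_of_eq_add ?_
  change JJ + 2 * ((xX T0 + xX T1 + xX T2) * YY) = _ +
    (xX T0 * xX T0 + xX T1 * xX T1 + xX T2 * xX T2 + 3 * (YY * YY))
  zify
  rw [← hp]
  linear_combination -h T0 - h T1 - h T2

/-- computed values of the certificate, with offset -/
def AN (T T0 T1 T2 p q r : ℕ) : ℕ :=
  Nat.add (Nat.add (dd (QG T) (Nat.add p 18) (Nat.add q 18) (Nat.add r 18))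
    (dd (QX T0 T1 T2) (Nat.add p 18) (Nat.add q 18) (Nat.add r 18)))
    (Nat.add (dd (QX T0 T1 T2) (Nat.add q 18) (Nat.add p 18) (Nat.add r 18))
      (dd (QX T0 T1 T2) (Nat.add r 18) (Nat.add p 18) (Nat.add q 18)))

lemma ddG (T p q r : ℕ) (hp : p ≤ 18) (hq : q ≤ 18) (hr : r ≤ 18) :
    (dd (QG T) (p + 18) (q + 18) (r + 18) : ℤ) = corr bx (hD (DG T)) (p, q, r) + 2 ^ 63 := by
  rw [dd_eq (QG T) (p + 18) (q + 18) (r + 18) _ ?_ (by omega) (by omega) (by omega) (QG_eq T)]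
  · have h0 := abs_le.1 (corr_bound _ (DG_le T) (p, q, r))
    rw [hh_eq]
    push_cast
    simp only [add_sub_cancel_right]
    rw [Int.toNat_of_nonneg]
    norm_num at *; linarith
  · intro i j k
    have h0 := abs_le.1 (corr_bound _ (DG_le T) ((i:ℤ) - 18, (j:ℤ) - 18, (k:ℤ) - 18))
    rw [hh_eq]
    norm_num at *
    omega

lemma ddX (T0 T1 T2 p q r : ℕ) (hp : p ≤ 18) (hq : q ≤ 18) (hr : r ≤ 18) :
    (dd (QX T0 T1 T2) (p + 18) (q + 18) (r + 18) : ℤ) = corr bx (hD (DX T0)) (p, q, r)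
      + corr bx (hD (DX T1)) (p, q, r) + corr bx (hD (DX T2)) (p, q, r) + 2 ^ 63 := by
  rw [dd_eq (QX T0 T1 T2) (p + 18) (q + 18) (r + 18) _ ?_ (by omega) (by omega) (by omega)
    (QX_eq T0 T1 T2)]
  · have h0 := abs_le.1 (corr_bound _ (DX_le T0) (p, q, r))
    have h1 := abs_le.1 (corr_bound _ (DX_le T1) (p, q, r))
    have h2 := abs_le.1 (corr_bound _ (DX_le T2) (p, q, r))
    rw [hh_eq]
    push_cast
    simp only [add_sub_cancel_right]
    rw [Int.toNat_of_nonneg]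
    norm_num at *; linarith
  · intro i j k
    have h0 := abs_le.1 (corr_bound _ (DX_le T0) ((i:ℤ) - 18, (j:ℤ) - 18, (k:ℤ) - 18))
    have h1 := abs_le.1 (corr_bound _ (DX_le T1) ((i:ℤ) - 18, (j:ℤ) - 18, (k:ℤ) - 18))
    have h2 := abs_le.1 (corr_bound _ (DX_le T2) ((i:ℤ) - 18, (j:ℤ) - 18, (k:ℤ) - 18))
    rw [hh_eq]
    norm_num at *
    omega

lemma AN_eq (T T0 T1 T2 p q r : ℕ) (hp : p ≤ 18) (hq : q ≤ 18) (hr : r ≤ 18) :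
    Acert bx (hD (DG T)) (XX T0 T1 T2) p q r = (AN T T0 T1 T2 p q r : ℤ) - 2 ^ 65 := by
  have h1 := ddG T p q r hp hq hr
  have h2 := ddX T0 T1 T2 p q r hp hq hr
  have h3 := ddX T0 T1 T2 q p r hq hp hr
  have h4 := ddX T0 T1 T2 r p q hr hp hq
  have e : AN T T0 T1 T2 p q r = dd (QG T) (p + 18) (q + 18) (r + 18)
    + dd (QX T0 T1 T2) (p + 18) (q + 18) (r + 18) + (dd (QX T0 T1 T2) (q + 18) (p + 18) (r + 18)
    + dd (QX T0 T1 T2) (r + 18) (p + 18) (q + 18)) := rfl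
  rw [e]
  push_cast
  rw [h1, h2, h3, h4, Acert, Fin.sum_univ_three]
  simp only [XX, Matrix.cons_val]
  ring

/-- bounded quantifier -/
def all (n : ℕ) (f : ℕ → Bool) : Bool :=
  Nat.rec (motive := fun _ => Bool) true (fun m ih => and (f m) ih) n

lemma all_spec (n : ℕ) (f : ℕ → Bool) (h : all n f = true) (i : ℕ) (hi : i < n) : f i = true := by
  induction n with
  | zero => omega
  | succ n ih =>
    have h' : and (f n) (all n f) = true := h
    rw [Bool.and_eq_true] at h'
    rcases Nat.lt_succ_iff_lt_or_eq.1 hi with h1 | h1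
    · exact ih h'.2 h1
    · rw [h1]; exact h'.1

def chk0 (A : ℕ → ℕ → ℕ → ℕ) : Bool :=
  all 19 (fun p => all 19 (fun q => all 19 (fun r =>
    or (and (and (Nat.ble p 11) (Nat.ble q 11)) (and (Nat.ble r 11) (Nat.ble (Nat.add (Nat.add p q) r) 23)))
      (Nat.ble (A p q r) 36893488147419103232))))

def cell1 (a000 a011 a101 a110 a111 : ℕ) : Bool :=
  and (and (Nat.ble (Nat.add a000 a011) 73786976294838206464)
    (Nat.ble (Nat.add a000 a101) 73786976294838206464))
  (and (Nat.ble (Nat.add a000 a110) 73786976294838206464)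
    (Nat.ble (Nat.add (Nat.add a000 a000) a111) 110680464442257309696))

def chk1 (A : ℕ → ℕ → ℕ → ℕ) : Bool :=
  all 12 (fun p => all 12 (fun q => all 12 (fun r =>
    or (not (Nat.beq (Nat.add (Nat.add p q) r) 23))
      (cell1 (A p q r) (A p (Nat.succ q) (Nat.succ r)) (A (Nat.succ p) q (Nat.succ r))
        (A (Nat.succ p) (Nat.succ q) r) (A (Nat.succ p) (Nat.succ q) (Nat.succ r))))))

def face (c a b d : ℕ) : Bool :=
  and (Nat.ble (Nat.add (Nat.mul 3 c) (Nat.add (Nat.add a b) d)) 221360928884514619392)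
   (and (Nat.ble (Nat.add c (Nat.add a d)) 110680464442257309696)
     (Nat.ble (Nat.add c (Nat.add b d)) 110680464442257309696))

def cell2 (a000 a001 a010 a100 a011 a101 a110 a111 : ℕ) : Bool :=
  and (and (face a111 a011 a101 a001) (face a111 a011 a110 a010)) (and (face a111 a101 a110 a100)
    (Nat.ble (Nat.add (Nat.add (Nat.mul 2 a111) a000) (Nat.add (Nat.add a011 a101) a110))
      221360928884514619392))

def chk2 (A : ℕ → ℕ → ℕ → ℕ) : Bool :=
  all 12 (fun p => all 12 (fun q => all 12 (fun r =>
    or (not (Nat.beq (Nat.add (Nat.add p q) r) 22))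
      (cell2 (A p q r) (A p q (Nat.succ r)) (A p (Nat.succ q) r) (A (Nat.succ p) q r)
        (A p (Nat.succ q) (Nat.succ r)) (A (Nat.succ p) q (Nat.succ r))
        (A (Nat.succ p) (Nat.succ q) r) (A (Nat.succ p) (Nat.succ q) (Nat.succ r))))))

def SG (T : ℕ) : ℕ := sm 0 (fun i => sm 0 (fun j => sm 0 (fun k => DG T i j k) 19) 19) 19

/-- total of the offsets is 6859 times 131072 -/
def chk3 (a s : ℕ) : Bool :=
  and (Nat.ble 899022849 s) (Nat.ble (Nat.mul 14400000 (Nat.sub a 36893488147419103232))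
    (Nat.mul 9364 (Nat.mul (Nat.sub s 899022848) (Nat.sub s 899022848))))

lemma SG_eq (T : ℕ) : ∑ k ∈ bx, hD (DG T) k = (SG T : ℤ) - 899022848 := by
  unfold SG
  simp only [sm_eq, pow_zero, one_pow, mul_one]
  have e : (899022848 : ℤ) = ∑ i ∈ Finset.range 19, ∑ j ∈ Finset.range 19,
      ∑ k ∈ Finset.range 19, (131072 : ℤ) := by simp
  rw [e, sum_bx]
  push_cast
  rw [← Finset.sum_sub_distrib]
  refine Finset.sum_congr rfl (fun i hi => ?_)
  rw [← Finset.sum_sub_distrib]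
  refine Finset.sum_congr rfl (fun j hj => ?_)
  rw [← Finset.sum_sub_distrib]
  refine Finset.sum_congr rfl (fun k hk => ?_)
  rw [Finset.mem_range] at hi hj hk
  rw [hD_in _ i j k hi hj hk]

lemma chk0_spec (A : ℕ → ℕ → ℕ → ℕ) (h : chk0 A = true) (p q r : ℕ) (hp : p < 19) (hq : q < 19)
    (hr : r < 19) : (p ≤ 11 ∧ q ≤ 11 ∧ r ≤ 11 ∧ p + q + r ≤ 23) ∨
      A p q r ≤ 36893488147419103232 := by
  unfold chk0 at h
  have h := all_spec 19 _ h p hp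
  have h := all_spec 19 _ h q hq
  have h := all_spec 19 _ h r hr
  simp only [Bool.or_eq_true, Bool.and_eq_true, Nat.ble_eq, Nat.add_eq] at h
  tauto

lemma chk1_spec (A : ℕ → ℕ → ℕ → ℕ) (h : chk1 A = true) (p q r : ℕ) (hp : p < 12) (hq : q < 12)
    (hr : r < 12) (hs : p + q + r = 23) : cell1 (A p q r) (A p (q + 1) (r + 1))
      (A (p + 1) q (r + 1)) (A (p + 1) (q + 1) r) (A (p + 1) (q + 1) (r + 1)) = true := by
  unfold chk1 at h
  have h := all_spec 12 _ h p hp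
  have h := all_spec 12 _ h q hq
  have h := all_spec 12 _ h r hr
  have e : Nat.beq (Nat.add (Nat.add p q) r) 23 = true := by
    rw [Nat.beq_eq]; exact hs
  rw [e] at h
  exact h

lemma chk2_spec (A : ℕ → ℕ → ℕ → ℕ) (h : chk2 A = true) (p q r : ℕ) (hp : p < 12) (hq : q < 12)
    (hr : r < 12) (hs : p + q + r = 22) : cell2 (A p q r) (A p q (r + 1)) (A p (q + 1) r)
      (A (p + 1) q r) (A p (q + 1) (r + 1)) (A (p + 1) q (r + 1)) (A (p + 1) (q + 1) r)
      (A (p + 1) (q + 1) (r + 1)) = true := by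
  unfold chk2 at h
  have h := all_spec 12 _ h p hp
  have h := all_spec 12 _ h q hq
  have h := all_spec 12 _ h r hr
  have e : Nat.beq (Nat.add (Nat.add p q) r) 22 = true := by
    rw [Nat.beq_eq]; exact hs
  rw [e] at h
  exact h

lemma good_of (T T0 T1 T2 : ℕ) (h0 : chk0 (AN T T0 T1 T2) = true)
    (h1 : chk1 (AN T T0 T1 T2) = true) (h2 : chk2 (AN T T0 T1 T2) = true) :
    Good (Acert bx (hD (DG T)) (XX T0 T1 T2)) := by
  have key := AN_eq T T0 T1 T2
  constructor
  · intro p q r hp hq hr hc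
    by_cases hb : p ≤ 18 ∧ q ≤ 18 ∧ r ≤ 18
    · lift p to ℕ using hp
      lift q to ℕ using hq
      lift r to ℕ using hr
      have h := chk0_spec _ h0 p q r (by omega) (by omega) (by omega)
      rw [key p q r (by omega) (by omega) (by omega)]
      have h' : AN T T0 T1 T2 p q r ≤ 36893488147419103232 := by
        rcases h with h | h
        · omega
        · exact h
      norm_num
      exact h'
    · have hfar : ∀ D, ∀ v : Z3, (18 < v.1 ∨ 18 < v.2.1 ∨ 18 < v.2.2) → corr bx (hD D) v = 0 := by
        intro D v hv
        refine corr_far D v ?_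
        rw [mem_bx2]; omega
      rw [Acert, Fin.sum_univ_three]
      simp only [XX, Matrix.cons_val]
      rw [hfar, hfar, hfar, hfar, hfar, hfar, hfar, hfar, hfar, hfar]
      all_goals first | (norm_num; done) | (dsimp only; omega)
  · intro p q r hp hq hr hp' hq' hr' hs
    lift p to ℕ using hp
    lift q to ℕ using hq
    lift r to ℕ using hr
    have h := chk1_spec _ h1 p q r (by omega) (by omega) (by omega) (by omega)
    simp only [cell1, Bool.and_eq_true, Nat.ble_eq] at h
    simp only [Nat.add_eq] at h
    have k := fun p q r hp hq hr => key p q r hp hq hr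
    have k1 := k p q r (by omega) (by omega) (by omega)
    have k2 := k p (q + 1) (r + 1) (by omega) (by omega) (by omega)
    have k3 := k (p + 1) q (r + 1) (by omega) (by omega) (by omega)
    have k4 := k (p + 1) (q + 1) r (by omega) (by omega) (by omega)
    have k5 := k (p + 1) (q + 1) (r + 1) (by omega) (by omega) (by omega)
    push_cast at k1 k2 k3 k4 k5
    rw [k1, k2, k3, k4, k5]
    obtain ⟨⟨g1, g2⟩, g3, g4⟩ := h
    clear h0 h1 h2 key k1 k2 k3 k4 k5 k
    zify at g1 g2 g3 g4
    norm_num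
    refine ⟨?_, ?_, ?_, ?_⟩ <;> linarith
  · intro p q r hp hq hr hp' hq' hr' hs
    lift p to ℕ using hp
    lift q to ℕ using hq
    lift r to ℕ using hr
    have h := chk2_spec _ h2 p q r (by omega) (by omega) (by omega) (by omega)
    simp only [cell2, face, Bool.and_eq_true, Nat.ble_eq] at h
    simp only [Nat.add_eq, Nat.mul_eq] at h
    have k1 := key p q r (by omega) (by omega) (by omega)
    have k2 := key p (q + 1) (r + 1) (by omega) (by omega) (by omega)
    have k3 := key (p + 1) q (r + 1) (by omega) (by omega) (by omega)
    have k4 := key (p + 1) (q + 1) r (by omega) (by omega) (by omega)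
    have k5 := key (p + 1) (q + 1) (r + 1) (by omega) (by omega) (by omega)
    have k6 := key p q (r + 1) (by omega) (by omega) (by omega)
    have k7 := key p (q + 1) r (by omega) (by omega) (by omega)
    have k8 := key (p + 1) q r (by omega) (by omega) (by omega)
    push_cast at k1 k2 k3 k4 k5 k6 k7 k8
    rw [k1, k2, k3, k4, k5, k6, k7, k8]
    generalize AN T T0 T1 T2 p q r = a000 at *
    generalize AN T T0 T1 T2 p q (r + 1) = a001 at *
    generalize AN T T0 T1 T2 p (q + 1) r = a010 at *
    generalize AN T T0 T1 T2 (p + 1) q r = a100 at *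
    generalize AN T T0 T1 T2 p (q + 1) (r + 1) = a011 at *
    generalize AN T T0 T1 T2 (p + 1) q (r + 1) = a101 at *
    generalize AN T T0 T1 T2 (p + 1) (q + 1) r = a110 at *
    generalize AN T T0 T1 T2 (p + 1) (q + 1) (r + 1) = a111 at *
    refine ⟨(a111 : ℤ) - 2 ^ 65, (a011 : ℤ) - a111, (a101 : ℤ) - a111, (a110 : ℤ) - a111,
      (a001 : ℤ) - a011 - a101 + a111, (a010 : ℤ) - a011 - a110 + a111,
      (a100 : ℤ) - a101 - a110 + a111,
      (a000 : ℤ) - a001 - a010 - a100 + a011 + a101 + a110 - a111, by ring, by ring, by ring, by ring, by ring, by ring, by ring, by ring, ?_⟩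
    obtain ⟨⟨⟨g1, g2, g3⟩, g4, g5, g6⟩, ⟨g7, g8, g9⟩, g10⟩ := h
    clear h0 h1 h2 key k1 k2 k3 k4 k5 k6 k7 k8
    zify at g1 g2 g3 g4 g5 g6 g7 g8 g9 g10
    norm_num
    refine ⟨?_, ?_, ?_, ?_, ?_, ?_, ?_, ?_, ?_, ?_⟩ <;> linarith

lemma chk3_spec (a s : ℕ) (h : chk3 a s = true) : (0:ℤ) < (s : ℤ) - 899022848 ∧
    14400000 * ((a : ℤ) - 2 ^ 65) ≤ 9364 * ((s : ℤ) - 899022848) ^ 2 := by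
  unfold chk3 at h
  rw [Bool.and_eq_true, Nat.ble_eq, Nat.ble_eq] at h
  obtain ⟨hs, hb⟩ := h
  have hb : 14400000 * (a - 36893488147419103232) ≤
    9364 * ((s - 899022848) * (s - 899022848)) := hb
  obtain ⟨t, rfl⟩ : ∃ t, s = t + 899022848 := ⟨s - 899022848, by omega⟩
  rw [Nat.add_sub_cancel] at hb
  have h5 : ((a:ℤ) - 2 ^ 65) ≤ ((a - 36893488147419103232 : ℕ) : ℤ) := by omega
  have h6 : (14400000 : ℤ) * ((a - 36893488147419103232 : ℕ) : ℤ) ≤ 9364 * ((t : ℤ) * t) := by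
    exact_mod_cast hb
  push_cast
  rw [add_sub_cancel_right, sq]
  constructor
  · omega
  · linarith

attribute [irreducible] AN SG

lemma cert_of (T T0 T1 T2 : ℕ) (h0 : chk0 (AN T T0 T1 T2) = true)
    (h1 : chk1 (AN T T0 T1 T2) = true) (h2 : chk2 (AN T T0 T1 T2) = true)
    (h3 : chk3 (AN T T0 T1 T2 0 0 0) (SG T) = true) :
    IsCert (hD (DG T)) (XX T0 T1 T2) ((AN T T0 T1 T2 0 0 0 : ℤ) - 2 ^ 65)
      ((SG T : ℤ) - 899022848) := by
  have eG := ev_hD (DG T) 1 (by norm_num) (DG1 T) (DG2 T) (DG3 T)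
  have eX := fun T => ev_hD (DX T) (-1) (by norm_num) (DX1 T) (DX2 T) (DX3 T)
  constructor
  · exact hD_out _
  · intro l
    fin_cases l
    · exact hD_out _
    · exact hD_out _
    · exact hD_out _
  · exact good_of T T0 T1 T2 h0 h1 h2
  · intro i j k
    simp only [Acert, Fin.sum_univ_three, XX, Matrix.cons_val, eG.f1, (eX _).f1, (eX _).f2, (eX _).f3]
  · intro i j k
    simp only [Acert, Fin.sum_univ_three, XX, Matrix.cons_val, eG.f2, (eX _).f1, (eX _).f2, (eX _).f3]
  · intro i j k
    simp only [Acert, Fin.sum_univ_three, XX, Matrix.cons_val, eG.f3, (eX _).f1, (eX _).f2, (eX _).f3]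
  · have := AN_eq T T0 T1 T2 0 0 0 (by norm_num) (by norm_num) (by norm_num)
    rw [Nat.cast_zero] at this
    exact this
  · exact SG_eq T
  · exact (chk3_spec _ _ h3).2
  · exact (chk3_spec _ _ h3).1

end Cubo

namespace Cubo

def TG : ℕ :=
  6012128847094252540024444947431963547238427174852832563069697283519273022545226973044443401733060837759725422766821279579401752163426217151185721610688280550698653798631037613299249679801494650001086222548200410476445475677702508552087921044147334333105367807251509743925350633467067853668009652646375628541402995986779945768697334826578688112332838167851793798447725238409422134069269476734207026088968925155605845431480899725137523533927781868861129055172991714997473403154808788627159391614261454457460999913608515251154697124998241350206437315413217665532400217362489969025047213332022534642240495416652721051175852426094800104414941167224880781474017300954252827992296330031347751260075328525202897703038049186007116517107108019406984167049646751432771831679536150592457590707323391587075711082824732382889724776502864642396882198846484292811074593139789745040123557401508281528943303775660936858143417700137812729912901888764348876180045352209119239554610001204656767868316576575569281553125394606291950835059719965179920636613131591214113637107233666669161182547543093329161398714964694828739482427033211804709161042773209775562906656138138896684707827445777997302265276009258296436260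
def TX0 : ℕ :=
  7521467794746620772730171181308890512312959925933999227874482058549222189552275021006849620120787677008501340858157929869644506293343822805094282255131901067616063896411956513231410258897419495485237560597604609018116141624243772239055859440622671205063711903296349534599697686621145479138068198962975246351251341103590314208044368059955305166283945732055197531824254330322038408840558581707267549697124989217704086037776958728814816567602841447833690976085707649511023909692125781893793706274812566825371766352281359016862712669907806667285995523939892783392980274083529501401719305078704399798145350910577728732346910697358100381083623332535299420796187222609945847686601349710484486281611517804964002942576380233910040946232973003250715105842482294169731432709359011885186171709915583859844690728141333904145781905984068910829740207388752772870623104207724084346909764895902930847365116331554398796594086450613994305360635707172710458179805308572588766722871774846510658433298581173089100950893207121096104948538995032188010811042541982367157044237713626662538341218587772593157201359295707065947786069068728652415455011528688645630957786518790672066577815744642245568964104425456310434425466172858835384923843301160877331243735880210945358894813388752301592021283720568001917326469129489927879764147924316632286619575961138256207776759359947076239474330223974950164027494488796925667030827431363808300836031318999368362445585964659839342611124710796691772624144769564222319113278579846337582648617062407391943044076160267603018713378479313165820996987151802049756185687605480860543424087533145928191004881408824011344480292803571814728671677050906333451510082716247663177744767134061005025733861564735777837798080088247429958304843931665545497106633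42291699132919341469332525415680186433868547916974090384479596845889377758196555191374899455783815443053544708012266959660933156080695463298151543561245048233300586865225737737195119029193004722690277428522043655331459492721376672547139141477810836052045566681903206715534025454990015854645279142876578673637845612303941255576347348405974157136201827198179183624640229667165323083455200311729351768077695787755202930269892480667506752657878337090667425495944683737322093646395336968553051986577616173798143162880183679525303146505145580959261697681229778016936933694581799310185298263713059094167211621398533760919322658699628804634486019627629652589256335345990896883201085234875819801638510324970693542691589097061574566259737746499912207762789968695523817789022588977462929770792153672361359915027987376529260086209217192966031604846242912479733554417939394782173938965234128245224392481404525102066375137461384694780298920254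
def TX1 : ℕ :=
  7555835390516328345894923597012466862847497295932468250297851766305335597837904618559065895260852569199198863319583135106232466736058975570082864060371214624942089858709850710931801469739018018007651451714274299752169107770414280931441403964773890271618343310699175091066323614952736125431143435697501475704753550817185387427606593915666726730509338216921253465484983349689609768909294129287239186779932612986583299719366376571536430279102209999762043091945532345200603043046693532905179245117013186696676020008798000253569629990354821312097019254593238878690061770315714219077046255354838498731895574964676058024876313400441924034913030369470642153376266992991114013126626656762624483148342712974442446833195682168337261677940918395816287200090297035534022641436692659278685439804009489907267062818551157713236591651242599601315405541602704240194933844681666929291170879750315603409297026205399780778123047707984517130253557561925105665184257734104208813710421421659594592743451312667140605463111903745855904465457059169407824249482020279970576311200565181016074727782297185188092133158860037853667994325462429736876862091942319268022728387248906891402436826180033624832928495219806540633488927157206262854885422573385591073813867778381936348776411514630037850075439650295192175708412162234453353930406942549002175338613441033086276680955199672566363234433612539539728910766769606378583609942637227943179055769155175050466407442497078824362228445922546912987781644360409309097753529587090026141744374141615862009250380549093171303373720967490647599813777462619889279755257681989951012938944947188623295795213119253631330361307708432392752157756398038344926638663616253373476888840409281080476322435177381345164251388351376086872888064516570925837464715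85583988780517970646347179502631752569702850479381484144076397182067960853388677573874810323334834624876832276535169806148609802072649849948041561041194411032964728654213084747085346644110450450963463629557349431226766902735196364592890539013270611521000470783997807734404516040715956879810497457347087713116816510607640901855361095626988172748302757716185055702471668460880420124818442701708149553149446333640133381815611546961238803573925520091338782170691098907957681190196386982355113438274743108500312287149107012886455130999451109104147736473892630833277963673736241126326476769240284803736950122057234196033926595675605988052266977377877014100891448268924931846980410845595727080198103454260429068360835557689053433091093858965969381107730015168411252272166787327962389987064092679686740472076578351909384200778837221657226153969828859945491727123502107163931536169825560327282934128497109738103535540087072008378976174061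
def TX2 : ℕ :=
  7420946912405703855063504072771019895504278124878562759607909267017312117278699436092316484846369186283064162511576760485024267833084705057832187486102207360693698063745494421405342230279427896338904482796367684118381603039418227995877271098761418514522240141095549632162739156813500086831997204572200493963862997797904067481180629504591276575857223930348135470703443364402463941849521969991382241221677739210320977273168044936808343821604898035019531096540239486803020686504795397994995405151224079299651555144236165357525821139098142456513339421922844746265294734336037927846983707633321372451804823795370815290126974873779617774277354403318149575585688170972643240072187652771582286899802435584505973337919392830843371113221811214210554131429529128439928060487478546464081655804876979586752724630364543133592022958915666070585422711030877533245269291675303987476549759040469455133230424859115693673876769726309183568662790726832431885442892086330788174140814620553898516941846079889894563619705425525792931431909349063681575992142841305661827417153459793900062459613451317210214950237910232943301138378002547053529155324610323319253481966295582486088982485650913237679696980977357779984374253562670151129056051371378407003242861525476646821746973384980518302715669235053479722883293935211433083856981759922538076357552675688683187518362304310249915588921671742214183233268000272601383707495734174463841665194212846562360010290535571366471709588361464317565131402497670939402789171113606309107747374279966780499529981631122953475317532370904464776126070223614597221483028793014748415984667701572393658855476591291202361428349407983509031320312919155316250739286560596764885086569346076456476956770906273973765811516080852897406117405938428179727088101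14807619243799596292451922139505980312790465592990947070878851374013552028016654526964454966904237433074181453583784818444522420480706309318126720824021607144658602653976280477600145314582765688423182771513241182697903197455188083543210182876540285770312051493460159920437823203358182438487563845883790250063375705663851827747139908541184664398843341081454976033151328169534793895690144322573587163757125353200459447421444366993296520207335663416326575997397479707833287196003287754135571646167847544123225065959510297376737383558141113031834656107662193748116061892879723534548138738685828306210050783255862327895206483070539564222697674211040290211952968404885380455251605662254762805181272385146256873541432167865949800277270291316982432550615727338124661513851848887488856132883990496073980197949214581252926055363860916165225776784071519704858349560933540850530468497547570347025065654752305454924535076913393629807993814503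

lemma ok3 : chk3 (AN TG TX0 TX1 TX2 0 0 0) (SG TG) = true := by decide +kernel
lemma ok2 : chk2 (AN TG TX0 TX1 TX2) = true := by decide +kernel
lemma ok1 : chk1 (AN TG TX0 TX1 TX2) = true := by decide +kernel
lemma ok0 : chk0 (AN TG TX0 TX1 TX2) = true := by decide +kernel

end Cubo

/-- Every translative packing of the cuboctahedron (the convex hull of all coordinate
permutations of `(±1, ±1, 0)`) has upper density at most `0.9365`. -/
theorem cuboctahedron_translative_packing_bound
    (C : Set (EuclideanSpace ℝ (Fin 3)))
    (hC : C = convexHull ℝ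
      {v : EuclideanSpace ℝ (Fin 3) | ∃ (σ : Equiv.Perm (Fin 3)) (e₁ e₂ : ℝ),
        (e₁ = 1 ∨ e₁ = -1) ∧ (e₂ = 1 ∨ e₂ = -1) ∧
        v = fun i => ![e₁, e₂, 0] (σ i)})
    (X : Set (EuclideanSpace ℝ (Fin 3))) (hX : IsTranslativePacking C X) :
    packingUpperDensity C X ≤ 0.9365 := by
  subst hC
  exact Cubo.density (Cubo.cert_of _ _ _ _ Cubo.ok0 Cubo.ok1 Cubo.ok2 Cubo.ok3) X hX
end

section
/- Let B¹₃ = {(x₁,x₂,x₃) ∈ ℝ³ : |x₁| + |x₂| + |x₃| ≤ 1} be the regular octahedron (the unit ball of the l¹₃-norm). Then every translative packing of B¹₃ has upper density at most 0.9730. -/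
open MeasureTheory Filter Metric

namespace Octa

structure El where
  β : ℝ
  n : ℝ
  g : ℝ

/-- covering interval of an element at parameters `a`, `b` -/
def J (b a : ℝ) (x : El) : Set ℝ := {v | x.g < a ∧ |x.β - v| < 1 - |1 - x.n - (a + b) / 2|}

def D (b a : ℝ) (S T : Set El) : Set ℝ := {v | (∃ x ∈ S, v ∈ J b a x) ∧ ∃ y ∈ T, v ∈ J b a y}

noncomputable def slot (b t a : ℝ) : ℝ := if t < a then a + b + t else 0

structure Hyp (A b m : ℝ) (S T : Set El) : Prop where
  b0 : 0 ≤ b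
  m0 : 0 ≤ m
  Am : A ≤ m + b
  h1 : ∀ x ∈ S ∪ T, x.n < 1 ∧ 0 ≤ x.g ∧ x.g < A ∧ -1 + m < x.β + x.n ∧ x.β - x.n < 1 - b
  hS : ∀ x ∈ S, ∀ y ∈ S, x ≠ y → 2 - |x.n - y.n| ≤ |x.β - y.β|
  hT : ∀ x ∈ T, ∀ y ∈ T, x ≠ y → 2 - |x.n - y.n| ≤ |x.β - y.β|
  hST : ∀ x ∈ S, ∀ y ∈ T, x.n + y.n ≤ |x.β - y.β| ∨ 2 * y.n ≤ x.g - y.g ∨ 2 * x.n ≤ y.g - x.g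

lemma Hyp.symm {A b m : ℝ} {S T : Set El} (h : Hyp A b m S T) : Hyp A b m T S where
  b0 := h.b0
  m0 := h.m0
  Am := h.Am
  h1 := fun x hx => h.h1 x (by rw [Set.union_comm]; exact hx)
  hS := h.hT
  hT := h.hS
  hST := fun x hx y hy => by
    rcases h.hST y hy x hx with h | h | h
    · left; rw [abs_sub_comm]; linarith
    · right; right; exact h
    · right; left; exact h

lemma D_symm (b a : ℝ) (S T : Set El) : D b a S T = D b a T S := by
  ext v; simp only [D, Set.mem_ofPred_eq]; tauto

def RW (m : ℝ) (x : El) : Prop := 1 + m < x.β + x.n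
def LW (b : ℝ) (x : El) : Prop := x.β - x.n < -1 - b

section
variable {A b m : ℝ} {S T : Set El}

lemma plain_unique (h : Hyp A b m S T) {x y : El} (hx : x ∈ S) (hy : y ∈ S)
    (hxy : x ≠ y) (hb : x.β ≤ y.β) : RW m y ∨ LW b x := by
  have h2 := h.hS x hx y hy hxy
  obtain ⟨x1, x2, x3, x4, x5⟩ := h.h1 x (Or.inl hx)
  obtain ⟨y1, y2, y3, y4, y5⟩ := h.h1 y (Or.inl hy)
  unfold RW LW
  rw [abs_sub_comm x.β, abs_of_nonneg (by linarith : 0 ≤ y.β - x.β)] at h2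
  rcases abs_cases (x.n - y.n) with ⟨e, _⟩ | ⟨e, _⟩
  · right; linarith
  · left; linarith

lemma not_both (h : Hyp A b m S T) {x : El} (hx : x ∈ S) (hR : RW m x) (hL : LW b x) : False := by
  obtain ⟨x1, x2, x3, x4, x5⟩ := h.h1 x (Or.inl hx)
  have := h.b0
  have := h.m0
  unfold RW at hR; unfold LW at hL
  linarith

lemma RW_unique (h : Hyp A b m S T) {x y : El} (hx : x ∈ S) (hy : y ∈ S)
    (hxr : RW m x) (hyr : RW m y) : x = y := by
  by_contra hxy
  wlog hb : x.β ≤ y.β generalizing x y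
  · exact this hy hx hyr hxr (Ne.symm hxy) (by linarith)
  have h2 := h.hS x hx y hy hxy
  obtain ⟨x1, x2, x3, x4, x5⟩ := h.h1 x (Or.inl hx)
  obtain ⟨y1, y2, y3, y4, y5⟩ := h.h1 y (Or.inl hy)
  have := h.b0
  have := h.m0
  unfold RW at *
  rw [abs_sub_comm x.β, abs_of_nonneg (by linarith : 0 ≤ y.β - x.β)] at h2
  rcases abs_cases (x.n - y.n) with ⟨e, _⟩ | ⟨e, _⟩ <;> linarith

lemma LW_unique (h : Hyp A b m S T) {x y : El} (hx : x ∈ S) (hy : y ∈ S)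
    (hxr : LW b x) (hyr : LW b y) : x = y := by
  by_contra hxy
  wlog hb : x.β ≤ y.β generalizing x y
  · exact this hy hx hyr hxr (Ne.symm hxy) (by linarith)
  have h2 := h.hS x hx y hy hxy
  obtain ⟨x1, x2, x3, x4, x5⟩ := h.h1 x (Or.inl hx)
  obtain ⟨y1, y2, y3, y4, y5⟩ := h.h1 y (Or.inl hy)
  have := h.b0
  have := h.m0
  unfold LW at *
  rw [abs_sub_comm x.β, abs_of_nonneg (by linarith : 0 ≤ y.β - x.β)] at h2
  rcases abs_cases (x.n - y.n) with ⟨e, _⟩ | ⟨e, _⟩ <;> linarith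

lemma W_big (h : Hyp A b m S T) {x : El} (hx : x ∈ S ∪ T) (hw : RW m x ∨ LW b x) :
    A < 2 * x.n := by
  obtain ⟨x1, x2, x3, x4, x5⟩ := h.h1 x hx
  have := h.b0
  have := h.m0
  have := h.Am
  unfold RW LW at hw
  rcases hw with hw | hw <;> linarith

lemma W_beta (h : Hyp A b m S T) {x y : El} (hx : x ∈ S) (hy : y ∈ T)
    (hxw : RW m x ∨ LW b x) (hyw : RW m y ∨ LW b y) : x.n + y.n ≤ |x.β - y.β| := by
  have bx := W_big h (Or.inl hx) hxw
  have bY := W_big h (Or.inr hy) hyw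
  obtain ⟨x1, x2, x3, x4, x5⟩ := h.h1 x (Or.inl hx)
  obtain ⟨y1, y2, y3, y4, y5⟩ := h.h1 y (Or.inr hy)
  rcases h.hST x hx y hy with h' | h' | h'
  · exact h'
  · linarith
  · linarith

lemma no_RR (h : Hyp A b m S T) {x y : El} (hx : x ∈ S) (hy : y ∈ T)
    (hxw : RW m x) (hyw : RW m y) : False := by
  have h2 := W_beta h hx hy (Or.inl hxw) (Or.inl hyw)
  obtain ⟨x1, x2, x3, x4, x5⟩ := h.h1 x (Or.inl hx)
  obtain ⟨y1, y2, y3, y4, y5⟩ := h.h1 y (Or.inr hy)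
  have := h.b0
  have := h.m0
  unfold RW at *
  rcases abs_cases (x.β - y.β) with ⟨e, _⟩ | ⟨e, _⟩ <;> linarith

lemma no_LL (h : Hyp A b m S T) {x y : El} (hx : x ∈ S) (hy : y ∈ T)
    (hxw : LW b x) (hyw : LW b y) : False := by
  have h2 := W_beta h hx hy (Or.inr hxw) (Or.inr hyw)
  obtain ⟨x1, x2, x3, x4, x5⟩ := h.h1 x (Or.inl hx)
  obtain ⟨y1, y2, y3, y4, y5⟩ := h.h1 y (Or.inr hy)
  have := h.b0
  have := h.m0
  unfold LW at *
  rcases abs_cases (x.β - y.β) with ⟨e, _⟩ | ⟨e, _⟩ <;> linarith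

lemma vol_J (b a : ℝ) (x : El) : volume (J b a x) ≤ ENNReal.ofReal (a + b + 2 * x.n) := by
  have : J b a x ⊆ Set.Ioo (x.β - (x.n + (a+b)/2)) (x.β + (x.n + (a+b)/2)) := by
    rintro v ⟨_, hv⟩
    have := neg_abs_le (1 - x.n - (a + b) / 2)
    have := le_abs_self (1 - x.n - (a + b) / 2)
    rw [abs_lt] at hv
    constructor <;> linarith
  refine (measure_mono this).trans ?_
  rw [Real.volume_Ioo]
  apply ENNReal.ofReal_le_ofReal; linarith

lemma vol_beta (b a : ℝ) (x y : El) (hxy : x.n + y.n ≤ |x.β - y.β|) :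
    volume (J b a x ∩ J b a y) ≤ ENNReal.ofReal (a + b) := by
  wlog hb : x.β ≤ y.β generalizing x y
  · rw [Set.inter_comm]
    exact this y x (by rw [abs_sub_comm]; linarith) (by linarith)
  rw [abs_sub_comm, abs_of_nonneg (by linarith : 0 ≤ y.β - x.β)] at hxy
  have : J b a x ∩ J b a y ⊆ Set.Ioo (y.β - (y.n + (a+b)/2)) (x.β + (x.n + (a+b)/2)) := by
    rintro v ⟨⟨_, hv⟩, ⟨_, hw⟩⟩
    have := le_abs_self (1 - x.n - (a + b) / 2)
    have := le_abs_self (1 - y.n - (a + b) / 2)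
    rw [abs_lt] at hv hw
    constructor <;> linarith
  refine (measure_mono this).trans ?_
  rw [Real.volume_Ioo]
  apply ENNReal.ofReal_le_ofReal; linarith

lemma slot_nonneg {b t a : ℝ} (hb : 0 ≤ b) (ht : 0 ≤ t) (ha : 0 < a) : 0 ≤ slot b t a := by
  unfold slot; split_ifs <;> linarith

lemma pair_aux (h : Hyp A b m S T) {x y : El} (hx : x ∈ S) (hy : y ∈ T)
    (ha2 : 2 * y.n ≤ x.g - y.g) {a : ℝ} (ha : 0 < a) :
    volume (J b a x ∩ J b a y) ≤ ENNReal.ofReal (slot b (max 0 (2 * y.n)) a) := by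
  obtain ⟨y1, y2, y3, y4, y5⟩ := h.h1 y (Or.inr hy)
  unfold slot
  split_ifs with hc
  · refine (measure_mono Set.inter_subset_right).trans ((vol_J b a y).trans ?_)
    apply ENNReal.ofReal_le_ofReal
    have := le_max_right 0 (2 * y.n)
    linarith
  · have : J b a x ∩ J b a y = ∅ := by
      ext v
      simp only [Set.mem_inter_iff, Set.mem_empty_iff_false, iff_false, not_and]
      rintro ⟨hg, _⟩ _
      apply hc
      apply max_lt ha
      linarith
    rw [this]; simp

lemma pair_bound (h : Hyp A b m S T) {x y : El} (hx : x ∈ S) (hy : y ∈ T) :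
    ∃ t : ℝ, 0 ≤ t ∧ (A < 2 * x.n → t ≤ max 0 (2 * y.n)) ∧ (A < 2 * y.n → t ≤ max 0 (2 * x.n)) ∧
      ∀ a, 0 < a → volume (J b a x ∩ J b a y) ≤ ENNReal.ofReal (slot b t a) := by
  obtain ⟨x1, x2, x3, x4, x5⟩ := h.h1 x (Or.inl hx)
  obtain ⟨y1, y2, y3, y4, y5⟩ := h.h1 y (Or.inr hy)
  rcases h.hST x hx y hy with h' | h' | h'
  · refine ⟨0, le_rfl, fun _ => le_max_left _ _, fun _ => le_max_left _ _, fun a ha => ?_⟩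
    refine (vol_beta b a x y h').trans ?_
    simp [slot, ha]
  · refine ⟨max 0 (2 * y.n), le_max_left _ _, fun _ => le_rfl, fun hh => ?_, fun a ha => ?_⟩
    · exfalso; linarith
    · exact pair_aux h hx hy h' ha
  · refine ⟨max 0 (2 * x.n), le_max_left _ _, fun hh => ?_, fun _ => le_rfl, fun a ha => ?_⟩
    · exfalso; linarith
    · rw [Set.inter_comm]; exact pair_aux h.symm hy hx h' ha

lemma class_bound (h : Hyp A b m S T) {C C' : Set El} (hC : C ⊆ S) (hC' : C' ⊆ T)
    (sC : C.Subsingleton) (sC' : C'.Subsingleton) :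
    ∃ t : ℝ, 0 ≤ t ∧ ∀ a, 0 < a → volume (D b a C C') ≤ ENNReal.ofReal (slot b t a) := by
  rcases sC.eq_empty_or_singleton with rfl | ⟨x, rfl⟩
  · exact ⟨0, le_rfl, fun a ha => by simp [D]⟩
  rcases sC'.eq_empty_or_singleton with rfl | ⟨y, rfl⟩
  · exact ⟨0, le_rfl, fun a ha => by simp [D]⟩
  obtain ⟨t, ht, _, _, h2⟩ := pair_bound h (hC rfl) (hC' rfl)
  refine ⟨t, ht, fun a ha => ?_⟩
  have : D b a {x} {y} = J b a x ∩ J b a y := by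
    ext v; simp [D]
  rw [this]; exact h2 a ha

def Concl (b : ℝ) (S T : Set El) : Prop :=
  ∃ t₁ t₂ t₃ : ℝ, 0 ≤ t₁ ∧ 0 ≤ t₂ ∧ 0 ≤ t₃ ∧ ∀ a, 0 < a →
    volume (D b a S T) ≤ ENNReal.ofReal (slot b t₁ a) + ENNReal.ofReal (slot b t₂ a) +
      ENNReal.ofReal (slot b t₃ a)

lemma vol_union3 {X Y Z W : Set ℝ} (h : X ⊆ Y ∪ Z ∪ W) :
    volume X ≤ volume Y + volume Z + volume W :=
  (measure_mono h).trans ((measure_union_le _ _).trans (by gcongr; exact measure_union_le _ _))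

lemma case_i (h : Hyp A b m S T) (hT : ∀ y ∈ T, ¬ RW m y ∧ ¬ LW b y) : Concl b S T := by
  have sT : T.Subsingleton := by
    intro x hx y hy
    by_contra hne
    rcases le_total x.β y.β with hb | hb
    · have := plain_unique h.symm hx hy hne hb
      have := hT x hx; have := hT y hy; tauto
    · have := plain_unique h.symm hy hx (Ne.symm hne) hb
      have := hT x hx; have := hT y hy; tauto
  have sP : {x ∈ S | ¬ RW m x ∧ ¬ LW b x}.Subsingleton := by
    rintro x ⟨hx, hx'⟩ y ⟨hy, hy'⟩
    by_contra hne
    rcases le_total x.β y.β with hb | hb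
    · have := plain_unique h hx hy hne hb
      tauto
    · have := plain_unique h hy hx (Ne.symm hne) hb
      tauto
  have sR : {x ∈ S | RW m x}.Subsingleton := fun x hx y hy => RW_unique h hx.1 hy.1 hx.2 hy.2
  have sL : {x ∈ S | LW b x}.Subsingleton := fun x hx y hy => LW_unique h hx.1 hy.1 hx.2 hy.2
  obtain ⟨t₁, p1, q1⟩ := class_bound h (Set.sep_subset _ _) subset_rfl sP sT
  obtain ⟨t₂, p2, q2⟩ := class_bound h (Set.sep_subset _ _) subset_rfl sR sT
  obtain ⟨t₃, p3, q3⟩ := class_bound h (Set.sep_subset _ _) subset_rfl sL sT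
  refine ⟨t₁, t₂, t₃, p1, p2, p3, fun a ha => ?_⟩
  refine (vol_union3 ?_).trans (add_le_add (add_le_add (q1 a ha) (q2 a ha)) (q3 a ha))
  rintro v ⟨⟨x, hx, hvx⟩, hy⟩
  by_cases hr : RW m x
  · exact Or.inl (Or.inr ⟨⟨x, ⟨hx, hr⟩, hvx⟩, hy⟩)
  by_cases hl : LW b x
  · exact Or.inr ⟨⟨x, ⟨hx, hl⟩, hvx⟩, hy⟩
  · exact Or.inl (Or.inl ⟨⟨x, ⟨hx, hr, hl⟩, hvx⟩, hy⟩)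

lemma J_sep (h : Hyp A b m S T) {x y : El} (hx : x ∈ S) (hy : y ∈ S) (hne : x ≠ y)
    (hb : x.β ≤ y.β) {a v w : ℝ} (hv : v ∈ J b a x) (hw : w ∈ J b a y) : v < w := by
  have h2 := h.hS x hx y hy hne
  rw [abs_sub_comm x.β, abs_of_nonneg (by linarith : 0 ≤ y.β - x.β)] at h2
  obtain ⟨_, hv⟩ := hv
  obtain ⟨_, hw⟩ := hw
  rw [abs_lt] at hv hw
  have : |x.n - y.n| ≤ |1 - x.n - (a + b) / 2| + |1 - y.n - (a + b) / 2| := by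
    have := abs_sub (1 - y.n - (a + b) / 2) (1 - x.n - (a + b) / 2)
    rw [show (1 - y.n - (a + b) / 2) - (1 - x.n - (a + b) / 2) = x.n - y.n by ring] at this
    linarith
  linarith

lemma case_iii (h : Hyp A b m S T) {r l : El} (hr : r ∈ S) (hl : l ∈ T)
    (hR : RW m r) (hL : LW b l) : Concl b S T := by
  have hb0 := h.b0
  have nS : ∀ x ∈ S, x ≠ r → ¬ RW m x ∧ ¬ LW b x := fun x hx hne =>
    ⟨fun hh => hne (RW_unique h hx hr hh hR), fun hh => no_LL h hx hl hh hL⟩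
  have nT : ∀ x ∈ T, x ≠ l → ¬ RW m x ∧ ¬ LW b x := fun x hx hne =>
    ⟨fun hh => no_RR h hr hx hR hh, fun hh => hne (LW_unique h.symm hx hl hh hL)⟩
  have sP : {x ∈ S | x ≠ r}.Subsingleton := by
    rintro x ⟨hx, hx'⟩ y ⟨hy, hy'⟩
    by_contra hne
    have := nS x hx hx'
    have := nS y hy hy'
    rcases le_total x.β y.β with hb | hb
    · have := plain_unique h hx hy hne hb
      tauto
    · have := plain_unique h hy hx (Ne.symm hne) hb
      tauto
  have sQ : {x ∈ T | x ≠ l}.Subsingleton := by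
    rintro x ⟨hx, hx'⟩ y ⟨hy, hy'⟩
    by_contra hne
    have := nT x hx hx'
    have := nT y hy hy'
    rcases le_total x.β y.β with hb | hb
    · have := plain_unique h.symm hx hy hne hb
      tauto
    · have := plain_unique h.symm hy hx (Ne.symm hne) hb
      tauto
  have key : ∀ v a, v ∈ D b a S T → v ∈ D b a {x ∈ S | x ≠ r} {x ∈ T | x ≠ l} ∨
      v ∈ (D b a {x ∈ S | x ≠ r} {l} ∪ D b a {r} {x ∈ T | x ≠ l} ∪ D b a {r} {l}) := by
    rintro v a ⟨⟨x, hx, hvx⟩, y, hy, hvy⟩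
    by_cases h1 : x = r <;> by_cases h2 : y = l
    · subst h1 h2; exact Or.inr (Or.inr ⟨⟨x, rfl, hvx⟩, y, rfl, hvy⟩)
    · subst h1; exact Or.inr (Or.inl (Or.inr ⟨⟨x, rfl, hvx⟩, y, ⟨hy, h2⟩, hvy⟩))
    · subst h2; exact Or.inr (Or.inl (Or.inl ⟨⟨x, ⟨hx, h1⟩, hvx⟩, y, rfl, hvy⟩))
    · exact Or.inl ⟨⟨x, ⟨hx, h1⟩, hvx⟩, y, ⟨hy, h2⟩, hvy⟩
  by_cases hE : {x ∈ S | x ≠ r} = ∅ ∨ {x ∈ T | x ≠ l} = ∅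
  · obtain ⟨t₁, p1, q1⟩ := class_bound h (Set.sep_subset _ _)
      (Set.singleton_subset_iff.2 hl) sP Set.subsingleton_singleton
    obtain ⟨t₂, p2, q2⟩ := class_bound h (Set.singleton_subset_iff.2 hr)
      (Set.sep_subset _ _) Set.subsingleton_singleton sQ
    obtain ⟨t₃, p3, q3⟩ := class_bound h (Set.singleton_subset_iff.2 hr)
      (Set.singleton_subset_iff.2 hl) Set.subsingleton_singleton Set.subsingleton_singleton
    refine ⟨t₁, t₂, t₃, p1, p2, p3, fun a ha => ?_⟩
    refine (vol_union3 ?_).trans (add_le_add (add_le_add (q1 a ha) (q2 a ha)) (q3 a ha))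
    intro v hv
    rcases key v a hv with ⟨⟨x, hx, _⟩, ⟨y, hy, _⟩⟩ | hk
    · exfalso
      rcases hE with hE | hE
      · rw [hE] at hx; exact hx
      · rw [hE] at hy; exact hy
    · exact hk
  push Not at hE
  obtain ⟨⟨p, hp, hpr⟩, ⟨q, hq, hql⟩⟩ := hE
  have eP : {x ∈ S | x ≠ r} = {p} := (sP.eq_singleton_of_mem ⟨hp, hpr⟩)
  have eQ : {x ∈ T | x ≠ l} = {q} := (sQ.eq_singleton_of_mem ⟨hq, hql⟩)
  rw [eP, eQ] at key
  have eD : ∀ a x y, D b a {x} {y} = J b a x ∩ J b a y := by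
    intro a x y; ext v; simp [D]
  simp only [eD] at key
  have bpr : p.β ≤ r.β := by
    by_contra hc
    push Not at hc
    have := plain_unique h hr hp (Ne.symm hpr) hc.le
    have := nS p hp hpr
    have := not_both h hr hR
    tauto
  have blq : l.β ≤ q.β := by
    by_contra hc
    push Not at hc
    have := plain_unique h.symm hq hl hql hc.le
    have := nT q hq hql
    have := fun hh => not_both h.symm hl hh hL
    tauto
  obtain ⟨t₁, p1, _, z1, q1⟩ := pair_bound h hp hl
  obtain ⟨t₂, p2, z2, _, q2⟩ := pair_bound h hr hq
  have z1 := z1 (W_big h (Or.inr hl) (Or.inr hL))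
  have z2 := z2 (W_big h (Or.inl hr) (Or.inl hR))
  have hbe := W_beta h hr hl (Or.inl hR) (Or.inr hL)
  refine ⟨t₁, t₂, 0, p1, p2, le_rfl, fun a ha => ?_⟩
  have s0 : slot b 0 a = a + b := by simp [slot, ha]
  rw [s0]
  by_cases hpq : J b a p ∩ J b a q = ∅
  · refine (vol_union3 ?_).trans (add_le_add (add_le_add (q1 a ha) (q2 a ha)) (vol_beta b a r l hbe))
    intro v hv
    rcases key v a hv with hk | hk
    · rw [hpq] at hk; exact hk.elim
    · exact hk
  obtain ⟨w, hwp, hwq⟩ := Set.nonempty_iff_ne_empty.2 hpq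
  have hrl : ∀ v, v ∉ J b a r ∩ J b a l := by
    rintro v ⟨hvr, hvl⟩
    have := J_sep h hp hr hpr bpr hwp hvr
    have := J_sep h.symm hl hq (Ne.symm hql) blq hvl hwq
    linarith
  have key2 : ∀ v, v ∈ D b a S T → v ∈ (J b a p ∩ J b a l) ∪ (J b a r ∩ J b a q) ∪ (J b a p ∩ J b a q) := by
    intro v hv
    rcases key v a hv with hk | (hk | hk) | hk
    · exact Or.inr hk
    · exact Or.inl (Or.inl hk)
    · exact Or.inl (Or.inr hk)
    · exact (hrl v hk).elim
  obtain ⟨_, pg, _⟩ := h.h1 p (Or.inl hp)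
  obtain ⟨_, qg, _⟩ := h.h1 q (Or.inr hq)
  have pa : p.g < a := hwp.1
  have qa : q.g < a := hwq.1
  rcases h.hST p hp q hq with h' | h' | h'
  · exact (vol_union3 key2).trans
      (add_le_add (add_le_add (q1 a ha) (q2 a ha)) (vol_beta b a p q h'))
  · have hs : slot b t₂ a = a + b + t₂ := by
      have : t₂ < a := z2.trans_lt (max_lt ha (by linarith))
      simp [slot, this]
    have : D b a S T ⊆ (J b a p ∩ J b a l) ∪ J b a q := by
      intro v hv
      rcases key2 v hv with (hk | hk) | hk
      · exact Or.inl hk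
      · exact Or.inr hk.2
      · exact Or.inr hk.2
    refine (measure_mono this).trans ((measure_union_le _ _).trans ?_)
    rw [add_assoc]
    refine add_le_add (q1 a ha) ((vol_J b a q).trans ?_)
    rw [hs, ← ENNReal.ofReal_add (by linarith) (by linarith)]
    apply ENNReal.ofReal_le_ofReal; linarith
  · have hs : slot b t₁ a = a + b + t₁ := by
      have : t₁ < a := z1.trans_lt (max_lt ha (by linarith))
      simp [slot, this]
    have : D b a S T ⊆ (J b a r ∩ J b a q) ∪ J b a p := by
      intro v hv
      rcases key2 v hv with (hk | hk) | hk
      · exact Or.inr hk.1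
      · exact Or.inl hk
      · exact Or.inr hk.1
    refine (measure_mono this).trans ((measure_union_le _ _).trans ?_)
    rw [add_comm (ENNReal.ofReal (slot b t₁ a)), add_assoc]
    refine add_le_add (q2 a ha) ((vol_J b a p).trans ?_)
    rw [hs, ← ENNReal.ofReal_add (by linarith) (by linarith)]
    apply ENNReal.ofReal_le_ofReal; linarith

lemma Concl.symm (h : Concl b T S) : Concl b S T := by
  obtain ⟨t₁, t₂, t₃, h1, h2, h3, h⟩ := h
  exact ⟨t₁, t₂, t₃, h1, h2, h3, fun a ha => by rw [D_symm]; exact h a ha⟩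

theorem comb (h : Hyp A b m S T) : Concl b S T := by
  by_cases hT : ∀ y ∈ T, ¬ RW m y ∧ ¬ LW b y
  · exact case_i h hT
  by_cases hS : ∀ y ∈ S, ¬ RW m y ∧ ¬ LW b y
  · exact (case_i h.symm hS).symm
  push Not at hT hS
  obtain ⟨y, hy, hy'⟩ := hT
  obtain ⟨x, hx, hx'⟩ := hS
  by_cases hxr : RW m x
  · have : LW b y := hy' (fun hh => no_RR h hx hy hxr hh)
    exact case_iii h hx hy hxr this
  · have hxl := hx' hxr
    by_cases hyr : RW m y
    · exact (case_iii h.symm hy hx hyr hxl).symm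
    · exact (no_LL h hx hy hxl (hy' hyr)).elim

end
end Octa

namespace Octa

abbrev W := Fin 3 → ℝ

def N (p : W) : ℝ := |p 0| + |p 1| + |p 2|
def Pk (X : Set W) : Prop := ∀ x ∈ X, ∀ y ∈ X, x ≠ y → 2 ≤ N (x - y)
def Cov (X : Set W) (p : W) : Prop := ∃ x ∈ X, N (p - x) < 1
noncomputable def q (s b a v : ℝ) : W :=
  ![(1 + (a - b) / 2 + v) / 2, (1 + (a - b) / 2 - v) / 2, s * ((a + b) / 2)]
def I (m b a : ℝ) : Set ℝ := Set.Ioo (-(1 - (a + b) / 2 - m)) (1 - (a + b) / 2 - b)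

lemma sum_abs_ge (p q : ℝ) : |p + q| ≤ |p| + |q| ∧ |p - q| ≤ |p| + |q| :=
  ⟨abs_add_le p q, abs_sub p q⟩

lemma sum_abs_or (p q : ℝ) : |p| + |q| = |p + q| ∨ |p| + |q| = |p - q| := by
  rcases abs_cases p with ⟨e, _⟩ | ⟨e, _⟩ <;> rcases abs_cases q with ⟨e', _⟩ | ⟨e', _⟩ <;>
  rcases abs_cases (p + q) with ⟨e1, _⟩ | ⟨e1, _⟩ <;>
  rcases abs_cases (p - q) with ⟨e2, _⟩ | ⟨e2, _⟩ <;> rw [e, e', e1, e2] <;>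
  first | (left; linarith) | (right; linarith)

/-- facts on one covering point -/
lemma facts {b m a v p0 p1 p2 : ℝ} (ha : 0 < a) (hb : 0 < b) (hm : 0 ≤ m)
    (hv : v ∈ I m b a) (hP : 2 ≤ |p0| + |p1| + |p2|)
    (hc : |(1 + (a - b) / 2 + v) / 2 - p0| + |(1 + (a - b) / 2 - v) / 2 - p1|
      + |(a + b) / 2 - p2| < 1) :
    0 < p2 ∧ 0 ≤ p0 + p1 + p2 - 2 ∧ p0 + p1 + p2 - 2 < a ∧
    |(p0 - p1) - v| < 1 - |1 - (1 - p2) - (a + b) / 2| ∧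
    -1 + m < (p0 - p1) + (1 - p2) ∧ (p0 - p1) - (1 - p2) < 1 - b ∧
    -1 - b < p0 + p1 - 1 - p2 ∧ p0 + p1 - 1 - p2 < 1 - b := by
  obtain ⟨hv1, hv2⟩ := hv
  set x := (1 + (a - b) / 2 + v) / 2 with hx
  set y := (1 + (a - b) / 2 - v) / 2 with hy
  set h := (a + b) / 2 with hh
  have a1 := le_abs_self (x - p0)
  have a2 := neg_abs_le (x - p0)
  have b1 := le_abs_self (y - p1)
  have b2 := neg_abs_le (y - p1)
  have c1 := le_abs_self (h - p2)
  have c2 := neg_abs_le (h - p2)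
  have e2 : |1 - (1 - p2) - h| = |h - p2| := by rw [abs_sub_comm]; ring_nf
  have s1 := (sum_abs_ge (x - p0) (y - p1)).2
  have hp2 : 0 < p2 := by
    by_contra hcon
    push Not at hcon
    rw [abs_of_nonpos hcon] at hP
    rcases abs_cases p0 with ⟨e, _⟩ | ⟨e, _⟩ <;> rcases abs_cases p1 with ⟨e', _⟩ | ⟨e', _⟩ <;>
      rw [e, e'] at hP <;> linarith
  have hp1 : 0 < p1 := by
    by_contra hcon
    push Not at hcon
    rw [abs_of_nonpos hcon, abs_of_pos hp2] at hP
    rcases abs_cases p0 with ⟨e, _⟩ | ⟨e, _⟩ <;> 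
      rw [e] at hP <;> linarith
  have hp0 : 0 < p0 := by
    by_contra hcon
    push Not at hcon
    rw [abs_of_nonpos hcon, abs_of_pos hp2, abs_of_pos hp1] at hP
    linarith
  rw [abs_of_pos hp0, abs_of_pos hp2, abs_of_pos hp1] at hP
  have e3 : |p0 - p1 - v| ≤ |x - p0| + |y - p1| := by
    rw [show p0 - p1 - v = -(x - p0 - (y - p1)) by rw [hx, hy]; ring, abs_neg]; exact s1
  have f1 := le_abs_self (p0 - p1 - v)
  have f2 := neg_abs_le (p0 - p1 - v)
  refine ⟨hp2, by linarith, by linarith, ?_, ?_, ?_, ?_, ?_⟩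
  · rw [e2]; linarith
  all_goals linarith

def el (s : ℝ) (P : W) : El := ⟨P 0 - P 1, 1 - s * P 2, P 0 + P 1 + s * P 2 - 2⟩

def U (X : Set W) (A b m s : ℝ) : Set W :=
  {P | P ∈ X ∧ ∃ a v, 0 < a ∧ a < A ∧ v ∈ I m b a ∧ N (q s b a v - P) < 1}

lemma factsU {X : Set W} (hX : Pk X) (h0 : (0 : W) ∈ X) {b m a v s : ℝ} {P : W} (hb : 0 < b)
    (hm : 0 ≤ m) (hs : s = 1 ∨ s = -1) (hP : P ∈ X) (ha : 0 < a) (hv : v ∈ I m b a)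
    (hc : N (q s b a v - P) < 1) :
    0 < s * P 2 ∧ 0 ≤ P 0 + P 1 + s * P 2 - 2 ∧ P 0 + P 1 + s * P 2 - 2 < a ∧
    |(P 0 - P 1) - v| < 1 - |1 - (1 - s * P 2) - (a + b) / 2| ∧
    -1 + m < (P 0 - P 1) + (1 - s * P 2) ∧ (P 0 - P 1) - (1 - s * P 2) < 1 - b ∧
    -1 - b < P 0 + P 1 - 1 - s * P 2 ∧ P 0 + P 1 - 1 - s * P 2 < 1 - b := by
  have hs2 : |s| = 1 := by rcases hs with rfl | rfl <;> simp
  have hss : s * s = 1 := by rcases hs with rfl | rfl <;> simp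
  have hc' : |(1 + (a - b) / 2 + v) / 2 - P 0| + |(1 + (a - b) / 2 - v) / 2 - P 1|
      + |(a + b) / 2 - s * P 2| < 1 := by
    have e : |(a + b) / 2 - s * P 2| = |s * ((a + b) / 2) - P 2| := by
      have : (a + b) / 2 - s * P 2 = s * (s * ((a + b) / 2) - P 2) := by
        linear_combination (-(a+b)/2) * hss
      rw [this, abs_mul, hs2, one_mul]
    rw [e]; simpa [N, q] using hc
  have hne : P ≠ 0 := by
    rintro rfl
    simp only [Pi.zero_apply, mul_zero, sub_zero] at hc'
    have := le_abs_self ((1 + (a - b) / 2 + v) / 2)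
    have := le_abs_self ((1 + (a - b) / 2 - v) / 2)
    have := le_abs_self ((a + b) / 2)
    linarith
  have h2 := hX P hP 0 h0 hne
  have h3 : 2 ≤ |P 0| + |P 1| + |s * P 2| := by
    rw [abs_mul, hs2, one_mul]; simpa [N] using h2
  exact facts ha hb hm hv h3 hc'

lemma mkHyp {X : Set W} (hX : Pk X) (h0 : (0 : W) ∈ X) {A b m : ℝ} (hb : 0 < b) (hA1 : A ≤ 1)
    (hm : 0 ≤ m) (hAm : A ≤ m + b) :
    Hyp A b m (el 1 '' U X A b m 1) (el (-1) '' U X A b m (-1)) := by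
  have H1 : ∀ s : ℝ, (s = 1 ∨ s = -1) → ∀ P ∈ U X A b m s, (el s P).n < 1 ∧ 0 ≤ (el s P).g ∧
      (el s P).g < A ∧ -1 + m < (el s P).β + (el s P).n ∧ (el s P).β - (el s P).n < 1 - b ∧
      -1 - b < P 0 + P 1 - 1 - s * P 2 ∧ P 0 + P 1 - 1 - s * P 2 < 1 - b := by
    rintro s hs P ⟨hP, a, v, ha, haA, hv, hc⟩
    obtain ⟨f1, f2, f3, f4, f5, f6, f7, f8⟩ := factsU hX h0 hb hm hs hP ha hv hc
    refine ⟨?_, ?_, ?_, ?_, ?_, f7, f8⟩ <;> simp only [el] <;> linarith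
  have H2 : ∀ s : ℝ, (s = 1 ∨ s = -1) → ∀ P ∈ U X A b m s, ∀ Q ∈ U X A b m s, el s P ≠ el s Q →
      2 - |(el s P).n - (el s Q).n| ≤ |(el s P).β - (el s Q).β| := by
    intro s hs P hP Q hQ hne
    have hPQ : P ≠ Q := by rintro rfl; exact hne rfl
    have h2 := hX P hP.1 Q hQ.1 hPQ
    obtain ⟨p1, p2, p3, p4, p5, p6, p7⟩ := H1 s hs P hP
    obtain ⟨q1, q2, q3, q4, q5, q6, q7⟩ := H1 s hs Q hQ
    have hs2 : |s| = 1 := by rcases hs with rfl | rfl <;> simp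
    have e : |P 2 - Q 2| = |s * P 2 - s * Q 2| := by
      rw [← mul_sub, abs_mul, hs2, one_mul]
    simp only [N, Pi.sub_apply] at h2
    rw [e] at h2
    simp only [el] at *
    rw [show 1 - s * P 2 - (1 - s * Q 2) = -(s * P 2 - s * Q 2) by ring, abs_neg,
      show P 0 - P 1 - (Q 0 - Q 1) = (P 0 - Q 0) - (P 1 - Q 1) by ring]
    rcases sum_abs_or (P 0 - Q 0) (P 1 - Q 1) with h | h
    · exfalso
      rw [h] at h2
      rcases abs_cases (P 0 - Q 0 + (P 1 - Q 1)) with ⟨e, _⟩ | ⟨e, _⟩ <;>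
      rcases abs_cases (s * P 2 - s * Q 2) with ⟨e', _⟩ | ⟨e', _⟩ <;> linarith
    · linarith
  constructor
  · exact hb.le
  · exact hm
  · exact hAm
  · rintro x (⟨P, hP, rfl⟩ | ⟨P, hP, rfl⟩)
    · obtain ⟨p1, p2, p3, p4, p5, p6, p7⟩ := H1 1 (Or.inl rfl) P hP
      exact ⟨p1, p2, p3, p4, p5⟩
    · obtain ⟨p1, p2, p3, p4, p5, p6, p7⟩ := H1 (-1) (Or.inr rfl) P hP
      exact ⟨p1, p2, p3, p4, p5⟩
  · rintro _ ⟨P, hP, rfl⟩ _ ⟨Q, hQ, rfl⟩ hne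
    exact H2 1 (Or.inl rfl) P hP Q hQ hne
  · rintro _ ⟨P, hP, rfl⟩ _ ⟨Q, hQ, rfl⟩ hne
    exact H2 (-1) (Or.inr rfl) P hP Q hQ hne
  · rintro _ ⟨P, hP, rfl⟩ _ ⟨Q, hQ, rfl⟩
    obtain ⟨p1, p2, p3, p4, p5, p6, p7⟩ := H1 1 (Or.inl rfl) P hP
    obtain ⟨q1, q2, q3, q4, q5, q6, q7⟩ := H1 (-1) (Or.inr rfl) Q hQ
    simp only [el] at *
    have hPQ : P ≠ Q := by rintro rfl; linarith
    have h2 := hX P hP.1 Q hQ.1 hPQ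
    simp only [N, Pi.sub_apply] at h2
    rw [abs_of_pos (by linarith : 0 < P 2 - Q 2)] at h2
    rw [show P 0 - P 1 - (Q 0 - Q 1) = (P 0 - Q 0) - (P 1 - Q 1) by ring]
    rcases sum_abs_or (P 0 - Q 0) (P 1 - Q 1) with h | h
    · right
      rw [h] at h2
      rcases abs_cases (P 0 - Q 0 + (P 1 - Q 1)) with ⟨e, _⟩ | ⟨e, _⟩
      · left; linarith
      · right; linarith
    · left; linarith

theorem row {X : Set W} (hX : Pk X) (h0 : (0 : W) ∈ X) {A b m : ℝ} (hb : 0 < b) (hA1 : A ≤ 1)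
    (hm : 0 ≤ m) (hAm : A ≤ m + b) :
    ∃ t₁ t₂ t₃ : ℝ, 0 ≤ t₁ ∧ 0 ≤ t₂ ∧ 0 ≤ t₃ ∧ ∀ a, 0 < a → a < A →
    volume {v | v ∈ I m b a ∧ Cov X (q 1 b a v) ∧ Cov X (q (-1) b a v)} ≤
      ENNReal.ofReal (slot b t₁ a) + ENNReal.ofReal (slot b t₂ a) +
      ENNReal.ofReal (slot b t₃ a) := by
  obtain ⟨t₁, t₂, t₃, h1, h2, h3, h⟩ := comb (mkHyp hX h0 hb hA1 hm hAm)
  refine ⟨t₁, t₂, t₃, h1, h2, h3, fun a ha haA => (measure_mono ?_).trans (h a ha)⟩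
  rintro v ⟨hv, ⟨P, hP, hPc⟩, ⟨Q, hQ, hQc⟩⟩
  refine ⟨⟨_, ⟨P, ⟨hP, a, v, ha, haA, hv, hPc⟩, rfl⟩, ?_⟩,
    ⟨_, ⟨Q, ⟨hQ, a, v, ha, haA, hv, hQc⟩, rfl⟩, ?_⟩⟩
  · obtain ⟨f1, f2, f3, f4, f5, f6, f7, f8⟩ := factsU hX h0 hb hm (Or.inl rfl) hP ha hv hPc
    exact ⟨f3, f4⟩
  · obtain ⟨f1, f2, f3, f4, f5, f6, f7, f8⟩ := factsU hX h0 hb hm (Or.inr rfl) hQ ha hv hQc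
    exact ⟨f3, f4⟩

end Octa

namespace Octa

lemma lint_poly {l u : ℝ} (hlu : l ≤ u) {f : ℝ → ℝ} (hf : Continuous f)
    (h0 : ∀ x ∈ Set.Ioo l u, 0 ≤ f x) :
    ∫⁻ x in Set.Ioo l u, ENNReal.ofReal (f x) = ENNReal.ofReal (∫ x in l..u, f x) := by
  rw [intervalIntegral.integral_of_le hlu, integral_Ioc_eq_integral_Ioo]
  rw [ofReal_integral_eq_lintegral_ofReal]
  · exact (hf.integrableOn_Icc).mono_set Set.Ioo_subset_Icc_self
  · exact (ae_restrict_iff' measurableSet_Ioo).2 (Eventually.of_forall h0)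

lemma int_quad (l u c0 c1 c2 : ℝ) : ∫ x in l..u, (c0 + c1 * x + c2 * x ^ 2) =
    c0 * (u - l) + c1 * ((u ^ 2 - l ^ 2) / 2) + c2 * ((u ^ 3 - l ^ 3) / 3) := by
  rw [intervalIntegral.integral_add, intervalIntegral.integral_add]
  · simp only [intervalIntegral.integral_const_mul, intervalIntegral.integral_const, integral_id,
      integral_pow, smul_eq_mul]
    rw [show (fun x : ℝ => c1 * x) = fun x => c1 * x from rfl, intervalIntegral.integral_const_mul, integral_id]
    norm_num
    ring
  all_goals exact Continuous.intervalIntegrable (by fun_prop) _ _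

lemma slot_meas (b t : ℝ) : Measurable (fun a => ENNReal.ofReal (slot b t a)) := by
  unfold slot
  apply ENNReal.measurable_ofReal.comp
  exact Measurable.ite (measurableSet_lt measurable_const measurable_id) (by fun_prop) (by fun_prop)

lemma slot_int {A b t : ℝ} (hA : 0 ≤ A) (hb : 0 ≤ b) (ht : 0 ≤ t) :
    ∫⁻ a in Set.Ioo 0 A, ENNReal.ofReal (slot b t a) ≤
      ENNReal.ofReal (A ^ 2 / 2 + b * A + (max (A - b) 0) ^ 2 / 6) := by
  by_cases htA : A ≤ t
  · rw [setLIntegral_congr_fun (g := fun _ => 0) measurableSet_Ioo]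
    · simp
    · intro a ha
      have : ¬ t < a := by have := ha.2; linarith
      simp [slot, this]
  push Not at htA
  have : ∫⁻ a in Set.Ioo 0 A, ENNReal.ofReal (slot b t a) ≤
      ∫⁻ a in Set.Ioo t A, ENNReal.ofReal ((b + t) + 1 * a + 0 * a ^ 2) := by
    rw [← lintegral_indicator measurableSet_Ioo, ← lintegral_indicator measurableSet_Ioo]
    apply lintegral_mono
    intro a
    simp only [Set.indicator, slot]
    split_ifs with h1 h2 h3 h4 <;> simp_all
    · apply ENNReal.ofReal_le_ofReal; linarith
  refine this.trans ?_
  rw [lint_poly htA.le (by fun_prop) (fun x hx => by have := hx.1; nlinarith), int_quad]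
  apply ENNReal.ofReal_le_ofReal
  rcases le_total (A - b) 0 with h | h
  · rw [max_eq_right h]; nlinarith
  · rw [max_eq_left h]; nlinarith [sq_nonneg (3 * t - (A - b))]

noncomputable def Sb (A b : ℝ) : ℝ :=
  2 * A - 2 * A ^ 2 - 5 * b * A - max A b * A - (max (A - b) 0) ^ 2 / 2

def M (X : Set W) (A s b a : ℝ) : Set ℝ := {v | v ∈ I (max A b) b a ∧ ¬ Cov X (q s b a v)}

lemma fixb {X : Set W} (hX : Pk X) (h0 : (0 : W) ∈ X) {b : ℝ} (hb : 0 < b) (hbB : b < 26/100) :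
    ENNReal.ofReal (Sb (21/100) b) ≤
    ∫⁻ a in Set.Ioo 0 (21/100), (volume (M X (21/100) 1 b a) + volume (M X (21/100) (-1) b a)) := by
  set A : ℝ := 21/100 with hA
  set m := max A b with hm
  have hm1 : A ≤ m := le_max_left _ _
  have hm2 : m ≤ 26/100 := max_le (by rw [hA]; norm_num) hbB.le
  obtain ⟨t₁, t₂, t₃, h1, h2, h3, h⟩ := row hX h0 (A := A) (m := m) hb (by rw [hA]; norm_num)
    (by rw [hA] at hm1; linarith) (by linarith)
  have e1 : ∫⁻ a in Set.Ioo 0 A, ENNReal.ofReal ((2 - 2 * b - m) + (-1) * a + 0 * a ^ 2) =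
      ENNReal.ofReal (2 * A - A ^ 2 / 2 - 2 * b * A - m * A) := by
    rw [lint_poly (by rw [hA]; norm_num) (by fun_prop), int_quad]
    · congr 1; ring
    · intro x hx; have := hx.2; rw [hA] at this; linarith
  have e2 : ∫⁻ a in Set.Ioo 0 A, ENNReal.ofReal ((2 - 2 * b - m) + (-1) * a + 0 * a ^ 2) ≤
      ∫⁻ a in Set.Ioo 0 A, ((volume (M X A 1 b a) + volume (M X A (-1) b a)) +
       (ENNReal.ofReal (slot b t₁ a) + ENNReal.ofReal (slot b t₂ a) +
      ENNReal.ofReal (slot b t₃ a))) := by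
    apply setLIntegral_mono' measurableSet_Ioo
    intro a ha
    have e3 : ENNReal.ofReal ((2 - 2 * b - m) + (-1) * a + 0 * a ^ 2) = volume (I m b a) := by
      rw [I, Real.volume_Ioo]; congr 1; ring
    rw [e3]
    have e4 : I m b a ⊆ (M X A 1 b a ∪ M X A (-1) b a) ∪
      {v | v ∈ I m b a ∧ Cov X (q 1 b a v) ∧ Cov X (q (-1) b a v)} := by
      intro v hv
      simp only [M, Set.mem_union, Set.mem_ofPred_eq]
      tauto
    refine (measure_mono e4).trans ((measure_union_le _ _).trans ?_)
    exact add_le_add (measure_union_le _ _) (h a ha.1 ha.2)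
  rw [e1, lintegral_add_right _ (by
      exact ((slot_meas b t₁).add (slot_meas b t₂)).add (slot_meas b t₃)),
    lintegral_add_right _ (slot_meas b t₃), lintegral_add_right _ (slot_meas b t₂)] at e2
  have hA0 : 0 ≤ A := by rw [hA]; norm_num
  set K := A ^ 2 / 2 + b * A + (max (A - b) 0) ^ 2 / 6 with hK
  have hK0 : 0 ≤ K := by rw [hK]; positivity
  have e5 := e2.trans (add_le_add le_rfl (add_le_add (add_le_add (slot_int hA0 hb.le h1)
    (slot_int hA0 hb.le h2)) (slot_int hA0 hb.le h3)))
  rw [← hK, ← ENNReal.ofReal_add hK0 hK0, ← ENNReal.ofReal_add (by positivity) hK0] at e5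
  have e6 : Sb A b = (2 * A - A ^ 2 / 2 - 2 * b * A - m * A) - (K + K + K) := by
    rw [Sb, hK]; ring
  rw [e6, ENNReal.ofReal_sub _ (by positivity)]
  exact tsub_le_iff_right.2 e5

lemma Sb_int : ENNReal.ofReal (375/10000) ≤
    ∫⁻ b in Set.Ioo 0 (26/100), ENNReal.ofReal (Sb (21/100) b) := by
  have hsub : Set.Ioo (0:ℝ) (21/100) ∪ Set.Ioo (21/100) (26/100) ⊆ Set.Ioo 0 (26/100) := by
    rintro x (⟨h1, h2⟩ | ⟨h1, h2⟩) <;> constructor <;> linarith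
  refine le_trans ?_ (lintegral_mono_set hsub)
  rw [lintegral_union measurableSet_Ioo]
  · have e1 : ∫⁻ b in Set.Ioo 0 (21/100), ENNReal.ofReal (Sb (21/100) b) =
        ∫⁻ b in Set.Ioo 0 (21/100), ENNReal.ofReal (((2 * (21/100) - 3 * (21/100)^2 - (21/100)^2/2) : ℝ)
          + (-4 * (21/100)) * b + (-1/2) * b ^ 2) := by
      apply setLIntegral_congr_fun measurableSet_Ioo
      intro b hb
      simp only [Sb]
      rw [max_eq_left hb.2.le, max_eq_left (by linarith [hb.2])]
      congr 1; ring
    have e2 : ∫⁻ b in Set.Ioo (21/100) (26/100), ENNReal.ofReal (Sb (21/100) b) =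
        ∫⁻ b in Set.Ioo (21/100) (26/100), ENNReal.ofReal (((2 * (21/100) - 2 * (21/100)^2) : ℝ)
          + (-6 * (21/100)) * b + 0 * b ^ 2) := by
      apply setLIntegral_congr_fun measurableSet_Ioo
      intro b hb
      simp only [Sb]
      rw [max_eq_right hb.1.le, max_eq_right (by linarith [hb.1])]
      congr 1; ring
    rw [e1, e2, lint_poly (by norm_num) (by fun_prop), lint_poly (by norm_num) (by fun_prop),
      int_quad, int_quad, ← ENNReal.ofReal_add (by norm_num) (by norm_num)]
    · apply ENNReal.ofReal_le_ofReal; norm_num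
    · rintro x ⟨h1, h2⟩; linarith
    · rintro x ⟨h1, h2⟩; nlinarith
  · rw [Set.disjoint_left]; rintro x ⟨h1, h2⟩ ⟨h3, h4⟩; linarith

/-- coordinates -/
lemma mp3 : MeasurePreserving (fun p : W => ((p 0, p 1, p 2) : ℝ × ℝ × ℝ)) volume volume := by
  have h1 := volume_preserving_piFinSuccAbove (fun _ : Fin 3 => ℝ) 0
  have h2 := volume_preserving_finTwoArrow ℝ
  have h3 := (MeasurePreserving.id (volume : Measure ℝ)).prod h2
  have := h3.comp h1
  exact this

lemma cont_N : Continuous N := by unfold N; fun_prop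

lemma V_closed (X : Set W) : IsClosed {p | ¬ Cov X p} := by
  rw [← isOpen_compl_iff]
  have : {p | ¬ Cov X p}ᶜ = ⋃ x ∈ X, {p | N (p - x) < 1} := by
    ext p; simp [Cov]
  rw [this]
  refine isOpen_biUnion fun x _ => ?_
  exact isOpen_lt (cont_N.comp (by fun_prop)) continuous_const

def R : Set W := {p | (0 < p 0 + p 1 + |p 2| - 1 ∧ p 0 + p 1 + |p 2| - 1 < 21/100) ∧
  (0 < 1 - p 0 - p 1 + |p 2| ∧ 1 - p 0 - p 1 + |p 2| < 26/100) ∧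
  p 0 - p 1 ∈ I (max (21/100) (1 - p 0 - p 1 + |p 2|)) (1 - p 0 - p 1 + |p 2|)
    (p 0 + p 1 + |p 2| - 1)}

lemma R_meas : MeasurableSet R := by
  unfold R I
  simp only [Set.mem_Ioo, Set.ofPred_and]
  refine MeasurableSet.inter (MeasurableSet.inter ?_ ?_) (MeasurableSet.inter
    (MeasurableSet.inter ?_ ?_) (MeasurableSet.inter ?_ ?_)) <;>
  exact measurableSet_lt (by fun_prop) (by fun_prop)

noncomputable def Lm (s : ℝ) : Matrix (Fin 3) (Fin 3) ℝ :=
  !![-1/4, 1/4, 1/2; -1/4, 1/4, -1/2; s/2, s/2, 0]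

lemma Lm_det {s : ℝ} : (Lm s).det = -s/4 := by
  simp [Lm, Matrix.det_fin_three]; ring

lemma psi_eq (s : ℝ) (p : W) : q s (p 0) (p 1) (p 2) = Matrix.toLin' (Lm s) p + ![1/2, 1/2, 0] := by
  ext i
  fin_cases i <;> simp [q, Lm, Matrix.mulVec, dotProduct, Fin.sum_univ_three] <;> ring

lemma psi_vol {s : ℝ} (hs : s = 1 ∨ s = -1) {T : Set W} (hT : MeasurableSet T) :
    volume ((fun p : W => q s (p 0) (p 1) (p 2)) ⁻¹' T) = 4 * volume T := by
  have hd : (Lm s).det ≠ 0 := by rw [Lm_det]; rcases hs with rfl | rfl <;> norm_num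
  have h1 := Real.map_matrix_volume_pi_eq_smul_volume_pi hd
  have h2 : (fun p : W => q s (p 0) (p 1) (p 2)) ⁻¹' T =
    (Matrix.toLin' (Lm s)) ⁻¹' ((fun p => p + ![1/2, 1/2, 0]) ⁻¹' T) := by
    ext p; simp only [Set.mem_preimage, psi_eq]
  have hm : MeasurableSet ((fun p : W => p + ![1/2, 1/2, 0]) ⁻¹' T) := hT.preimage (by fun_prop)
  rw [h2, ← Measure.map_apply (LinearMap.continuous_of_finiteDimensional _).measurable hm, h1,
    Measure.smul_apply, measure_preimage_add_right, Lm_det, smul_eq_mul]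
  congr 1
  rcases hs with rfl | rfl <;> norm_num

def Z (X : Set W) (s : ℝ) : Set (ℝ × ℝ × ℝ) :=
  {p | (0 < p.1 ∧ p.1 < 26/100) ∧ (0 < p.2.1 ∧ p.2.1 < 21/100) ∧
    p.2.2 ∈ M X (21/100) s p.1 p.2.1}

lemma Z_meas (X : Set W) (s : ℝ) : MeasurableSet (Z X s) := by
  unfold Z M I
  simp only [Set.mem_Ioo, Set.mem_ofPred_eq, Set.ofPred_and]
  refine MeasurableSet.inter (MeasurableSet.inter ?_ ?_) (MeasurableSet.inter
    (MeasurableSet.inter ?_ ?_) (MeasurableSet.inter (MeasurableSet.inter ?_ ?_) ?_))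
  on_goal 7 => 
    have : Measurable (fun p : ℝ × ℝ × ℝ => q s p.1 p.2.1 p.2.2) := by
      unfold q
      rw [measurable_pi_iff]
      intro i
      fin_cases i <;> simp <;> fun_prop
    exact (V_closed X).measurableSet.preimage this
  all_goals exact measurableSet_lt (by fun_prop) (by fun_prop)

lemma Z_vol (X : Set W) {s : ℝ} (hs : s = 1 ∨ s = -1) :
    volume (Z X s) ≤ 4 * volume ({p | ¬ Cov X p} ∩ R ∩ {p | 0 < s * p 2}) := by
  have hm : MeasurableSet ({p | ¬ Cov X p} ∩ R ∩ {p | 0 < s * p 2}) :=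
    ((V_closed X).measurableSet.inter R_meas).inter (measurableSet_lt (by fun_prop) (by fun_prop))
  rw [← psi_vol hs hm, ← mp3.measure_preimage (Z_meas X s).nullMeasurableSet]
  apply measure_mono
  rintro p ⟨⟨h1, h2⟩, ⟨h3, h4⟩, h5, h6⟩
  simp only at h1 h2 h3 h4 h5 h6
  have hss : s * s = 1 := by rcases hs with rfl | rfl <;> simp
  have habs : |s * ((p 1 + p 0) / 2)| = (p 1 + p 0) / 2 := by
    rw [abs_mul, show |s| = 1 by rcases hs with rfl | rfl <;> simp, one_mul, abs_of_nonneg]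
    linarith
  set P := q s (p 0) (p 1) (p 2) with hP
  have e0 : P 0 = (1 + (p 1 - p 0) / 2 + p 2) / 2 := by simp [hP, q]
  have e1 : P 1 = (1 + (p 1 - p 0) / 2 - p 2) / 2 := by simp [hP, q]
  have e2 : P 2 = s * ((p 1 + p 0) / 2) := by simp [hP, q]
  have ea : P 0 + P 1 + |P 2| - 1 = p 1 := by rw [e0, e1, e2, habs]; ring
  have eb : 1 - P 0 - P 1 + |P 2| = p 0 := by rw [e0, e1, e2, habs]; ring
  have ev : P 0 - P 1 = p 2 := by rw [e0, e1]; ring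
  refine ⟨⟨h6, ?_⟩, ?_⟩
  · show P ∈ R
    simp only [R, Set.mem_ofPred_eq]
    rw [ea, eb, ev]
    exact ⟨⟨h3, h4⟩, ⟨h1, h2⟩, h5⟩
  · show 0 < s * P 2
    rw [e2, ← mul_assoc, hss]; linarith

theorem edge {X : Set W} (hX : Pk X) (h0 : (0 : W) ∈ X) :
    ENNReal.ofReal (375/10000) ≤ 4 * volume ({p | ¬ Cov X p} ∩ R) := by
  have hdis : volume ({p | ¬ Cov X p} ∩ R ∩ {p | 0 < (1:ℝ) * p 2}) +
      volume ({p | ¬ Cov X p} ∩ R ∩ {p | 0 < (-1:ℝ) * p 2}) ≤ volume ({p | ¬ Cov X p} ∩ R) := by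
    rw [← measure_union]
    · apply measure_mono; rintro p (h | h) <;> exact h.1
    · rw [Set.disjoint_left]; rintro p ⟨_, h⟩ ⟨_, h'⟩
      simp only [Set.mem_ofPred_eq] at h h'
      linarith
    · exact ((V_closed X).measurableSet.inter R_meas).inter
        (measurableSet_lt (by fun_prop) (by fun_prop))
  refine le_trans ?_ (mul_le_mul_right hdis 4)
  rw [mul_add]
  refine le_trans ?_ (add_le_add (Z_vol X (Or.inl rfl)) (Z_vol X (Or.inr rfl)))
  have hZ : ∀ s, volume (Z X s) = ∫⁻ b, ∫⁻ a, volume {v | (b, a, v) ∈ Z X s} := by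
    intro s
    rw [Measure.volume_eq_prod, Measure.prod_apply (Z_meas X s)]
    refine lintegral_congr fun b => ?_
    rw [Measure.volume_eq_prod, Measure.prod_apply ((Z_meas X s).preimage measurable_prodMk_left)]
    rfl
  have hms : ∀ s, Measurable (fun p : ℝ × ℝ => volume {v | (p.1, p.2, v) ∈ Z X s}) := by
    intro s
    have : MeasurableSet ((fun p : (ℝ × ℝ) × ℝ => (p.1.1, p.1.2, p.2)) ⁻¹' Z X s) :=
      (Z_meas X s).preimage (by fun_prop)
    exact measurable_measure_prodMk_left this
  have hms2 : ∀ s b, Measurable (fun a : ℝ => volume {v | (b, a, v) ∈ Z X s}) := fun s b =>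
    (hms s).comp (measurable_prodMk_left (x := b))
  rw [hZ, hZ, ← lintegral_add_left (Measurable.lintegral_prod_right (hms 1))]
  simp_rw [← lintegral_add_left (hms2 1 _)]
  refine Sb_int.trans ?_
  refine le_trans ?_ (setLIntegral_le_lintegral (Set.Ioo 0 (26/100)) _)
  apply setLIntegral_mono' measurableSet_Ioo
  intro b hb
  refine (fixb hX h0 hb.1 hb.2).trans ?_
  refine le_trans ?_ (setLIntegral_le_lintegral (Set.Ioo 0 (21/100)) _)
  apply setLIntegral_mono' measurableSet_Ioo
  intro a ha
  apply add_le_add <;> apply measure_mono <;> intro v hv <;> exact ⟨hb, ha, hv⟩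

end Octa

namespace Octa

lemma R_sub {p : W} (hp : p ∈ R) : |p 2| < p 1 ∧ |p 0 - 21/100| + |p 1| + |p 2| < 1 := by
  obtain ⟨⟨h1, h2⟩, ⟨h3, h4⟩, h5, h6⟩ := hp
  have hm := le_max_left (21/100) (1 - p 0 - p 1 + |p 2|)
  have h7 : |p 2| < p 1 := by linarith
  have := abs_nonneg (p 2)
  refine ⟨h7, ?_⟩
  rw [abs_of_pos (by linarith : 0 < p 1)]
  rcases abs_cases (p 0 - 21/100) with ⟨e, _⟩ | ⟨e, _⟩ <;> rw [e] <;> linarith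

/-- transport of the edge lemma -/
lemma edge_map (f : W → W) (hf : MeasurePreserving f volume volume) (hsub : ∀ p x, N (f p - f x) = N (p - x))
    (hf0 : f 0 = 0) {X : Set W} (hX : Pk X) (h0 : (0 : W) ∈ X) :
    ENNReal.ofReal (375/40000) ≤ volume ({p | ¬ Cov X p} ∩ f ⁻¹' R) := by
  have hX' : Pk (f '' X) := by
    rintro _ ⟨x, hx, rfl⟩ _ ⟨y, hy, rfl⟩ hne
    rw [hsub]
    exact hX x hx y hy (by rintro rfl; exact hne rfl)
  have h0' : (0 : W) ∈ f '' X := ⟨0, h0, hf0⟩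
  have he := edge hX' h0'
  have e1 : {p | ¬ Cov X p} ∩ f ⁻¹' R = f ⁻¹' ({p | ¬ Cov (f '' X) p} ∩ R) := by
    ext p
    simp [Cov, hsub]
  rw [e1, hf.measure_preimage ((V_closed _).measurableSet.inter R_meas).nullMeasurableSet]
  rw [show (375/10000 : ℝ) = 4 * (375/40000) by norm_num, ENNReal.ofReal_mul (by norm_num)] at he
  have h4 : ENNReal.ofReal 4 = 4 := by norm_num
  rw [h4] at he
  exact (ENNReal.mul_le_mul_iff_right (by norm_num) (by norm_num)).1 he

lemma mp_mat (Mx : Matrix (Fin 3) (Fin 3) ℝ) (hd : Mx.det = 1) :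
    MeasurePreserving (Matrix.toLin' Mx) (volume : Measure W) volume := by
  refine ⟨(LinearMap.continuous_of_finiteDimensional _).measurable, ?_⟩
  rw [Real.map_matrix_volume_pi_eq_smul_volume_pi (by rw [hd]; norm_num), hd]
  simp

def f0 (p : W) : W := p
def f1 (p : W) : W := ![p 0, -p 2, p 1]
def f2 (p : W) : W := ![p 0, -p 1, -p 2]
def f3 (p : W) : W := ![p 0, p 2, -p 1]

lemma mp1 : MeasurePreserving f1 volume volume := by
  have := mp_mat !![1, 0, 0; 0, 0, -1; 0, 1, 0] (by simp [Matrix.det_fin_three])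
  convert this using 1
  ext p i
  fin_cases i <;> simp [f1, Matrix.mulVec, dotProduct, Fin.sum_univ_three]

lemma mp2 : MeasurePreserving f2 volume volume := by
  have := mp_mat !![1, 0, 0; 0, -1, 0; 0, 0, -1] (by simp [Matrix.det_fin_three])
  convert this using 1
  ext p i
  fin_cases i <;> simp [f2, Matrix.mulVec, dotProduct, Fin.sum_univ_three]

lemma mp3' : MeasurePreserving f3 volume volume := by
  have := mp_mat !![1, 0, 0; 0, 0, 1; 0, -1, 0] (by simp [Matrix.det_fin_three])
  convert this using 1
  ext p i
  fin_cases i <;> simp [f3, Matrix.mulVec, dotProduct, Fin.sum_univ_three]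

lemma nn (a b : ℝ) : |-a - -b| = |a - b| ∧ |-a + b| = |a - b| := by
  constructor <;> rw [← abs_neg] <;> ring_nf

lemma vac0 {X : Set W} (hX : Pk X) (h0 : (0 : W) ∈ X) :
    ENNReal.ofReal (375/10000) ≤
      volume ({p | ¬ Cov X p} ∩ {p | N (p - ![21/100, 0, 0]) < 1}) := by
  have a0 := edge_map f0 (MeasurePreserving.id _) (fun p x => rfl) rfl hX h0
  have a1 := edge_map f1 mp1 (fun p x => by simp [N, f1, nn]; try ring_nf)
    (by ext i; fin_cases i <;> simp [f1]) hX h0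
  have a2 := edge_map f2 mp2 (fun p x => by simp [N, f2, nn]; try ring_nf)
    (by ext i; fin_cases i <;> simp [f2]) hX h0
  have a3 := edge_map f3 mp3' (fun p x => by simp [N, f3, nn]; try ring_nf)
    (by ext i; fin_cases i <;> simp [f3]) hX h0
  have hV := (V_closed X).measurableSet
  have m1 := hV.inter (R_meas.preimage mp1.measurable)
  have m2 := hV.inter (R_meas.preimage mp2.measurable)
  have m3 := hV.inter (R_meas.preimage mp3'.measurable)
  have key : volume ({p | ¬ Cov X p} ∩ f0 ⁻¹' R) + volume ({p | ¬ Cov X p} ∩ f1 ⁻¹' R) +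
      volume ({p | ¬ Cov X p} ∩ f2 ⁻¹' R) + volume ({p | ¬ Cov X p} ∩ f3 ⁻¹' R) ≤
      volume ({p | ¬ Cov X p} ∩ {p | N (p - ![21/100, 0, 0]) < 1}) := by
    rw [← measure_union _ m1, ← measure_union _ m2, ← measure_union _ m3]
    · apply measure_mono
      rintro p (((⟨hp, h⟩ | ⟨hp, h⟩) | ⟨hp, h⟩) | ⟨hp, h⟩) <;> refine ⟨hp, ?_⟩ <;>
        have h2 := (R_sub h).2 <;> 
        simp [N, f0, f1, f2, f3] at h2 ⊢ <;> linarith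
    · rw [Set.disjoint_left]
      rintro p ((⟨_, h⟩ | ⟨_, h⟩) | ⟨_, h⟩) ⟨_, h'⟩ <;>
        have h2 := (R_sub h).1 <;> have h3 := (R_sub h').1 <;>
        simp [f0, f1, f2, f3, abs_lt] at h2 h3 <;> linarith
    · rw [Set.disjoint_left]
      rintro p (⟨_, h⟩ | ⟨_, h⟩) ⟨_, h'⟩ <;>
        have h2 := (R_sub h).1 <;> have h3 := (R_sub h').1 <;>
        simp [f0, f1, f2, f3, abs_lt] at h2 h3 <;> linarith
    · rw [Set.disjoint_left]
      rintro p ⟨_, h⟩ ⟨_, h'⟩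
      have h2 := (R_sub h).1
      have h3 := (R_sub h').1
      simp [f0, f1, f2, f3, abs_lt] at h2 h3
      linarith
  refine le_trans ?_ (le_trans (add_le_add (add_le_add (add_le_add a0 a1) a2) a3) key)
  rw [← ENNReal.ofReal_add (by norm_num) (by norm_num),
    ← ENNReal.ofReal_add (by norm_num) (by norm_num),
    ← ENNReal.ofReal_add (by norm_num) (by norm_num)]
  apply ENNReal.ofReal_le_ofReal; norm_num

theorem vac {X : Set W} (hX : Pk X) {x : W} (hx : x ∈ X) :
    ENNReal.ofReal (375/10000) ≤
      volume ({p | ¬ Cov X p} ∩ {p | N (p - x - ![21/100, 0, 0]) < 1}) := by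
  set Y : Set W := (fun y => y - x) '' X with hY
  have hY1 : Pk Y := by
    rintro _ ⟨y, hy, rfl⟩ _ ⟨z, hz, rfl⟩ hne
    have := hX y hy z hz (by rintro rfl; exact hne rfl)
    simpa using this
  have h := vac0 hY1 ⟨x, hx, by simp⟩
  have e : {p | ¬ Cov X p} ∩ {p | N (p - x - ![21/100, 0, 0]) < 1} =
      (fun p => p - x) ⁻¹' ({p | ¬ Cov Y p} ∩ {p | N (p - ![21/100, 0, 0]) < 1}) := by
    ext p
    simp [Cov, hY]
  rw [e]
  have : volume ((fun p => p - x) ⁻¹' ({p | ¬ Cov Y p} ∩ {p | N (p - ![21/100, 0, 0]) < 1})) =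
    volume ({p | ¬ Cov Y p} ∩ {p | N (p - ![21/100, 0, 0]) < 1}) := by
    simp only [sub_eq_add_neg _ x]
    exact measure_preimage_add_right _ _ _
  rw [this]; exact h

end Octa

namespace Octa

abbrev E := EuclideanSpace ℝ (Fin 3)

def e (x : E) : W := WithLp.ofLp x

lemma e_mp : MeasurePreserving e volume volume := PiLp.volume_preserving_ofLp (Fin 3)

lemma vol_lt : volume {p : W | N p < 1} = ENNReal.ofReal (4/3) := by
  have h := MeasureTheory.volume_sum_rpow_lt_one (Fin 3) (p := 1) le_rfl
  have e1 : {x : W | ∑ i, |x i| ^ (1:ℝ) < 1} = {p : W | N p < 1} := by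
    ext p; simp [N, Fin.sum_univ_three]
  rw [e1] at h
  rw [h]
  congr 1
  have g1 : Real.Gamma (1 / 1 + 1) = 1 := by
    rw [show (1:ℝ) / 1 + 1 = 2 by norm_num]; exact Real.Gamma_two
  have g2 : Real.Gamma ((Fintype.card (Fin 3) : ℝ) / 1 + 1) = 6 := by
    have := Real.Gamma_nat_eq_factorial 3
    simp only [Fintype.card_fin, div_one]
    rw [this]; norm_num [Nat.factorial]
  rw [g1, g2]; norm_num

lemma vol_le : volume {p : W | N p ≤ 1} = ENNReal.ofReal (4/3) := by
  have h := MeasureTheory.volume_sum_rpow_le (Fin 3) (p := 1) le_rfl 1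
  have h' := MeasureTheory.volume_sum_rpow_lt (Fin 3) (p := 1) le_rfl 1
  rw [← h'] at h
  have e1 : {x : W | (∑ i, |x i| ^ (1:ℝ)) ^ (1 / 1 : ℝ) < 1} = {p : W | N p < 1} := by
    ext p; simp [N, Fin.sum_univ_three]
  have e2 : {x : W | (∑ i, |x i| ^ (1:ℝ)) ^ (1 / 1 : ℝ) ≤ 1} = {p : W | N p ≤ 1} := by
    ext p; simp [N, Fin.sum_univ_three]
  rw [e1, e2] at h
  rw [h, vol_lt]

lemma vol_shift {T : Set W} (c : W) : volume {p | p - c ∈ T} = volume T := by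
  have : {p | p - c ∈ T} = (fun p => p + -c) ⁻¹' T := by
    ext p; simp [sub_eq_add_neg]
  rw [this]; exact measure_preimage_add_right _ _ _

lemma N_tri (x y : W) : N (x + y) ≤ N x + N y := by
  unfold N
  have := abs_add_le (x 0) (y 0)
  have := abs_add_le (x 1) (y 1)
  have := abs_add_le (x 2) (y 2)
  simp only [Pi.add_apply]; linarith

lemma norm_le_N (x : E) : ‖x‖ ≤ N (e x) := by
  rw [EuclideanSpace.norm_eq, Fin.sum_univ_three]
  apply Real.sqrt_le_iff.2
  simp only [N, e, Real.norm_eq_abs]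
  have := abs_nonneg (x 0)
  have := abs_nonneg (x 1)
  have := abs_nonneg (x 2)
  refine ⟨by positivity, ?_⟩
  nlinarith [mul_nonneg (abs_nonneg (x 0)) (abs_nonneg (x 1)),
    mul_nonneg (abs_nonneg (x 0)) (abs_nonneg (x 2)), mul_nonneg (abs_nonneg (x 1)) (abs_nonneg (x 2))]

lemma packing_Pk {B : Set E} (hB : B = {x : E | |x 0| + |x 1| + |x 2| ≤ 1}) {X : Set E}
    (hX : IsTranslativePacking B X) : Pk (e '' X) := by
  rintro _ ⟨x, hx, rfl⟩ _ ⟨y, hy, rfl⟩ hne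
  by_contra hc
  push Not at hc
  have hd := hX x hx y hy (by rintro rfl; exact hne rfl)
  have hsub : {z : E | N (e z) < 1} ⊆ interior B := by
    apply interior_maximal
    · intro z hz; rw [hB]; exact (show N (e z) < 1 from hz).le
    · refine isOpen_lt (cont_N.comp ?_) continuous_const
      exact PiLp.continuous_ofLp 2 _
  rw [Set.disjoint_left] at hd
  refine hd (a := (1/2 : ℝ) • (x + y)) ⟨(1/2 : ℝ) • (y - x), hsub ?_, ?_⟩
    ⟨(1/2 : ℝ) • (x - y), hsub ?_, ?_⟩
  · have : N (e ((1/2 : ℝ) • (y - x))) = N (e x - e y) / 2 := by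
      simp only [N, e, PiLp.smul_apply, PiLp.sub_apply, Pi.sub_apply, smul_eq_mul, abs_mul]
      rw [abs_sub_comm (y 0), abs_sub_comm (y 1), abs_sub_comm (y 2)]
      rw [abs_of_pos (by norm_num : (0:ℝ) < 1/2)]; ring
    show N _ < 1
    rw [this]; linarith
  · simp only; module
  · have : N (e ((1/2 : ℝ) • (x - y))) = N (e x - e y) / 2 := by
      simp only [N, e, PiLp.smul_apply, PiLp.sub_apply, Pi.sub_apply, smul_eq_mul, abs_mul]
      rw [abs_of_pos (by norm_num : (0:ℝ) < 1/2)]; ring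
    show N _ < 1
    rw [this]; linarith
  · simp only; module

def tileW (Y : Set W) (x : W) : Set W :=
  {p | N (p - x) < 1} ∪ ({p | ¬ Cov Y p} ∩ {p | N (p - x - ![21/100, 0, 0]) < 1})

lemma m1 (c : W) : MeasurableSet {p : W | N (p - c) < 1} :=
  (isOpen_lt (cont_N.comp (by fun_prop)) continuous_const).measurableSet

lemma m2 (Y : Set W) (x : W) : MeasurableSet ({p | ¬ Cov Y p} ∩ {p | N (p - x - ![21/100, 0, 0]) < 1}) :=
  (V_closed Y).measurableSet.inter
    (isOpen_lt (cont_N.comp (by fun_prop)) continuous_const).measurableSet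

lemma tile_meas (Y : Set W) (x : W) : MeasurableSet (tileW Y x) := (m1 x).union (m2 Y x)

lemma tile_vol {Y : Set W} (hY : Pk Y) {x : W} (hx : x ∈ Y) :
    ENNReal.ofReal (4/3 + 375/10000) ≤ volume (tileW Y x) := by
  rw [tileW, measure_union _ (m2 Y x), ENNReal.ofReal_add (by norm_num) (by norm_num)]
  · refine add_le_add (le_of_eq ?_) (vac hY hx)
    rw [← vol_lt]; exact (vol_shift (T := {p | N p < 1}) x).symm
  · rw [Set.disjoint_left]
    rintro p hp ⟨h, _⟩
    exact h ⟨x, hx, hp⟩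

lemma N_disj {Y : Set W} (hY : Pk Y) {x y p c : W} (hx : x ∈ Y) (hy : y ∈ Y) (hne : x ≠ y)
    (h1 : N (p - x - c) < 1) (h2 : N (p - y - c) < 1) : False := by
  have h3 := hY x hx y hy hne
  have h4 := N_tri (p - y - c) (-(p - x - c))
  have h5 : N (-(p - x - c)) = N (p - x - c) := by
    simp only [N, Pi.neg_apply, abs_neg]
  rw [show p - y - c + -(p - x - c) = x - y by abel] at h4
  linarith

lemma tile_disj {Y : Set W} (hY : Pk Y) {x y : W} (hx : x ∈ Y) (hy : y ∈ Y) (hne : x ≠ y) :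
    Disjoint (tileW Y x) (tileW Y y) := by
  rw [Set.disjoint_left]
  rintro p (h | ⟨h, h'⟩) (k | ⟨k, k'⟩)
  · exact N_disj hY (c := 0) (p := p) hx hy hne (by simpa using h) (by simpa using k)
  · exact k ⟨x, hx, h⟩
  · exact h ⟨y, hy, k⟩
  · exact N_disj hY hx hy hne h' k'

lemma tile_sub {Y : Set W} {x p : W} (hp : p ∈ tileW Y x) : N (p - x) < 2 := by
  rcases hp with h | ⟨_, h⟩
  · have : N (p - x) < 1 := h
    linarith
  · have h' : N (p - x - ![21/100, 0, 0]) < 1 := h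
    have h4 := N_tri (p - x - ![21/100, 0, 0]) ![21/100, 0, 0]
    rw [sub_add_cancel] at h4
    have : N ![21/100, 0, 0] = 21/100 := by simp [N, abs_of_pos]
    linarith

/-- the main counting estimate -/
lemma count {B : Set E} (hB : B = {x : E | |x 0| + |x 1| + |x 2| ≤ 1}) {X : Set E}
    (hX : IsTranslativePacking B X) (c : E) (r : ℝ) :
    ∃ k : ℕ, volume (closedBall c r ∩ ⋃ x ∈ X, (fun z => x + z) '' B) ≤ k * ENNReal.ofReal (4/3) ∧
      k * ENNReal.ofReal (4/3 + 375/10000) ≤ volume (closedBall c (r + 4)) := by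
  have hY := packing_Pk hB hX
  have hBv : ∀ x : E, volume ((fun z => x + z) '' B) = ENNReal.ofReal (4/3) := by
    intro x
    rw [← vol_le, ← vol_shift (T := {p : W | N p ≤ 1}) (e x)]
    have hm : MeasurableSet {p | p - e x ∈ {p : W | N p ≤ 1}} :=
      (isClosed_le (cont_N.comp (by fun_prop : Continuous fun p : W => p - e x))
        continuous_const).measurableSet
    rw [← e_mp.measure_preimage hm.nullMeasurableSet]
    congr 1
    ext p
    constructor
    · rintro ⟨z, hz, rfl⟩
      rw [hB] at hz
      simpa [e, N] using hz
    · intro hp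
      refine ⟨p - x, ?_, by simp⟩
      rw [hB]
      simpa [e, N] using hp
  set F : Set E := {x | x ∈ X ∧ (closedBall c r ∩ (fun z => x + z) '' B).Nonempty} with hF
  have hbig : ∑' x : F, ENNReal.ofReal (4/3 + 375/10000) ≤ volume (closedBall c (r + 4)) := by
    have h1 : ∑' x : F, ENNReal.ofReal (4/3 + 375/10000) ≤
        ∑' x : F, volume (e ⁻¹' (tileW (e '' X) (e x))) := by
      apply ENNReal.tsum_le_tsum
      intro x
      rw [e_mp.measure_preimage (tile_meas _ _).nullMeasurableSet]
      exact tile_vol hY ⟨x, x.2.1, rfl⟩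
    refine h1.trans ((tsum_meas_le_meas_iUnion_of_disjoint volume
      (fun x => (tile_meas _ _).preimage e_mp.measurable) ?_).trans (measure_mono ?_))
    · intro x y hne
      apply Disjoint.preimage
      apply tile_disj hY ⟨x, x.2.1, rfl⟩ ⟨y, y.2.1, rfl⟩
      intro h
      apply hne
      apply Subtype.ext
      exact WithLp.ofLp_injective 2 h
    · intro p hp
      rw [Set.mem_iUnion] at hp
      obtain ⟨⟨x, hx, w, hw, z, hz, rfl⟩, hp⟩ := hp
      have h2 : ‖p - x‖ < 2 := lt_of_le_of_lt (norm_le_N _) (tile_sub hp)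
      have h3 : ‖z‖ ≤ 1 := by
        rw [hB] at hz
        exact (norm_le_N z).trans hz
      rw [mem_closedBall, dist_eq_norm] at hw ⊢
      have h4 : p - c = (p - x) + ((x + z - c) - z) := by abel
      have h5 := norm_add_le (p - x) ((x + z - c) - z)
      have h6 := norm_sub_le (x + z - c) z
      simp only at hw
      rw [h4]; linarith
  have hfin : Finite F := by
    by_contra hinf
    rw [not_finite_iff_infinite] at hinf
    rw [ENNReal.tsum_const_eq_top_of_ne_zero (by simp; norm_num)] at hbig
    exact (measure_closedBall_lt_top (μ := volume)).not_ge hbig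
  have := Fintype.ofFinite F
  refine ⟨Fintype.card F, ?_, ?_⟩
  · have h1 : closedBall c r ∩ ⋃ x ∈ X, (fun z => x + z) '' B ⊆ ⋃ x : F, (fun z => (x : E) + z) '' B := by
      rintro p ⟨hp, hp'⟩
      simp only [Set.mem_iUnion] at hp' ⊢
      obtain ⟨x, hx, hz⟩ := hp'
      exact ⟨⟨x, hx, p, hp, hz⟩, hz⟩
    refine (measure_mono h1).trans ((measure_iUnion_le _).trans (le_of_eq ?_))
    simp only [hBv]
    rw [tsum_fintype]; simp
  · rw [tsum_fintype] at hbig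
    simpa using hbig

lemma ratio {B : Set E} (hB : B = {x : E | |x 0| + |x 1| + |x 2| ≤ 1}) {X : Set E}
    (hX : IsTranslativePacking B X) (c : E) {r : ℝ} (hr : 100000 ≤ r) :
    (volume (closedBall c r ∩ ⋃ x ∈ X, (fun z => x + z) '' B) /
      volume (closedBall c r)).toReal ≤ 0.9730 := by
  obtain ⟨k, h1, h2⟩ := count hB hX c r
  have hfr : Module.finrank ℝ E = 3 := by simp [E]
  have v1 := Measure.addHaar_closedBall (volume : Measure E) c (by linarith : 0 ≤ r)
  have v2 := Measure.addHaar_closedBall (volume : Measure E) c (by linarith : 0 ≤ r + 4)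
  rw [hfr] at v1 v2
  have hκ0 : volume (ball (0 : E) 1) ≠ 0 := (measure_ball_pos _ _ one_pos).ne'
  have hκt : volume (ball (0 : E) 1) ≠ ⊤ := measure_ball_lt_top.ne
  set κ := (volume (ball (0 : E) 1)).toReal with hκ
  have hκp : 0 < κ := ENNReal.toReal_pos hκ0 hκt
  rw [ENNReal.toReal_div]
  have r1 : (volume (closedBall c r)).toReal = r ^ 3 * κ := by
    rw [v1, ENNReal.toReal_mul, ENNReal.toReal_ofReal (by positivity)]
  have r2 : (volume (closedBall c (r + 4))).toReal = (r + 4) ^ 3 * κ := by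
    have : 0 ≤ r + 4 := by linarith
    rw [v2, ENNReal.toReal_mul, ENNReal.toReal_ofReal (by positivity)]
  have h1' : (volume (closedBall c r ∩ ⋃ x ∈ X, (fun z => x + z) '' B)).toReal ≤ k * (4/3) := by
    have := ENNReal.toReal_mono (ENNReal.mul_ne_top (ENNReal.natCast_ne_top k) ENNReal.ofReal_ne_top) h1
    rwa [ENNReal.toReal_mul, ENNReal.toReal_natCast, ENNReal.toReal_ofReal (by norm_num)] at this
  have h2' : k * (4/3 + 375/10000) ≤ (r + 4) ^ 3 * κ := by
    have := ENNReal.toReal_mono measure_closedBall_lt_top.ne h2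
    rwa [ENNReal.toReal_mul, ENNReal.toReal_natCast, ENNReal.toReal_ofReal (by norm_num), r2] at this
  rw [r1, div_le_iff₀ (by positivity)]
  refine h1'.trans ?_
  have h3 : (r + 4) ^ 3 ≤ 1.0002 * r ^ 3 := by
    have : r + 4 ≤ 1.00004 * r := by linarith
    calc (r + 4) ^ 3 ≤ (1.00004 * r) ^ 3 := by gcongr; 
      _ = 1.00004 ^ 3 * r ^ 3 := by ring
      _ ≤ 1.0002 * r ^ 3 := by gcongr; norm_num
  have h4 : (r + 4) ^ 3 * κ ≤ 1.0002 * r ^ 3 * κ := by gcongr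
  have h5 : 0 < r ^ 3 * κ := by positivity
  linarith

end Octa

/-- Every translative packing of the regular octahedron `B¹₃` (unit ball of the `l¹`-norm)
has upper density at most `0.9730`. -/
theorem octahedron_translative_packing_bound
    (B : Set (EuclideanSpace ℝ (Fin 3)))
    (hB : B = {x : EuclideanSpace ℝ (Fin 3) | |x 0| + |x 1| + |x 2| ≤ 1})
    (X : Set (EuclideanSpace ℝ (Fin 3))) (hX : IsTranslativePacking B X) :
    packingUpperDensity B X ≤ 0.9730 := by
  unfold packingUpperDensity
  apply Filter.limsup_le_of_le
  · refine Filter.isCoboundedUnder_le_of_le (x := 0) (l := atTop) fun r => ?_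
    exact Real.iSup_nonneg fun c => ENNReal.toReal_nonneg
  · filter_upwards [eventually_ge_atTop 100000] with r hr
    exact ciSup_le fun c => Octa.ratio hB hX c hr
end
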